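/- Every 3-coloring of the edges of K_15 contains a 5-cycle in the first color or a 6-cycle in one of the other two colors; i.e., R(C_5, C_6, C_6) ≤ 15. -/

import Mathlib

open SimpleGraph

/-- `HasCopy H G` means the graph `H` contains a (not necessarily induced) copy of `G`. -/
def HasCopy {α β : Type*} (H : SimpleGraph α) (G : SimpleGraph β) : Prop :=
  ∃ f : β ↪ α, ∀ a b, G.Adj a b → H.Adj (f a) (f b)

/-- The graph consisting of the edges assigned color `i` by the edge coloring `c`. -/
def colorGraph {V : Type*} {k : ℕ} (c : Sym2 V → Fin k) (i : Fin k) : SimpleGraph V :=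
  SimpleGraph.fromRel (fun a b => c s(a, b) = i)

/-! ### The kernel-evaluated search

Everything below is written with raw recursors and raw `Nat` operations, so that the kernel evaluates it
quickly.  Vertices are labels `0, …, n - 1`; sets of vertices are bit masks. -/

noncomputable section

namespace CycleSearch

/-- Processed vertices: the bit of the label and the neighbourhood mask. -/
inductive Rows | nil | cons (b r : Nat) (t : Rows)

/-- Classes of unprocessed vertices.  A class is the interval of `cnt` labels starting at the label with
bit `b`; `lim` bounds the number of unprocessed neighbours, `m` is the mask of processed neighbours, `l`
lists them with their rows, `u1` (`u2`) is the mask of labels adjacent to at least one (two) of them. -/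
inductive Cls | nil | cons (b cnt lim m u1 u2 : Nat) (l : Rows) (t : Cls)

/-- Classes available as neighbours of the vertex being processed.  The flag `f` says whether the class
may contain vertices of maximal degree; `s` is the total size of the classes listed from here on. -/
inductive Avail | nil | cons (f b cnt lim m u1 u2 : Nat) (l : Rows) (s : Nat) (t : Avail)

/-- Classes in which neighbours have been chosen. -/
inductive Chosen | nil | cons (b m u1 u2 : Nat) (t : Chosen)

local notation "IF" c "THEN" a "ELSE" b => @Bool.rec (fun _ => Bool) b a c
local notation "IFN" c "THEN" a "ELSE" b => @Bool.rec (fun _ => Nat) b a c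
local notation "IFA" c "THEN" a "ELSE" b => @Bool.rec (fun _ => Avail) b a c
local notation "IFC" c "THEN" a "ELSE" b => @Bool.rec (fun _ => Cls) b a c
local notation "n0" => (nat_lit 0)
local notation "n1" => (nat_lit 1)

def adjMask (ba ra x y : Nat) : Nat := IFN Nat.beq (Nat.land ba x) n0 THEN n0 ELSE Nat.land ra y

/-- Labels that are interior vertices next to a processed vertex on a path of length three joining two
processed vertices with neighbourhoods `hw` and `hc`. -/
def midMask (P : Rows) (hw hc : Nat) : Nat :=
  @Rows.rec (fun _ => Nat) n0 (fun ba ra _ ih =>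
    IFN Nat.beq (Nat.land ba (Nat.lor hw hc)) n0 THEN ih ELSE
      Nat.lor ih (Nat.lor (adjMask ba ra hw hc) (adjMask ba ra hc hw))) P

def remove (x b : Nat) : Nat := Nat.xor x (Nat.land x b)

def pathFrom (P : Rows) (nav bw rw : Nat) (l : Rows) : Bool :=
  @Rows.rec (fun _ => Bool) false (fun bc rc _ ih =>
    IF Nat.beq bw bc THEN ih ELSE
    IF Nat.beq (Nat.land (midMask P (remove rw bc) (remove rc bw)) nav) n0 THEN ih ELSE true) l

def pathBetween (P : Rows) (nav : Nat) (lv lu : Rows) : Bool :=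
  @Rows.rec (fun _ => Bool) false (fun bw rw _ ih =>
    IF pathFrom P nav bw rw lu THEN true ELSE ih) lv

def clash (x m m' u2 u2' : Nat) : Bool :=
  IF Nat.beq x n0 THEN false ELSE
  IF Nat.beq (Nat.land m m') n0 THEN true ELSE
  IF Nat.beq (Nat.land x (Nat.lor u2 u2')) n0 THEN false ELSE true

def clashAny (nav m u1 u2 : Nat) (h : Chosen) : Bool :=
  @Chosen.rec (fun _ => Bool) false (fun b' m' u1' u2' _ ih =>
    IF clash (Nat.land (Nat.land u1 u1') (Nat.xor nav b')) m m' u2 u2' THEN true ELSE ih) h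

def size (a : Avail) : Nat := @Avail.rec (fun _ => Nat) n0 (fun _ _ _ _ _ _ _ _ s _ _ => s) a

def avCons (f b cnt lim m u1 u2 : Nat) (l : Rows) (t : Avail) : Avail :=
  Avail.cons f b cnt lim m u1 u2 l (Nat.add cnt (size t)) t

def avSelf (b cnt lim m u1 u2 : Nat) (l : Rows) (t : Avail) : Avail :=
  IFA Nat.beq cnt n0 THEN t ELSE avCons n1 b cnt lim m u1 u2 l t

def available (row bv : Nat) (C : Cls) : Nat → Avail :=
  @Cls.rec (fun _ => Nat → Avail) (fun _ => Avail.nil)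
    (fun b cnt lim m u1 u2 l _ ih f =>
      IFA Nat.beq (Nat.land row b) n0 THEN
        IFA Nat.beq b bv THEN avSelf b (Nat.sub cnt n1) lim m u1 u2 l (ih n1) ELSE
          avCons f b cnt lim m u1 u2 l (ih f)
      ELSE (IFA Nat.beq b bv THEN ih n1 ELSE ih f)) C

def unSelf (b cnt lim m u1 u2 : Nat) (l : Rows) (t : Cls) : Cls :=
  IFC Nat.beq cnt n0 THEN t ELSE Cls.cons b cnt lim m u1 u2 l t

def unavailable (row bv d : Nat) (C R : Cls) : Nat → Cls :=
  @Cls.rec (fun _ => Nat → Cls) (fun _ => R)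
    (fun b cnt lim m u1 u2 l _ ih f =>
      IFC Nat.beq (Nat.land row b) n0 THEN
        (IFC Nat.beq b bv THEN ih d ELSE ih f)
      ELSE
        IFC Nat.beq b bv THEN
          unSelf b (Nat.sub cnt n1) (Nat.sub lim (Nat.sub lim d)) m u1 u2 l (ih d)
        ELSE Cls.cons b cnt (Nat.sub lim (Nat.sub lim f)) m u1 u2 l (ih f)) C

def splitCls (k vb cap b cnt m u1 u2 : Nat) (l : Rows) (rv : Nat) (rest : Cls) : Cls :=
  Cls.cons b k (Nat.sub cap n1) (Nat.lor m vb) (Nat.lor u1 rv) (Nat.lor u2 (Nat.land u1 rv))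
    (Rows.cons vb rv l)
    (IFC Nat.beq k cnt THEN rest ELSE Cls.cons (Nat.shiftLeft b k) (Nat.sub cnt k) cap m u1 u2 l rest)

def maxCount (nav b m u1 u2 : Nat) (h : Chosen) (cnt left : Nat) : Nat :=
  IFN Nat.beq left n0 THEN n0 ELSE
  IFN clashAny (Nat.xor nav b) m u1 u2 h THEN n0 ELSE
  IFN Nat.beq cnt n1 THEN n1 ELSE
  IFN clash (Nat.land u1 (Nat.xor (Nat.xor nav b) (Nat.shiftLeft b n1))) m m u2 u2 THEN n1 ELSE
    Nat.sub cnt (Nat.sub cnt left)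

def tryCounts (vb cap b cnt m u1 u2 : Nat) (l : Rows) (K : Nat → Cls → Cls) (h : Chosen) (nb left : Nat)
    (ih : (Nat → Cls → Cls) → Chosen → Nat → Nat → Bool) (k : Nat) : Bool :=
  @Nat.rec (fun _ => Bool)
    (ih (fun rv rest => K rv (Cls.cons b cnt cap m u1 u2 l rest)) h nb left)
    (fun k ihk =>
      IF ihk THEN
        ih (fun rv rest => K rv (splitCls (Nat.succ k) vb cap b cnt m u1 u2 l rv rest))
          (Chosen.cons b m u1 u2 h) (Nat.lor nb (Nat.sub (Nat.shiftLeft b (Nat.succ k)) b))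
          (Nat.sub left (Nat.succ k))
      ELSE false) k

def choose (vb nav dm mv : Nat) (F : Nat → Cls → Bool) (a : Avail) :
    (Nat → Cls → Cls) → Chosen → Nat → Nat → Bool :=
  @Avail.rec (fun _ => (Nat → Cls → Cls) → Chosen → Nat → Nat → Bool)
    (fun K _ nb left =>
      IF Nat.beq left n0 THEN F (Nat.lor mv nb) (K (Nat.lor mv nb) Cls.nil) ELSE true)
    (fun f b cnt lim m u1 u2 l s _ ih K h nb left =>
      IF Nat.ble left s THEN
        tryCounts vb (Nat.sub lim (Nat.sub lim (Nat.add f dm))) b cnt m u1 u2 l K h nb left ih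
          (maxCount nav b m u1 u2 h cnt left)
      ELSE true) a

def degBound (C : Cls) (d : Nat) : Nat :=
  @Cls.rec (fun _ => Nat) n0 (fun _ cnt lim _ _ _ _ _ ih =>
    Nat.add (Nat.mul cnt (Nat.sub lim (Nat.sub lim d))) ih) C

/-- `f x`, with `x` evaluated first. -/
def eager (x : Nat) (f : Nat → Bool) : Bool := @Nat.rec (fun _ => Bool) false (fun n _ => f n) (Nat.succ x)

def tryDeg (C C' : Cls) (g : Nat) (body : Nat → Nat → Bool) (ih : Bool) (dm d : Nat) : Bool :=
  IF Nat.ble g (Nat.add (Nat.sub (degBound C dm) (degBound C' dm)) (degBound C' d)) THEN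
    (IF body dm d THEN ih ELSE false) ELSE true

def finish (leaf : Rows → Bool) (P : Rows) (g : Nat) : Bool :=
  IF Nat.beq g n0 THEN leaf P ELSE true

def degLoop (leaf : Rows → Bool) (P : Rows) (C C' : Cls) (g : Nat) (body : Nat → Nat → Bool)
    (lim : Nat) : Bool :=
  @Nat.rec (fun _ => Bool) (finish leaf P g) (fun dm ih =>
    eager (Nat.succ dm) (tryDeg C C' g body ih dm)) lim

def shiftUnit (b : Nat) : Nat := Nat.pow b (nat_lit 32)

def interval (b cnt : Nat) : Nat := Nat.sub (Nat.shiftLeft b cnt) b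

def digit (b cnt cnt' : Nat) : Nat := Nat.add (interval b cnt) (Nat.mul (nat_lit 65536) cnt')

def forbidPairs (full : Nat) (P : Rows) (b cnt lim : Nat) (l : Rows) (t : Cls) : Nat :=
  @Cls.rec (fun _ => Nat) n0 (fun b' cnt' lim' _ _ _ l' _ ih =>
    (fun w => IFN Nat.beq (Nat.mul lim lim') n0 THEN w ELSE
      IFN pathBetween P (Nat.xor full (Nat.lor b b')) l l' THEN w ELSE ih)
      (Nat.add (Nat.add (Nat.mul (shiftUnit b) (digit b' cnt' cnt'))
        (Nat.mul (shiftUnit b') (digit b cnt cnt))) ih)) t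

def forbidSelf (full : Nat) (P : Rows) (b cnt lim : Nat) (l : Rows) (x : Nat) : Nat :=
  IFN Nat.beq cnt n1 THEN x ELSE
    (fun w => IFN Nat.beq lim n0 THEN w ELSE
     IFN pathBetween P (Nat.xor full (Nat.lor b (Nat.shiftLeft b n1))) l l THEN w ELSE x)
     (Nat.add (Nat.mul (shiftUnit b) (digit b cnt (Nat.sub cnt n1))) x)

/-- The matrix of pairs of classes that span no edge.  The digit (in base `2 ^ 32`) at the first label of
a class holds the mask of the forbidden labels and, sixteen bits higher, their number. -/
def forbidden (full : Nat) (P : Rows) (C : Cls) : Nat :=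
  @Cls.rec (fun _ => Nat) n0 (fun b cnt lim _ _ _ l t ih =>
    forbidSelf full P b cnt lim l (Nat.add (forbidPairs full P b cnt lim l t) ih)) C

def clip (M r : Nat) (C : Cls) : Cls :=
  @Cls.rec (fun _ => Cls) Cls.nil (fun b cnt lim m u1 u2 l _ ih =>
    Cls.cons b cnt (Nat.sub lim (Nat.sub lim (Nat.sub r
      (Nat.land (Nat.div M (Nat.mul (shiftUnit b) (nat_lit 65536))) (nat_lit 65535))))) m u1 u2 l ih) C

def limSum (C : Cls) : Nat :=
  @Cls.rec (fun _ => Nat) n0 (fun _ cnt lim _ _ _ _ _ ih => Nat.add (Nat.mul cnt lim) ih) C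

def expand (leaf : Rows → Bool) (C C' : Cls) (P : Rows) (g vb nav b m row lim : Nat)
    (next : Cls → Rows → Nat → Bool) : Bool :=
  (fun A => degLoop leaf P C C' g (fun dm d =>
      choose vb nav dm m
        (fun rv R => next (unavailable row b d C R dm) (Rows.cons vb rv P)
          (Nat.sub g (Nat.mul (nat_lit 2) d))) A
        (fun _ r => r) Chosen.nil n0 d) lim)
    (available row b C n0)

def expandAll (leaf : Rows → Bool) (full M : Nat) (P : Rows) (g : Nat)
    (next : Cls → Rows → Nat → Bool) (C C' : Cls) : Bool :=
  @Cls.rec (fun _ => Bool) true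
    (fun b cnt lim m u1 u2 l t ih =>
      (fun vb =>
        IF expand leaf C (Cls.cons b cnt lim m u1 u2 l t) P g vb (Nat.xor full vb) b m
          (Nat.div M (shiftUnit b)) lim next THEN ih ELSE false)
       (Nat.shiftLeft b (Nat.sub cnt n1))) C'

def node (leaf : Rows → Bool) (full M : Nat) (P : Rows) (g : Nat)
    (next : Cls → Rows → Nat → Bool) (C : Cls) : Bool :=
  IF Nat.ble g (limSum C) THEN
    @Cls.rec (fun _ => Bool) (finish leaf P g)
      (fun _ _ _ _ _ _ _ _ _ => expandAll leaf full M P g next C C) C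
  ELSE true

def step (leaf : Rows → Bool) (full r : Nat) (next : Cls → Rows → Nat → Bool)
    (C : Cls) (P : Rows) (g : Nat) : Bool :=
  (fun M => node leaf full M P g next (clip M (Nat.sub r n1) C)) (forbidden full P C)

def search (leaf : Rows → Bool) (full fuel : Nat) : Cls → Rows → Nat → Bool :=
  @Nat.rec (fun _ => Cls → Rows → Nat → Bool) (fun _ _ _ => false)
    (fun r next => step leaf full r next) fuel

def within (lo hi : Nat) (next : Cls → Rows → Nat → Bool) (C : Cls) (P : Rows) (g : Nat) : Bool :=
  IF Nat.ble lo g THEN (IF Nat.ble g hi THEN next C P g ELSE true) ELSE true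

def start (n : Nat) : Cls := Cls.cons 1 n (n - 1) 0 0 0 Rows.nil Cls.nil

/-- The part of the search for `C₆`-free graphs on `15` vertices with `34` edges in which the number of
edges left after one and two steps lies in the given ranges. -/
def searchPart (lo hi lo' hi' : Nat) : Bool :=
  step (fun _ => false) (2 ^ 15 - 1) 15
    (within lo hi (step (fun _ => false) (2 ^ 15 - 1) 14
      (within lo' hi' (search (fun _ => false) (2 ^ 15 - 1) 14)))) (start 15) Rows.nil 68

section

open Classical in
/-- The number of neighbours of `z` in `U`. -/
noncomputable def degIn (H : SimpleGraph ℕ) (U : Finset ℕ) (z : ℕ) : ℕ := (U.filter (H.Adj z)).card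

def HasHexagon (H : SimpleGraph ℕ) : Prop :=
  ∃ a b c d e f, [a, b, c, d, e, f].Nodup ∧
    H.Adj a b ∧ H.Adj b c ∧ H.Adj c d ∧ H.Adj d e ∧ H.Adj e f ∧ H.Adj f a

structure Cell where
  (b cnt lim m u1 u2 : ℕ)
  l : Rows

namespace Cell

def first (c : Cell) : ℕ := Nat.log 2 c.b

/-- The labels in a class. -/
def labels (c : Cell) : Finset ℕ := Finset.Ico c.first (c.first + c.cnt)

theorem mem_labels {c : Cell} {x : ℕ} : x ∈ c.labels ↔ c.first ≤ x ∧ x < c.first + c.cnt :=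
  Finset.mem_Ico

end Cell

def Rows.toList : Rows → List (ℕ × ℕ)
  | nil => []
  | cons b r t => (b, r) :: t.toList

def Cls.toList : Cls → List Cell
  | nil => []
  | cons b cnt lim m u1 u2 l t => ⟨b, cnt, lim, m, u1, u2, l⟩ :: t.toList

def Avail.toList : Avail → List (ℕ × Cell)
  | nil => []
  | cons f b cnt lim m u1 u2 l _ t => (f, ⟨b, cnt, lim, m, u1, u2, l⟩) :: t.toList

structure Pick where
  (b m u1 u2 : ℕ)

def Chosen.toList : Chosen → List Pick
  | nil => []
  | cons b m u1 u2 t => ⟨b, m, u1, u2⟩ :: t.toList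

/-- `(b, r)` describes a processed vertex of `H` and its neighbourhood. -/
def IsRow (H : SimpleGraph ℕ) (U : Finset ℕ) (e : ℕ × ℕ) : Prop :=
  ∃ a, a ∉ U ∧ e.1 = 2 ^ a ∧ ∀ x, e.2.testBit x = true ↔ H.Adj a x

/-- `m`, `u1`, `u2` are the masks that belong to a vertex `x` of `H`. -/
structure MasksAt (H : SimpleGraph ℕ) (U : Finset ℕ) (m u1 u2 x : ℕ) : Prop where
  adj : ∀ p, m.testBit p = true ↔ p ∉ U ∧ H.Adj x p
  one : ∀ y, u1.testBit y = true → ∃ p, m.testBit p = true ∧ H.Adj p y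
  two : ∀ y, u2.testBit y = true → ∃ p q, p ≠ q ∧ m.testBit p = true ∧ m.testBit q = true ∧
    H.Adj p y ∧ H.Adj q y

structure Cell.Valid (H : SimpleGraph ℕ) (U : Finset ℕ) (c : Cell) : Prop where
  pos : 0 < c.cnt
  bit : c.b = 2 ^ c.first
  masks : ∀ x ∈ c.labels, MasksAt H U c.m c.u1 c.u2 x
  rows : ∀ e ∈ c.l.toList, IsRow H U e
  rows_mem : ∀ e ∈ c.l.toList, ∀ a, e.1 = 2 ^ a → c.m.testBit a = true
  deg : ∀ x ∈ c.labels, degIn H U x ≤ c.lim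

def labelSum (L : List Cell) : Multiset ℕ := (L.map fun c => c.labels.val).sum

/-- `H` is compatible with a state of the search. -/
structure Compat (n : ℕ) (H : SimpleGraph ℕ) (U : Finset ℕ) (L : List Cell) (P : Rows) (g : ℕ) :
    Prop where
  lt : ∀ a b, H.Adj a b → a < n
  rows : ∀ e ∈ P.toList, IsRow H U e
  processed : ∀ a < n, a ∉ U → ∃ e ∈ P.toList, e.1 = 2 ^ a
  unprocessed : ∀ a ∈ U, a < n
  labels : labelSum L = U.val
  valid : ∀ c ∈ L, c.Valid H U
  edges : g ≤ ∑ z ∈ U, degIn H U z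

section swap

/-- `H` with the labels `x` and `y` exchanged. -/
def swapped (H : SimpleGraph ℕ) (x y : ℕ) : SimpleGraph ℕ := H.comap (Equiv.swap x y)

variable {H : SimpleGraph ℕ} {x y : ℕ}

@[simp] theorem swapped_adj {a b : ℕ} :
    (swapped H x y).Adj a b ↔ H.Adj (Equiv.swap x y a) (Equiv.swap x y b) := Iff.rfl

theorem swap_of_notMem {U : Finset ℕ} (hx : x ∈ U) (hy : y ∈ U) {p : ℕ} (hp : p ∉ U) :
    Equiv.swap x y p = p :=
  Equiv.swap_apply_of_ne_of_ne (by rintro rfl; exact hp hx) (by rintro rfl; exact hp hy)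

theorem swap_mem {U : Finset ℕ} (h : x ∈ U ↔ y ∈ U) {p : ℕ} :
    Equiv.swap x y p ∈ U ↔ p ∈ U := by
  rcases eq_or_ne p x with rfl | h1
  · simp [h]
  rcases eq_or_ne p y with rfl | h2
  · simp [h]
  rw [Equiv.swap_apply_of_ne_of_ne h1 h2]

theorem degIn_swapped {U : Finset ℕ} (h : x ∈ U ↔ y ∈ U) (z : ℕ) :
    degIn (swapped H x y) U z = degIn H U (Equiv.swap x y z) := by
  classical
  unfold degIn
  refine Finset.card_bij (fun a _ => Equiv.swap x y a) ?_ ?_ ?_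
  · intro a ha
    simp only [Finset.mem_filter, swapped_adj] at ha ⊢
    exact ⟨(swap_mem h).2 ha.1, ha.2⟩
  · intro a _ b _ hab
    exact (Equiv.swap x y).injective hab
  · intro b hb
    refine ⟨Equiv.swap x y b, ?_, by simp⟩
    simp only [Finset.mem_filter, swapped_adj, Equiv.swap_apply_self] at hb ⊢
    exact ⟨(swap_mem h).2 hb.1, hb.2⟩

theorem IsRow.swapped {U : Finset ℕ} (hx : x ∈ U) (hy : y ∈ U)
    (hxy : ∀ p ∉ U, H.Adj x p ↔ H.Adj y p) {e : ℕ × ℕ} (h : IsRow H U e) :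
    IsRow (swapped H x y) U e := by
  obtain ⟨a, ha, h1, h2⟩ := h
  refine ⟨a, ha, h1, fun z => ?_⟩
  rw [h2, swapped_adj, swap_of_notMem hx hy ha]
  rcases eq_or_ne z x with rfl | hzx
  · rw [Equiv.swap_apply_left, H.adj_comm, hxy a ha, H.adj_comm]
  rcases eq_or_ne z y with rfl | hzy
  · rw [Equiv.swap_apply_right, H.adj_comm, ← hxy a ha, H.adj_comm]
  rw [Equiv.swap_apply_of_ne_of_ne hzx hzy]

theorem adj_swapped_of_notMem {U : Finset ℕ} (hx : x ∈ U) (hy : y ∈ U)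
    (hxy : ∀ p ∉ U, H.Adj x p ↔ H.Adj y p) {p z : ℕ} (hp : p ∉ U) :
    (swapped H x y).Adj p z ↔ H.Adj p z := by
  rw [swapped_adj, swap_of_notMem hx hy hp]
  rcases eq_or_ne z x with rfl | hzx
  · rw [Equiv.swap_apply_left, H.adj_comm, ← hxy p hp, H.adj_comm]
  rcases eq_or_ne z y with rfl | hzy
  · rw [Equiv.swap_apply_right, H.adj_comm, hxy p hp, H.adj_comm]
  rw [Equiv.swap_apply_of_ne_of_ne hzx hzy]

theorem MasksAt.swapped {U : Finset ℕ} (hx : x ∈ U) (hy : y ∈ U)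
    (hxy : ∀ p ∉ U, H.Adj x p ↔ H.Adj y p) {m u1 u2 z : ℕ} (h : MasksAt H U m u1 u2 z) :
    MasksAt (swapped H x y) U m u1 u2 z := by
  have key : ∀ p, p ∉ U → ∀ z, (CycleSearch.swapped H x y).Adj p z ↔ H.Adj p z := fun p hp z =>
    adj_swapped_of_notMem hx hy hxy hp
  have hm : ∀ p, m.testBit p = true → p ∉ U := fun p hp => ((h.adj p).1 hp).1
  refine ⟨fun p => ?_, fun w hw => ?_, fun w hw => ?_⟩
  · rw [h.adj]
    refine and_congr_right fun hp => ?_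
    rw [SimpleGraph.adj_comm, ← key p hp, SimpleGraph.adj_comm]
  · obtain ⟨p, hp, hpw⟩ := h.one w hw
    exact ⟨p, hp, (key p (hm p hp) w).2 hpw⟩
  · obtain ⟨p, q, hpq, hp, hq, hpw, hqw⟩ := h.two w hw
    exact ⟨p, q, hpq, hp, hq, (key p (hm p hp) w).2 hpw, (key q (hm q hq) w).2 hqw⟩

end swap

@[simp] theorem labelSum_nil : labelSum [] = 0 := rfl

@[simp] theorem labelSum_cons (c : Cell) (L : List Cell) :
    labelSum (c :: L) = c.labels.val + labelSum L := by simp [labelSum]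

@[simp] theorem labelSum_append (L L' : List Cell) :
    labelSum (L ++ L') = labelSum L + labelSum L' := by simp [labelSum]

theorem mem_labelSum {L : List Cell} {x : ℕ} : x ∈ labelSum L ↔ ∃ c ∈ L, x ∈ c.labels := by
  induction L with
  | nil => simp
  | cons c L ih => simp [ih]

/-- A class meeting a class of the list in `x` and `y` contains both or none of them. -/
theorem labels_iff_of_nodup {L : List Cell} (h : (labelSum L).Nodup) {c : Cell} (hc : c ∈ L) {x y : ℕ}
    (hx : x ∈ c.labels) (hy : y ∈ c.labels) : ∀ c' ∈ L, x ∈ c'.labels ↔ y ∈ c'.labels := by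
  induction L with
  | nil => simp at hc
  | cons c₀ L ih =>
    rw [labelSum_cons, Multiset.nodup_add] at h
    obtain ⟨-, h2, h3⟩ := h
    rw [Multiset.disjoint_left] at h3
    intro c' hc'
    rcases List.mem_cons.1 hc with rfl | hc₁ <;> rcases List.mem_cons.1 hc' with rfl | hc₂
    · simp [hx, hy]
    · exact iff_of_false (fun hx' => h3 hx (mem_labelSum.2 ⟨c', hc₂, hx'⟩))
        (fun hy' => h3 hy (mem_labelSum.2 ⟨c', hc₂, hy'⟩))
    · exact iff_of_false (fun hx' => h3 hx' (mem_labelSum.2 ⟨c, hc₁, hx⟩))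
        (fun hy' => h3 hy' (mem_labelSum.2 ⟨c, hc₁, hy⟩))
    · exact ih h2 hc₁ c' hc₂

section swap

variable {n : ℕ} {H : SimpleGraph ℕ} {U : Finset ℕ} {L : List Cell} {P : Rows} {g : ℕ}

theorem Compat.mem (h : Compat n H U L P g) {c : Cell} (hc : c ∈ L) {x : ℕ} (hx : x ∈ c.labels) :
    x ∈ U := by
  rw [← Finset.mem_val, ← h.labels]
  exact mem_labelSum.2 ⟨c, hc, hx⟩

theorem Compat.exists_cell (h : Compat n H U L P g) {x : ℕ} (hx : x ∈ U) :
    ∃ c ∈ L, x ∈ c.labels := by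
  rw [← Finset.mem_val, ← h.labels] at hx
  exact mem_labelSum.1 hx

theorem Compat.nodup (h : Compat n H U L P g) : (labelSum L).Nodup := h.labels ▸ U.nodup

theorem Compat.twins (h : Compat n H U L P g) {c : Cell} (hc : c ∈ L) {x y : ℕ} (hx : x ∈ c.labels)
    (hy : y ∈ c.labels) : ∀ p ∉ U, H.Adj x p ↔ H.Adj y p := fun p hp => by
  have h1 := ((h.valid c hc).masks x hx).adj p
  have h2 := ((h.valid c hc).masks y hy).adj p
  simp only [hp, not_false_eq_true, true_and] at h1 h2
  rw [← h1, ← h2]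

theorem Compat.swapped (h : Compat n H U L P g) {c : Cell} (hc : c ∈ L) {x y : ℕ} (hx : x ∈ c.labels)
    (hy : y ∈ c.labels) : Compat n (swapped H x y) U L P g := by
  have hxU := h.mem hc hx
  have hyU := h.mem hc hy
  have hxy := h.twins hc hx hy
  have hU : x ∈ U ↔ y ∈ U := iff_of_true hxU hyU
  refine ⟨fun a b hab => ?_, fun e he => (h.rows e he).swapped hxU hyU hxy, h.processed, h.unprocessed,
    h.labels, fun c' hc' => ?_, ?_⟩
  · have := h.lt _ _ hab
    by_cases ha : a ∈ U
    · exact h.unprocessed a ha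
    · rwa [swap_of_notMem hxU hyU ha] at this
  · have v := h.valid c' hc'
    refine ⟨v.pos, v.bit, fun z hz => (v.masks z hz).swapped hxU hyU hxy,
      fun e he => (v.rows e he).swapped hxU hyU hxy, v.rows_mem, fun z hz => ?_⟩
    rw [degIn_swapped hU]
    refine v.deg _ ?_
    rwa [swap_mem (labels_iff_of_nodup h.nodup hc hx hy c' hc')]
  · rw [Finset.sum_congr rfl fun z _ => degIn_swapped hU z]
    refine h.edges.trans_eq (Finset.sum_bij (fun a _ => Equiv.swap x y a) ?_ ?_ ?_ ?_)
    · exact fun a ha => (swap_mem hU).2 ha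
    · exact fun a _ b _ hab => (Equiv.swap x y).injective hab
    · exact fun b hb => ⟨Equiv.swap x y b, (swap_mem hU).2 hb, by simp⟩
    · simp

/-- The neighbours of `v` come first in each class, disregarding `v` itself. -/
def NbrsFirst (H : SimpleGraph ℕ) (L : List Cell) (v : ℕ) : Prop :=
  ∀ c ∈ L, ∀ x ∈ c.labels, ∀ y ∈ c.labels, x < y → x ≠ v → H.Adj v y → H.Adj v x

theorem sum_nbrs_swapped_lt {v x y : ℕ} (hxy : x < y) (hxv : x ≠ v) (hx : x ∈ U) (hy : y ∈ U)
    (hvy : H.Adj v y) (hvx : ¬ H.Adj v x) [DecidableRel H.Adj]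
    [DecidableRel (CycleSearch.swapped H x y).Adj] :
    ∑ z ∈ U with (CycleSearch.swapped H x y).Adj v z, z < ∑ z ∈ U with H.Adj v z, z := by
  have hyv : v ≠ y := H.ne_of_adj hvy
  have hv : Equiv.swap x y v = v := Equiv.swap_apply_of_ne_of_ne hxv.symm hyv
  have e1 : (U.filter fun z => (CycleSearch.swapped H x y).Adj v z) =
      insert x ((U.filter fun z => H.Adj v z).erase y) := by
    ext z
    simp only [Finset.mem_filter, swapped_adj, hv, Finset.mem_insert, Finset.mem_erase]
    rcases eq_or_ne z x with rfl | h1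
    · simp [hx, hvy]
    rcases eq_or_ne z y with rfl | h2
    · simp [hvx, h1]
    rw [Equiv.swap_apply_of_ne_of_ne h1 h2]
    simp [h1, h2]
  have hy' : y ∈ U.filter fun z => H.Adj v z := by simp [hy, hvy]
  rw [e1, Finset.sum_insert (by simp [hvx]), ← Finset.add_sum_erase _ _ hy']
  omega

theorem Compat.exists_nbrsFirst (Q : SimpleGraph ℕ → Prop) {v : ℕ}
    (hQ : ∀ H, Compat n H U L P g → Q H → ∀ c ∈ L, ∀ x ∈ c.labels, ∀ y ∈ c.labels, x ≠ v → y ≠ v →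
      Q (CycleSearch.swapped H x y))
    (h : Compat n H U L P g) (hH : Q H) : ∃ H', Compat n H' U L P g ∧ Q H' ∧ NbrsFirst H' L v := by
  classical
  by_contra! hcon
  suffices key : ∀ k H, Compat n H U L P g → Q H → ∑ z ∈ U with H.Adj v z, z ≠ k from
    key _ H h hH rfl
  intro k
  induction k using Nat.strong_induction_on with
  | _ k ih =>
    intro H h hH hk
    have := hcon H h hH
    simp only [NbrsFirst, not_forall] at this
    obtain ⟨c, hc, x, hx, y, hy, hxy, hxv, hvy, hvx⟩ := this
    refine ih _ ?_ (CycleSearch.swapped H x y) (h.swapped hc hx hy)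
      (hQ H h hH c hc x hx y hy hxv (H.ne_of_adj hvy).symm) rfl
    rw [← hk]
    exact sum_nbrs_swapped_lt hxy hxv (h.mem hc hx) (h.mem hc hy) hvy hvx

end swap

end

section

/-! ### Paths of length five -/

theorem rec_eq_ite {α : Sort*} (c : Bool) (a b : α) :
    @Bool.rec (fun _ => α) b a c = if c = true then a else b := by cases c <;> rfl

theorem two_pow_land_eq_zero {a x : ℕ} : Nat.land (2 ^ a) x = 0 ↔ x.testBit a = false := by
  change 2 ^ a &&& x = 0 ↔ _
  rw [Nat.two_pow_and]
  cases x.testBit a <;> simp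

theorem land_two_pow_eq_zero {a x : ℕ} : Nat.land x (2 ^ a) = 0 ↔ x.testBit a = false := by
  change x &&& 2 ^ a = 0 ↔ _
  rw [Nat.and_two_pow]
  cases x.testBit a <;> simp

theorem exists_testBit_of_ne_zero {x : ℕ} (h : x ≠ 0) : ∃ i, x.testBit i = true :=
  Nat.exists_testBit_of_ne_zero h

theorem testBit_land {x y i : ℕ} : (Nat.land x y).testBit i = (x.testBit i && y.testBit i) :=
  Nat.testBit_and x y i

theorem testBit_lor {x y i : ℕ} : (Nat.lor x y).testBit i = (x.testBit i || y.testBit i) :=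
  Nat.testBit_or x y i

theorem testBit_xor {x y i : ℕ} : (Nat.xor x y).testBit i = (x.testBit i ^^ y.testBit i) :=
  Nat.testBit_xor x y i

theorem testBit_remove {x b i : ℕ} : (remove x b).testBit i = (x.testBit i && !b.testBit i) := by
  unfold remove
  rw [testBit_xor, testBit_land]
  cases x.testBit i <;> cases b.testBit i <;> rfl

theorem adjMask_eq (ba ra x y : ℕ) :
    adjMask ba ra x y = if Nat.land ba x = 0 then 0 else Nat.land ra y := by
  change (IFN Nat.beq (Nat.land ba x) 0 THEN 0 ELSE Nat.land ra y) = _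
  simp only [rec_eq_ite, Nat.beq_eq]

theorem testBit_adjMask {a ra x y i : ℕ} :
    (adjMask (2 ^ a) ra x y).testBit i = (x.testBit a && ra.testBit i && y.testBit i) := by
  simp only [adjMask_eq, two_pow_land_eq_zero]
  cases x.testBit a
  · simp
  · simp only [Bool.true_eq_false, if_false, testBit_land, Bool.true_and]

theorem midMask_cons (ba ra : ℕ) (t : Rows) (hw hc : ℕ) : midMask (.cons ba ra t) hw hc =
    if Nat.land ba (Nat.lor hw hc) = 0 then midMask t hw hc else
      Nat.lor (midMask t hw hc) (Nat.lor (adjMask ba ra hw hc) (adjMask ba ra hc hw)) := by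
  change (IFN Nat.beq (Nat.land ba (Nat.lor hw hc)) 0 THEN midMask t hw hc ELSE
    Nat.lor (midMask t hw hc) (Nat.lor (adjMask ba ra hw hc) (adjMask ba ra hc hw))) = _
  simp only [rec_eq_ite, Nat.beq_eq]

variable {n : ℕ} {H : SimpleGraph ℕ} {U : Finset ℕ}

theorem of_testBit_midMask {P : Rows} (hP : ∀ e ∈ P.toList, IsRow H U e) {hw hc i : ℕ}
    (h : (midMask P hw hc).testBit i = true) :
    ∃ a, a ∉ U ∧ H.Adj a i ∧
      (hw.testBit a = true ∧ hc.testBit i = true ∨ hc.testBit a = true ∧ hw.testBit i = true) := by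
  induction P with
  | nil => simp [midMask] at h
  | cons ba ra t ih =>
    have ht : ∀ e ∈ t.toList, IsRow H U e := fun e he => hP e (List.mem_cons_of_mem _ he)
    rw [midMask_cons] at h
    split_ifs at h with h0
    · exact ih ht h
    obtain ⟨a, ha, h1, h2⟩ := hP (ba, ra) List.mem_cons_self
    obtain rfl : ba = 2 ^ a := h1
    simp only [testBit_lor, testBit_adjMask, Bool.or_eq_true, Bool.and_eq_true] at h
    rcases h with h | ⟨⟨h3, h4⟩, h5⟩ | ⟨⟨h3, h4⟩, h5⟩
    · exact ih ht h
    · exact ⟨a, ha, (h2 i).1 h4, .inl ⟨h3, h5⟩⟩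
    · exact ⟨a, ha, (h2 i).1 h4, .inr ⟨h3, h5⟩⟩

theorem pathFrom_cons (P : Rows) (nav bw rw bc rc : ℕ) (t : Rows) :
    pathFrom P nav bw rw (.cons bc rc t) = if bw = bc then pathFrom P nav bw rw t else
      if Nat.land (midMask P (remove rw bc) (remove rc bw)) nav = 0 then pathFrom P nav bw rw t
      else true := by
  change (IF Nat.beq bw bc THEN pathFrom P nav bw rw t ELSE
    IF Nat.beq (Nat.land (midMask P (remove rw bc) (remove rc bw)) nav) 0 THEN pathFrom P nav bw rw t
    ELSE true) = _
  simp only [rec_eq_ite, Nat.beq_eq]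

theorem of_pathFrom {P : Rows} {nav bw rw : ℕ} {l : Rows} (h : pathFrom P nav bw rw l = true) :
    ∃ e ∈ l.toList, bw ≠ e.1 ∧ ∃ i, nav.testBit i = true ∧
      (midMask P (remove rw e.1) (remove e.2 bw)).testBit i = true := by
  induction l with
  | nil => simp [pathFrom] at h
  | cons bc rc t ih =>
    rw [pathFrom_cons] at h
    split_ifs at h with h1 h2
    · obtain ⟨e, he, h⟩ := ih h
      exact ⟨e, List.mem_cons_of_mem _ he, h⟩
    · obtain ⟨e, he, h⟩ := ih h
      exact ⟨e, List.mem_cons_of_mem _ he, h⟩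
    · obtain ⟨i, hi⟩ := exists_testBit_of_ne_zero h2
      rw [testBit_land, Bool.and_eq_true] at hi
      exact ⟨(bc, rc), List.mem_cons_self, h1, i, hi.2, hi.1⟩

theorem pathBetween_cons (P : Rows) (nav bw rw : ℕ) (t lu : Rows) :
    pathBetween P nav (.cons bw rw t) lu =
      if pathFrom P nav bw rw lu = true then true else pathBetween P nav t lu := by
  change (IF pathFrom P nav bw rw lu THEN true ELSE pathBetween P nav t lu) = _
  simp only [rec_eq_ite]

theorem of_pathBetween {P : Rows} {nav : ℕ} {lv lu : Rows} (h : pathBetween P nav lv lu = true) :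
    ∃ e ∈ lv.toList, pathFrom P nav e.1 e.2 lu = true := by
  induction lv with
  | nil => simp [pathBetween] at h
  | cons bw rw t ih =>
    rw [pathBetween_cons] at h
    split_ifs at h with h1
    · exact ⟨(bw, rw), List.mem_cons_self, h1⟩
    · obtain ⟨e, he, h⟩ := ih h
      exact ⟨e, List.mem_cons_of_mem _ he, h⟩

theorem exists_path {P : Rows} (hP : ∀ e ∈ P.toList, IsRow H U e) {nav : ℕ} {lv lu : Rows}
    (hv : ∀ e ∈ lv.toList, IsRow H U e) (hu : ∀ e ∈ lu.toList, IsRow H U e)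
    (h : pathBetween P nav lv lu = true) :
    ∃ w p q c, w ∉ U ∧ c ∉ U ∧ (∃ e ∈ lv.toList, e.1 = 2 ^ w) ∧ (∃ e ∈ lu.toList, e.1 = 2 ^ c) ∧
      w ≠ c ∧ p ≠ c ∧ q ≠ w ∧ H.Adj w p ∧ H.Adj p q ∧ H.Adj q c ∧
      (p ∉ U ∧ nav.testBit q = true ∨ nav.testBit p = true ∧ q ∉ U) := by
  obtain ⟨e, he, h⟩ := of_pathBetween h
  obtain ⟨e', he', hne, i, hi, h⟩ := of_pathFrom h
  obtain ⟨w, hw, hew, hrw⟩ := hv e he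
  obtain ⟨c, hc, hec, hrc⟩ := hu e' he'
  obtain ⟨a, ha, hai, h⟩ := of_testBit_midMask hP h
  have hwc : w ≠ c := by
    rintro rfl
    exact hne (hew.trans hec.symm)
  simp only [testBit_remove, hew, hec, Nat.testBit_two_pow, Bool.and_eq_true, hrw, hrc,
    Bool.not_eq_true', decide_eq_false_iff_not] at h
  rcases h with ⟨⟨h1, h2⟩, h3, h4⟩ | ⟨⟨h1, h2⟩, h3, h4⟩
  · exact ⟨w, a, i, c, hw, hc, ⟨e, he, hew⟩, ⟨e', he', hec⟩, hwc, Ne.symm h2, Ne.symm h4, h1, hai,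
      h3.symm, .inl ⟨ha, hi⟩⟩
  · exact ⟨w, i, a, c, hw, hc, ⟨e, he, hew⟩, ⟨e', he', hec⟩, hwc, Ne.symm h4, Ne.symm h2, h3, hai.symm,
      h1.symm, .inr ⟨hi, ha⟩⟩

theorem HasHexagon.of_swapped {x y : ℕ} (h : HasHexagon (swapped H x y)) : HasHexagon H := by
  obtain ⟨a, b, c, d, e, f, hn, h⟩ := h
  exact ⟨_, _, _, _, _, _, hn.map (Equiv.swap x y).injective, h⟩

/-- The properties of the graphs searched for. -/
structure IsGood (n : ℕ) (good : SimpleGraph ℕ → Prop) : Prop where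
  not_hasHexagon : ∀ H, good H → ¬ HasHexagon H
  swapped : ∀ H x y, x < n → y < n → good H → good (swapped H x y)

variable {L : List Cell} {P : Rows} {g : ℕ} {good : SimpleGraph ℕ → Prop}

theorem Compat.exists_adj (h : Compat n H U L P g) (hg : IsGood n good) (hH : good H) {c c' : Cell}
    (hc : c ∈ L) (hc' : c' ∈ L) {x y a b : ℕ} (hx : x ∈ c.labels) (hy : y ∈ c'.labels)
    (ha : a ∈ c.labels) (hb : b ∈ c'.labels) (hab : a ≠ b) (hxy : H.Adj x y) :
    ∃ H', Compat n H' U L P g ∧ good H' ∧ H'.Adj a b := by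
  have lt : ∀ {c}, c ∈ L → ∀ {x}, x ∈ c.labels → x < n := fun hc _ hx =>
    h.unprocessed _ (h.mem hc hx)
  set y' := Equiv.swap x a y with hy'
  have hy'c : y' ∈ c'.labels := (swap_mem (labels_iff_of_nodup h.nodup hc hx ha c' hc')).2 hy
  have hy'a : y' ≠ a := by
    rw [hy', Ne, Equiv.swap_apply_eq_iff, Equiv.swap_apply_right]
    exact hxy.ne'
  refine ⟨_, (h.swapped hc hx ha).swapped hc' hy'c hb,
    hg.swapped _ _ _ (lt hc' hy'c) (lt hc' hb) (hg.swapped _ _ _ (lt hc hx) (lt hc ha) hH), ?_⟩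
  rw [swapped_adj, Equiv.swap_apply_of_ne_of_ne hy'a.symm hab, Equiv.swap_apply_right, swapped_adj,
    Equiv.swap_apply_right, hy', Equiv.swap_apply_self]
  exact hxy

/-- A path of length five between two classes forbids all edges between them. -/
theorem Compat.not_adj_of_pathBetween (h : Compat n H U L P g) (hg : IsGood n good) (hH : good H)
    {c c' : Cell} (hc : c ∈ L) (hc' : c' ∈ L) {x y a b full : ℕ} (hx : x ∈ c.labels)
    (hy : y ∈ c'.labels) (ha : a ∈ c.labels) (hb : b ∈ c'.labels) (hab : a ≠ b)
    (hfull : ∀ i < n, full.testBit i = true)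
    (hp : pathBetween P (Nat.xor full (Nat.lor (2 ^ a) (2 ^ b))) c.l c'.l = true) : ¬ H.Adj x y := by
  intro hxy
  obtain ⟨H', h', hH', hadj⟩ := h.exists_adj hg hH hc hc' hx hy ha hb hab hxy
  have haU := h.mem hc ha
  have hbU := h.mem hc' hb
  have hv := h'.valid c hc
  have hv' := h'.valid c' hc'
  obtain ⟨w, p, q, r, hw, hr, ⟨e, he, hew⟩, ⟨e', he', her⟩, hwr, hpr, hqw, h1, h2, h3, hnav⟩ :=
    exists_path h'.rows hv.rows hv'.rows hp
  have haw := (((hv.masks a ha).adj w).1 (hv.rows_mem e he w hew)).2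
  have hbr := (((hv'.masks b hb).adj r).1 (hv'.rows_mem e' he' r her)).2
  have key : ∀ i, (Nat.xor full (Nat.lor (2 ^ a) (2 ^ b))).testBit i = true → i ≠ a ∧ i ≠ b := by
    intro i hi
    constructor
    · rintro rfl
      rw [testBit_xor, testBit_lor] at hi
      simp [hfull _ (h.unprocessed _ haU)] at hi
    · rintro rfl
      rw [testBit_xor, testBit_lor] at hi
      simp [hfull _ (h.unprocessed _ hbU)] at hi
  have ne : ∀ {i j}, i ∈ U → j ∉ U → i ≠ j := by
    rintro i j hi hj rfl
    exact hj hi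
  refine hg.not_hasHexagon _ hH' ⟨a, w, p, q, r, b, ?_, haw, h1, h2, h3, hbr.symm, hadj.symm⟩
  have hp' : p ≠ a ∧ p ≠ b := by
    rcases hnav with ⟨hp, -⟩ | ⟨hp, -⟩
    · exact ⟨(ne haU hp).symm, (ne hbU hp).symm⟩
    · exact key p hp
  have hq' : q ≠ a ∧ q ≠ b := by
    rcases hnav with ⟨-, hq⟩ | ⟨-, hq⟩
    · exact key q hq
    · exact ⟨(ne haU hq).symm, (ne hbU hq).symm⟩
  simp only [List.nodup_cons, List.mem_cons, List.not_mem_nil, not_or, or_false, not_false_eq_true,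
    List.nodup_nil, and_true]
  exact ⟨⟨ne haU hw, hp'.1.symm, hq'.1.symm, ne haU hr, hab⟩, ⟨h1.ne, hqw.symm, hwr, (ne hbU hw).symm⟩,
    ⟨h2.ne, hpr, hp'.2⟩, ⟨h3.ne, hq'.2⟩, (ne hbU hr).symm⟩

end

section

/-! ### Pairs of classes without edges -/

theorem testBit_sum_two_pow (S : Finset ℕ) (i : ℕ) :
    (∑ j ∈ S, 2 ^ j).testBit i = true ↔ i ∈ S := by
  conv_rhs => rw [← Finset.toFinset_bitIndices_sum_two_pow S]
  rw [List.mem_toFinset, Nat.mem_bitIndices]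

theorem sum_two_pow_lt {S : Finset ℕ} {n : ℕ} (h : ∀ i ∈ S, i < n) : ∑ j ∈ S, 2 ^ j < 2 ^ n :=
  Nat.lt_pow_two_of_testBit _ fun i hi => by
    rw [Bool.eq_false_iff, Ne, testBit_sum_two_pow]
    exact fun hS => absurd (h i hS) (by omega)

theorem sum_digits_lt (D : ℕ → ℕ) (hD : ∀ k, D k < 2 ^ 32) (n : ℕ) :
    ∑ k ∈ Finset.range n, 2 ^ (32 * k) * D k < 2 ^ (32 * n) := by
  induction n with
  | zero => simp
  | succ n ih =>
    rw [Finset.sum_range_succ, mul_add, pow_add]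
    have := Nat.mul_le_mul_left (2 ^ (32 * n)) (Nat.succ_le_of_lt (hD n))
    rw [Nat.mul_succ] at this
    omega

theorem sum_digits_div (D : ℕ → ℕ) (hD : ∀ k, D k < 2 ^ 32) {n k : ℕ} (hk : k < n) :
    ∃ X, (∑ k ∈ Finset.range n, 2 ^ (32 * k) * D k) / 2 ^ (32 * k) = D k + 2 ^ 32 * X := by
  obtain ⟨m, rfl⟩ := Nat.exists_eq_add_of_lt hk
  refine ⟨∑ j ∈ Finset.range m, 2 ^ (32 * j) * D (k + 1 + j), ?_⟩
  rw [show k + m + 1 = k + 1 + m by omega, Finset.sum_range_add, Finset.sum_range_succ]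
  have e : ∑ j ∈ Finset.range m, 2 ^ (32 * (k + 1 + j)) * D (k + 1 + j) =
      2 ^ (32 * k) * (2 ^ 32 * ∑ j ∈ Finset.range m, 2 ^ (32 * j) * D (k + 1 + j)) := by
    rw [Finset.mul_sum, Finset.mul_sum]
    refine Finset.sum_congr rfl fun j _ => ?_
    rw [show 32 * (k + 1 + j) = 32 * k + (32 + 32 * j) by ring, pow_add, pow_add]
    ring
  rw [e, add_assoc, ← mul_add, Nat.add_mul_div_left _ _ (by positivity),
    Nat.div_eq_of_lt (sum_digits_lt D hD k), zero_add]

theorem interval_eq (b cnt : ℕ) : interval (2 ^ b) cnt = ∑ j ∈ Finset.Ico b (b + cnt), 2 ^ j := by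
  change 2 ^ b <<< cnt - 2 ^ b = _
  rw [Nat.shiftLeft_eq, ← pow_add]
  induction cnt with
  | zero => simp
  | succ k ih =>
    rw [← add_assoc, Finset.sum_Ico_succ_top (by omega), ← ih, pow_succ]
    have := Nat.pow_le_pow_right (n := 2) (by omega) (show b ≤ b + k by omega)
    omega

/-- There are no edges of `H` between two classes. -/
def NoEdge (H : SimpleGraph ℕ) (c c' : Cell) : Prop :=
  ∀ x ∈ c.labels, ∀ y ∈ c'.labels, ¬ H.Adj x y

theorem NoEdge.symm {H : SimpleGraph ℕ} {c c' : Cell} (h : NoEdge H c c') : NoEdge H c' c :=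
  fun x hx y hy hxy => h y hy x hx hxy.symm

open Classical in
/-- The contribution of a pair of classes to `forbidden`. -/
noncomputable def pairValue (p : Cell × Cell) : ℕ :=
  2 ^ (32 * p.1.first) *
    (∑ j ∈ p.2.labels, 2 ^ j + 65536 * if p.1 = p.2 then p.2.cnt - 1 else p.2.cnt)

theorem shiftUnit_mul_digit {b b' cnt cnt' : ℕ} : shiftUnit (2 ^ b) * digit (2 ^ b') cnt cnt' =
    2 ^ (32 * b) * (∑ j ∈ Finset.Ico b' (b' + cnt), 2 ^ j + 65536 * cnt') := by
  unfold shiftUnit digit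
  change (2 ^ b) ^ 32 * (_ + 65536 * cnt') = _
  rw [interval_eq, ← pow_mul, mul_comm b]

theorem pairValue_of_ne {c c' : Cell} (hc : c.b = 2 ^ c.first) (hc' : c'.b = 2 ^ c'.first)
    (h : c ≠ c') : pairValue (c, c') = shiftUnit c.b * digit c'.b c'.cnt c'.cnt := by
  rw [hc, hc', shiftUnit_mul_digit, pairValue, if_neg h]
  rfl

theorem pairValue_self {c : Cell} (hc : c.b = 2 ^ c.first) :
    pairValue (c, c) = shiftUnit c.b * digit c.b c.cnt (c.cnt - 1) := by
  rw [hc, shiftUnit_mul_digit, pairValue, if_pos rfl]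
  rfl

def pairTest (full : ℕ) (P : Rows) (c c' : Cell) : Prop :=
  c.lim * c'.lim = 0 ∨ pathBetween P (Nat.xor full (Nat.lor c.b c'.b)) c.l c'.l = true

def selfTest (full : ℕ) (P : Rows) (c : Cell) : Prop :=
  c.cnt ≠ 1 ∧ (c.lim = 0 ∨
    pathBetween P (Nat.xor full (Nat.lor c.b (Nat.shiftLeft c.b 1))) c.l c.l = true)

theorem forbidPairs_cons (full : ℕ) (P : Rows) (b cnt lim : ℕ) (l : Rows)
    (b' cnt' lim' m u1 u2 : ℕ) (l' : Rows) (t : Cls) :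
    forbidPairs full P b cnt lim l (.cons b' cnt' lim' m u1 u2 l' t) =
      if lim * lim' = 0 ∨ pathBetween P (Nat.xor full (Nat.lor b b')) l l' = true then
        shiftUnit b * digit b' cnt' cnt' + shiftUnit b' * digit b cnt cnt +
          forbidPairs full P b cnt lim l t
      else forbidPairs full P b cnt lim l t := by
  change (IFN Nat.beq (lim * lim') 0 THEN shiftUnit b * digit b' cnt' cnt' +
    shiftUnit b' * digit b cnt cnt + forbidPairs full P b cnt lim l t ELSE
    IFN pathBetween P (Nat.xor full (Nat.lor b b')) l l' THEN shiftUnit b * digit b' cnt' cnt' +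
    shiftUnit b' * digit b cnt cnt + forbidPairs full P b cnt lim l t ELSE
    forbidPairs full P b cnt lim l t) = _
  simp only [rec_eq_ite, Nat.beq_eq]
  split_ifs with h1 h2 h3 h3 <;> first | rfl | tauto

theorem forbidSelf_eq (full : ℕ) (P : Rows) (b cnt lim : ℕ) (l : Rows) (x : ℕ) :
    forbidSelf full P b cnt lim l x =
      if cnt ≠ 1 ∧ (lim = 0 ∨
        pathBetween P (Nat.xor full (Nat.lor b (Nat.shiftLeft b 1))) l l = true)
      then shiftUnit b * digit b cnt (cnt - 1) + x else x := by
  change (IFN Nat.beq cnt 1 THEN x ELSE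
    IFN Nat.beq lim 0 THEN shiftUnit b * digit b cnt (cnt - 1) + x ELSE
    IFN pathBetween P (Nat.xor full (Nat.lor b (Nat.shiftLeft b 1))) l l
    THEN shiftUnit b * digit b cnt (cnt - 1) + x ELSE x) = _
  simp only [rec_eq_ite, Nat.beq_eq]
  split_ifs with h1 h2 h3 h4 h5 <;> first | rfl | tauto

theorem forbidden_cons (full : ℕ) (P : Rows) (b cnt lim m u1 u2 : ℕ) (l : Rows) (t : Cls) :
    forbidden full P (.cons b cnt lim m u1 u2 l t) =
      forbidSelf full P b cnt lim l (forbidPairs full P b cnt lim l t + forbidden full P t) := rfl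

theorem exists_forbidPairs {full : ℕ} {P : Rows} {c : Cell} (hc : c.b = 2 ^ c.first) (t : Cls)
    (ht : ∀ c' ∈ t.toList, c'.b = 2 ^ c'.first) (hn : (c :: t.toList).Nodup) :
    ∃ E : Finset (Cell × Cell), forbidPairs full P c.b c.cnt c.lim c.l t = ∑ p ∈ E, pairValue p ∧
      ∀ p ∈ E, p.1 = c ∧ p.2 ∈ t.toList ∧ pairTest full P c p.2 ∨
        p.2 = c ∧ p.1 ∈ t.toList ∧ pairTest full P c p.1 := by
  classical
  induction t with
  | nil => exact ⟨∅, rfl, by simp⟩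
  | cons b' cnt' lim' m u1 u2 l' t ih =>
    simp only [Cls.toList, List.nodup_cons, List.mem_cons, not_or] at hn ih
    obtain ⟨E, hE, hE'⟩ := ih (fun c' h => ht c' (List.mem_cons_of_mem _ h)) ⟨hn.1.2, hn.2.2⟩
    have hE'' := fun (p : Cell × Cell) (hp : p ∈ E) => (hE' p hp).imp
      (And.imp_right (And.imp_left (List.mem_cons_of_mem (⟨b', cnt', lim', m, u1, u2, l'⟩ : Cell))))
      (And.imp_right (And.imp_left (List.mem_cons_of_mem (⟨b', cnt', lim', m, u1, u2, l'⟩ : Cell))))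
    rw [forbidPairs_cons]
    split_ifs with h
    · set c' : Cell := ⟨b', cnt', lim', m, u1, u2, l'⟩ with hc'
      have hb' : c'.b = 2 ^ c'.first := ht c' List.mem_cons_self
      refine ⟨insert (c, c') (insert (c', c) E), ?_, ?_⟩
      · rw [Finset.sum_insert, Finset.sum_insert, pairValue_of_ne hc hb' hn.1.1,
          pairValue_of_ne hb' hc (Ne.symm hn.1.1), hE, ← add_assoc]
        · intro hmem
          rcases hE' _ hmem with h | h
          · exact hn.1.1 h.1.symm
          · exact hn.2.1 h.2.1
        · rw [Finset.mem_insert, not_or]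
          refine ⟨fun he => hn.1.1 (Prod.ext_iff.1 he).1, fun hmem => ?_⟩
          rcases hE' _ hmem with h | h
          · exact hn.2.1 h.2.1
          · exact hn.1.1 h.1.symm
      · intro p hp
        rw [Finset.mem_insert, Finset.mem_insert] at hp
        rcases hp with rfl | rfl | hp
        · exact .inl ⟨rfl, List.mem_cons_self, h⟩
        · exact .inr ⟨rfl, List.mem_cons_self, h⟩
        · exact hE'' p hp
    · exact ⟨E, hE, hE''⟩

theorem exists_forbidden {full : ℕ} {P : Rows} (C : Cls) (hC : ∀ c ∈ C.toList, c.b = 2 ^ c.first)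
    (hn : C.toList.Nodup) :
    ∃ E : Finset (Cell × Cell), forbidden full P C = ∑ p ∈ E, pairValue p ∧
      ∀ p ∈ E, p.1 ∈ C.toList ∧ p.2 ∈ C.toList ∧
        (p.1 ≠ p.2 ∧ (pairTest full P p.1 p.2 ∨ pairTest full P p.2 p.1) ∨
          p.1 = p.2 ∧ selfTest full P p.1) := by
  classical
  induction C with
  | nil => exact ⟨∅, rfl, by simp⟩
  | cons b cnt lim m u1 u2 l t ih =>
    simp only [Cls.toList] at hC hn ⊢
    set c : Cell := ⟨b, cnt, lim, m, u1, u2, l⟩ with hc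
    have hn' := List.nodup_cons.1 hn
    obtain ⟨E, hE, hE'⟩ := ih (fun c' h => hC c' (List.mem_cons_of_mem _ h)) hn'.2
    obtain ⟨F, hF, hF'⟩ := exists_forbidPairs (full := full) (P := P) (hC c List.mem_cons_self) t
      (fun c' h => hC c' (List.mem_cons_of_mem _ h)) hn
    have hEF : Disjoint F E := by
      rw [Finset.disjoint_left]
      intro p hp hpE
      rcases hF' p hp with ⟨h, -⟩ | ⟨h, -⟩
      · exact hn'.1 (h ▸ (hE' p hpE).1)
      · exact hn'.1 (h ▸ (hE' p hpE).2.1)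
    have key : ∀ p ∈ F ∪ E, p.1 ∈ c :: t.toList ∧ p.2 ∈ c :: t.toList ∧
        (p.1 ≠ p.2 ∧ (pairTest full P p.1 p.2 ∨ pairTest full P p.2 p.1) ∨
          p.1 = p.2 ∧ selfTest full P p.1) := by
      intro p hp
      rcases Finset.mem_union.1 hp with hp | hp
      · rcases hF' p hp with ⟨h1, h2, h3⟩ | ⟨h1, h2, h3⟩
        · refine ⟨by simp [h1], by simp [h2], .inl ⟨?_, .inl (h1 ▸ h3)⟩⟩
          rintro h
          exact hn'.1 (h1 ▸ h ▸ h2)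
        · refine ⟨by simp [h2], by simp [h1], .inl ⟨?_, .inr (h1 ▸ h3)⟩⟩
          rintro h
          exact hn'.1 (h1 ▸ h ▸ h2)
      · obtain ⟨h1, h2, h3⟩ := hE' p hp
        exact ⟨List.mem_cons_of_mem _ h1, List.mem_cons_of_mem _ h2, h3⟩
    have hcE : (c, c) ∉ F ∪ E := by
      rw [Finset.mem_union, not_or]
      refine ⟨fun h => ?_, fun h => hn'.1 (hE' _ h).1⟩
      rcases hF' _ h with h | h <;> exact hn'.1 h.2.1
    rw [forbidden_cons, forbidSelf_eq]
    split_ifs with h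
    · refine ⟨insert (c, c) (F ∪ E), ?_, ?_⟩
      · rw [Finset.sum_insert hcE, Finset.sum_union hEF, ← hE, ← hF,
          pairValue_self (hC c List.mem_cons_self)]
      · intro p hp
        rcases Finset.mem_insert.1 hp with rfl | hp
        · exact ⟨List.mem_cons_self, List.mem_cons_self, .inr ⟨rfl, h⟩⟩
        · exact key p hp
    · exact ⟨F ∪ E, by rw [Finset.sum_union hEF, ← hE, ← hF], key⟩

variable {n : ℕ} {H : SimpleGraph ℕ} {U : Finset ℕ} {L : List Cell} {P : Rows} {g : ℕ}
  {good : SimpleGraph ℕ → Prop}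

theorem Cell.Valid.first_mem {c : Cell} (h : c.Valid H U) : c.first ∈ c.labels := by
  rw [Cell.mem_labels]
  have := h.pos
  omega

theorem Compat.eq_of_mem (h : Compat n H U L P g) {c c' : Cell} (hc : c ∈ L) (hc' : c' ∈ L) {x : ℕ}
    (hx : x ∈ c.labels) (hx' : x ∈ c'.labels) : c = c' := by
  have hn := h.nodup
  clear h
  induction L with
  | nil => simp at hc
  | cons c₀ L ih =>
    rw [labelSum_cons, Multiset.nodup_add, Multiset.disjoint_left] at hn
    obtain ⟨-, h2, h3⟩ := hn
    rcases List.mem_cons.1 hc with rfl | hc₁ <;> rcases List.mem_cons.1 hc' with rfl | hc₂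
    · rfl
    · exact absurd (mem_labelSum.2 ⟨c', hc₂, hx'⟩) (h3 hx)
    · exact absurd (mem_labelSum.2 ⟨c, hc₁, hx⟩) (h3 hx')
    · exact ih hc₁ hc₂ h2

theorem Compat.nodup_cells (h : Compat n H U L P g) : L.Nodup := by
  have hn := h.nodup
  have hv := fun c hc => (h.valid c hc).first_mem
  clear h
  induction L with
  | nil => exact List.nodup_nil
  | cons c₀ L ih =>
    rw [labelSum_cons, Multiset.nodup_add, Multiset.disjoint_left] at hn
    rw [List.nodup_cons]
    exact ⟨fun hc => hn.2.2 (hv c₀ List.mem_cons_self)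
      (mem_labelSum.2 ⟨c₀, hc, hv c₀ List.mem_cons_self⟩),
      ih hn.2.1 fun c hc => hv c (List.mem_cons_of_mem _ hc)⟩

theorem degIn_eq_zero {z : ℕ} : degIn H U z = 0 ↔ ∀ x ∈ U, ¬ H.Adj z x := by
  classical
  unfold degIn
  rw [Finset.card_eq_zero, Finset.filter_eq_empty_iff]

theorem Compat.noEdge_of_lim (h : Compat n H U L P g) {c c' : Cell} (hc : c ∈ L) (hc' : c' ∈ L)
    (h0 : c.lim = 0) : NoEdge H c c' := by
  intro x hx y hy
  have := (h.valid c hc).deg x hx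
  rw [h0, Nat.le_zero, degIn_eq_zero] at this
  exact this y (h.mem hc' hy)

theorem Compat.noEdge_of_pairTest (h : Compat n H U L P g) (hg : IsGood n good) (hH : good H)
    {full : ℕ} (hfull : ∀ i < n, full.testBit i = true) {c c' : Cell} (hc : c ∈ L) (hc' : c' ∈ L)
    (hne : c ≠ c') (ht : pairTest full P c c') : NoEdge H c c' := by
  have hv := h.valid c hc
  have hv' := h.valid c' hc'
  rcases ht with h0 | hp
  · rcases Nat.mul_eq_zero.1 h0 with h0 | h0
    · exact h.noEdge_of_lim hc hc' h0
    · exact (h.noEdge_of_lim hc' hc h0).symm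
  · rw [hv.bit, hv'.bit] at hp
    intro x hx y hy
    refine h.not_adj_of_pathBetween hg hH hc hc' hx hy hv.first_mem hv'.first_mem ?_ hfull hp
    intro he
    exact hne (h.eq_of_mem hc hc' hv.first_mem (he ▸ hv'.first_mem))

theorem Compat.noEdge_of_selfTest (h : Compat n H U L P g) (hg : IsGood n good) (hH : good H)
    {full : ℕ} (hfull : ∀ i < n, full.testBit i = true) {c : Cell} (hc : c ∈ L)
    (ht : selfTest full P c) : NoEdge H c c := by
  have hv := h.valid c hc
  obtain ⟨h1, h0 | hp⟩ := ht
  · exact h.noEdge_of_lim hc hc h0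
  · have e : Nat.shiftLeft c.b 1 = 2 ^ (c.first + 1) := by
      change c.b <<< 1 = _
      rw [Nat.shiftLeft_eq, hv.bit, ← pow_add]
    rw [e, hv.bit] at hp
    intro x hx y hy
    refine h.not_adj_of_pathBetween hg hH hc hc hx hy hv.first_mem ?_ (by omega) hfull hp
    rw [Cell.mem_labels]
    have := hv.pos
    omega

end

section

variable {n : ℕ} {H : SimpleGraph ℕ} {U : Finset ℕ} {L : List Cell} {P : Rows} {g : ℕ}
  {good : SimpleGraph ℕ → Prop}

open Classical in
theorem degIn_add_card_le {x k : ℕ} {T : Finset ℕ} (hx : x ∈ U) (hT : T ⊆ U) (hxT : x ∉ T)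
    (h : ∀ y ∈ T, ¬ H.Adj x y) (hk : k ≤ T.card) : degIn H U x + k + 1 ≤ U.card := by
  have hd : Disjoint (U.filter (H.Adj x)) (insert x T) := by
    rw [Finset.disjoint_left]
    intro y hy hy'
    rw [Finset.mem_filter] at hy
    rcases Finset.mem_insert.1 hy' with rfl | hy'
    · exact H.loopless.irrefl _ hy.2
    · exact h y hy' hy.2
  have := Finset.card_le_card (Finset.union_subset (Finset.filter_subset (H.Adj x) U)
    (Finset.insert_subset hx hT))
  rw [Finset.card_union_of_disjoint hd, Finset.card_insert_of_notMem hxT] at this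
  unfold degIn
  omega

open Classical in
/-- The digit of `forbidden` that belongs to the label `k`. -/
noncomputable def pairDigit (E : Finset (Cell × Cell)) (k : ℕ) : ℕ :=
  ∑ p ∈ E with p.1.first = k,
    (∑ j ∈ p.2.labels, 2 ^ j + 65536 * if p.1 = p.2 then p.2.cnt - 1 else p.2.cnt)

theorem Compat.pairDigit_eq (h : Compat n H U L P g) {E : Finset (Cell × Cell)}
    (hE : ∀ p ∈ E, p.1 ∈ L ∧ p.2 ∈ L ∧ NoEdge H p.1 p.2) {c : Cell} (hc : c ∈ L) :
    ∃ (S : Finset ℕ) (B : ℕ), pairDigit E c.first = ∑ j ∈ S, 2 ^ j + 65536 * B ∧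
      (∀ i ∈ S, ∃ c' ∈ L, i ∈ c'.labels ∧ NoEdge H c c') ∧
      ∀ x ∈ c.labels, degIn H U x + B + 1 ≤ U.card := by
  classical
  set E' := E.filter fun p => p.1.first = c.first with hE'
  have h1 : ∀ p ∈ E', p.1 = c ∧ p.2 ∈ L ∧ NoEdge H c p.2 := by
    intro p hp
    obtain ⟨hp, hf⟩ := Finset.mem_filter.1 hp
    obtain ⟨a1, a2, a3⟩ := hE p hp
    have : p.1 = c := h.eq_of_mem a1 hc (h.valid _ a1).first_mem (hf ▸ (h.valid c hc).first_mem)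
    exact ⟨this, a2, this ▸ a3⟩
  have hdis : ∀ p ∈ E', ∀ q ∈ E', p ≠ q → Disjoint p.2.labels q.2.labels := by
    intro p hp q hq hne
    rw [Finset.disjoint_left]
    intro y hy hy'
    exact hne (Prod.ext ((h1 p hp).1.trans (h1 q hq).1.symm)
      (h.eq_of_mem (h1 p hp).2.1 (h1 q hq).2.1 hy hy'))
  refine ⟨E'.biUnion fun p => p.2.labels,
    ∑ p ∈ E', if p.1 = p.2 then p.2.cnt - 1 else p.2.cnt, ?_, ?_, ?_⟩
  · rw [Finset.sum_biUnion hdis, Finset.mul_sum, ← Finset.sum_add_distrib]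
    rfl
  · intro i hi
    obtain ⟨p, hp, hi⟩ := Finset.mem_biUnion.1 hi
    exact ⟨p.2, (h1 p hp).2.1, hi, (h1 p hp).2.2⟩
  · intro x hx
    refine degIn_add_card_le (T := E'.biUnion fun p => p.2.labels.erase x) (h.mem hc hx) ?_ ?_ ?_ ?_
    · intro y hy
      obtain ⟨p, hp, hy⟩ := Finset.mem_biUnion.1 hy
      exact h.mem (h1 p hp).2.1 (Finset.mem_of_mem_erase hy)
    · simp
    · intro y hy
      obtain ⟨p, hp, hy⟩ := Finset.mem_biUnion.1 hy
      exact (h1 p hp).2.2 x hx y (Finset.mem_of_mem_erase hy)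
    · rw [Finset.card_biUnion fun p hp q hq hne =>
        (hdis p hp q hq hne).mono (Finset.erase_subset _ _) (Finset.erase_subset _ _)]
      refine (Finset.sum_congr rfl fun p hp => ?_).le
      have hcard : p.2.labels.card = p.2.cnt := by simp [Cell.labels]
      rw [(h1 p hp).1]
      split_ifs with he
      · rw [Finset.card_erase_of_mem (he ▸ hx), hcard]
      · rw [Finset.erase_eq_of_notMem fun hx' => he (h.eq_of_mem hc (h1 p hp).2.1 hx hx'), hcard]

theorem sum_pairValue {E : Finset (Cell × Cell)} (hE : ∀ p ∈ E, p.1.first < n) :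
    ∑ p ∈ E, pairValue p = ∑ k ∈ Finset.range n, 2 ^ (32 * k) * pairDigit E k := by
  classical
  rw [← Finset.sum_fiberwise_of_maps_to (g := fun p => p.1.first) (t := Finset.range n)
    fun p hp => Finset.mem_range.2 (hE p hp)]
  refine Finset.sum_congr rfl fun k _ => ?_
  rw [pairDigit, Finset.mul_sum]
  refine Finset.sum_congr rfl fun p hp => ?_
  rw [pairValue, (Finset.mem_filter.1 hp).2]

theorem Compat.first_lt (h : Compat n H U L P g) {c : Cell} (hc : c ∈ L) : c.first < n :=
  h.unprocessed _ (h.mem hc (h.valid c hc).first_mem)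

theorem Compat.card_le (h : Compat n H U L P g) : U.card ≤ n := by
  simpa using Finset.card_le_card fun a ha => Finset.mem_range.2 (h.unprocessed a ha)

/-- What the matrix of forbidden pairs says about a class. -/
theorem Compat.forbidden_spec {C : Cls} (h : Compat n H U C.toList P g) (hg : IsGood n good)
    (hH : good H) {full : ℕ} (hfull : ∀ i < n, full.testBit i = true) (hn : n ≤ 16) {c : Cell}
    (hc : c ∈ C.toList) :
    (∀ c' ∈ C.toList, (Nat.div (forbidden full P C) (shiftUnit c.b)).testBit c'.first = true →
      NoEdge H c c') ∧
    ∀ x ∈ c.labels, degIn H U x +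
      Nat.land (Nat.div (forbidden full P C) (Nat.mul (shiftUnit c.b) 65536)) 65535 + 1 ≤ U.card := by
  obtain ⟨E, hE, hE'⟩ := exists_forbidden (full := full) (P := P) C
    (fun c hc => (h.valid c hc).bit) h.nodup_cells
  have hE2 : ∀ p ∈ E, p.1 ∈ C.toList ∧ p.2 ∈ C.toList ∧ NoEdge H p.1 p.2 := by
    intro p hp
    obtain ⟨h1, h2, ⟨h3, h4 | h4⟩ | ⟨h3, h4⟩⟩ := hE' p hp
    · exact ⟨h1, h2, h.noEdge_of_pairTest hg hH hfull h1 h2 h3 h4⟩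
    · exact ⟨h1, h2, (h.noEdge_of_pairTest hg hH hfull h2 h1 h3.symm h4).symm⟩
    · exact ⟨h1, h2, h3 ▸ h.noEdge_of_selfTest hg hH hfull h1 h4⟩
  have lt16 : ∀ {S : Finset ℕ}, (∀ i ∈ S, ∃ c' ∈ C.toList, i ∈ c'.labels) →
      ∑ j ∈ S, 2 ^ j < 2 ^ 16 := by
    intro S hS
    refine sum_two_pow_lt fun i hi => ?_
    obtain ⟨c', hc', hi⟩ := hS i hi
    exact (h.unprocessed _ (h.mem hc' hi)).trans_le hn
  have lt32 : ∀ k, pairDigit E k < 2 ^ 32 := by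
    intro k
    by_cases hk : ∃ c' ∈ C.toList, c'.first = k
    · obtain ⟨c', hc', rfl⟩ := hk
      obtain ⟨S, B, h1, h2, h3⟩ := h.pairDigit_eq hE2 hc'
      have hS := lt16 fun i hi => (h2 i hi).imp fun _ => And.imp_right And.left
      have := h3 _ (h.valid c' hc').first_mem
      have := h.card_le
      rw [h1]
      omega
    · push Not at hk
      rw [pairDigit, Finset.filter_false_of_mem fun p hp => hk _ (hE2 p hp).1]
      simp
  obtain ⟨S, B, h1, h2, h3⟩ := h.pairDigit_eq hE2 hc
  have hlt := lt16 fun i hi => (h2 i hi).imp fun _ => And.imp_right And.left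
  obtain ⟨X, hX⟩ := sum_digits_div (pairDigit E) lt32 (h.first_lt hc)
  rw [← sum_pairValue fun p hp => h.first_lt (hE2 p hp).1, ← hE, h1] at hX
  have hu : shiftUnit c.b = 2 ^ (32 * c.first) := by
    unfold shiftUnit
    change c.b ^ 32 = _
    rw [(h.valid c hc).bit, ← pow_mul, mul_comm]
  have e : forbidden full P C / shiftUnit c.b = 2 ^ 16 * (B + 2 ^ 16 * X) + ∑ j ∈ S, 2 ^ j := by
    rw [hu, hX]
    ring
  refine ⟨fun c' hc' hb => ?_, fun x hx => ?_⟩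
  · change (forbidden full P C / shiftUnit c.b).testBit _ = true at hb
    rw [e, Nat.testBit_two_pow_mul_add _ hlt, if_pos ((h.first_lt hc').trans_le hn),
      testBit_sum_two_pow] at hb
    obtain ⟨c'', hc'', hi, hne⟩ := h2 _ hb
    rwa [h.eq_of_mem hc' hc'' (h.valid c' hc').first_mem hi]
  · have hB : Nat.land (Nat.div (forbidden full P C) (Nat.mul (shiftUnit c.b) 65536)) 65535 = B := by
      change (forbidden full P C / (shiftUnit c.b * 65536)) &&& (2 ^ 16 - 1) = B
      have := h3 x hx
      have := h.card_le
      rw [← Nat.div_div_eq_div_mul, e, Nat.and_two_pow_sub_one_eq_mod]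
      omega
    rw [hB]
    exact h3 x hx

/-- The effect of `clip` on a class. -/
def Cell.clip (M r : ℕ) (c : Cell) : Cell :=
  { c with lim := Nat.sub c.lim (Nat.sub c.lim (Nat.sub r
      (Nat.land (Nat.div M (Nat.mul (shiftUnit c.b) 65536)) 65535))) }

theorem toList_clip (M r : ℕ) (C : Cls) : (clip M r C).toList = C.toList.map (Cell.clip M r) := by
  induction C with
  | nil => rfl
  | cons b cnt lim m u1 u2 l t ih =>
    change _ :: (clip M r t).toList = _
    rw [ih]
    rfl

theorem sub_sub_eq_min (a b : ℕ) : Nat.sub a (Nat.sub a b) = min a b := by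
  change a - (a - b) = _
  omega

theorem Compat.clip {C : Cls} (h : Compat n H U C.toList P g) (hg : IsGood n good) (hH : good H)
    {full : ℕ} (hfull : ∀ i < n, full.testBit i = true) (hn : n ≤ 16) {r : ℕ} (hr : U.card ≤ r) :
    Compat n H U (clip (forbidden full P C) (Nat.sub r 1) C).toList P g := by
  refine ⟨h.lt, h.rows, h.processed, h.unprocessed, ?_, ?_, h.edges⟩
  · rw [toList_clip, labelSum, List.map_map, ← h.labels]
    rfl
  · intro c' hc'
    rw [toList_clip, List.mem_map] at hc'
    obtain ⟨c, hc, rfl⟩ := hc'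
    have v := h.valid c hc
    refine ⟨v.pos, v.bit, v.masks, v.rows, v.rows_mem, fun x hx => ?_⟩
    have h1 := v.deg x hx
    have h2 := (h.forbidden_spec hg hH hfull hn hc).2 x hx
    change _ ≤ Nat.sub _ (Nat.sub _ _)
    rw [sub_sub_eq_min, le_min_iff]
    refine ⟨h1, ?_⟩
    change _ ≤ r - 1 - _
    omega

end

section

/-! ### Choosing the neighbours of a vertex -/

variable {n : ℕ} {H : SimpleGraph ℕ} {U : Finset ℕ} {v : ℕ}

theorem clash_eq (x m m' u2 u2' : ℕ) : clash x m m' u2 u2' = true ↔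
    x ≠ 0 ∧ (Nat.land m m' = 0 ∨ Nat.land x (Nat.lor u2 u2') ≠ 0) := by
  unfold clash
  simp only [rec_eq_ite, Nat.beq_eq]
  generalize Nat.land x (Nat.lor u2 u2') = z
  generalize Nat.land m m' = w
  split_ifs <;> simp_all

theorem hasHexagon_of_clash {w w' m m' u1 u1' u2 u2' nav : ℕ} (hv : v ∈ U) (hw : w ∈ U) (hw' : w' ∈ U)
    (hvw : H.Adj v w) (hvw' : H.Adj v w') (hne : w ≠ w') (h : MasksAt H U m u1 u2 w)
    (h' : MasksAt H U m' u1' u2' w')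
    (hnav : nav.testBit v = false ∧ nav.testBit w = false ∧ nav.testBit w' = false) {x : ℕ}
    (hx : ∀ i, x.testBit i = true → u1.testBit i = true ∧ u1'.testBit i = true ∧ nav.testBit i = true)
    (hc : clash x m m' u2 u2' = true) : HasHexagon H := by
  rw [clash_eq] at hc
  suffices key : ∃ y p p', nav.testBit y = true ∧ m.testBit p = true ∧ m'.testBit p' = true ∧ p ≠ p' ∧
      H.Adj p y ∧ H.Adj p' y by
    obtain ⟨y, p, p', hy, hp, hp', hpp', hpy, hpy'⟩ := key
    obtain ⟨hpU, hwp⟩ := (h.adj p).1 hp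
    obtain ⟨hpU', hwp'⟩ := (h'.adj p').1 hp'
    have ne : ∀ {i j}, i ∈ U → j ∉ U → i ≠ j := by
      rintro i j hi hj rfl
      exact hj hi
    have hyv : v ≠ y := by rintro rfl; simp [hnav.1] at hy
    have hyw : w ≠ y := by rintro rfl; simp [hnav.2.1] at hy
    have hyw' : y ≠ w' := by rintro rfl; simp [hnav.2.2] at hy
    refine ⟨v, w, p, y, p', w', ?_, hvw, hwp, hpy, hpy'.symm, hwp'.symm, hvw'.symm⟩
    simp only [List.nodup_cons, List.mem_cons, List.not_mem_nil, not_or, or_false, not_false_eq_true,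
      List.nodup_nil, and_true]
    exact ⟨⟨hvw.ne, ne hv hpU, hyv, ne hv hpU', hvw'.ne⟩, ⟨ne hw hpU, hyw, ne hw hpU', hne⟩,
      ⟨hpy.ne, hpp', (ne hw' hpU).symm⟩, ⟨hpy'.ne', hyw'⟩, (ne hw' hpU').symm⟩
  obtain ⟨h0, hd | h2⟩ := hc
  · obtain ⟨y, hy⟩ := exists_testBit_of_ne_zero h0
    obtain ⟨hy1, hy1', hy2⟩ := hx y hy
    obtain ⟨p, hp, hpy⟩ := h.one y hy1
    obtain ⟨p', hp', hpy'⟩ := h'.one y hy1'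
    refine ⟨y, p, p', hy2, hp, hp', ?_, hpy, hpy'⟩
    rintro rfl
    have : (Nat.land m m').testBit p = true := by rw [testBit_land, hp, hp']; rfl
    rw [hd, Nat.zero_testBit] at this
    exact Bool.noConfusion this
  · obtain ⟨y, hy⟩ := exists_testBit_of_ne_zero h2
    rw [testBit_land, testBit_lor, Bool.and_eq_true, Bool.or_eq_true] at hy
    obtain ⟨hy1, hy1', hy2⟩ := hx y hy.1
    rcases hy.2 with hy | hy
    · obtain ⟨p, q, hpq, hp, hq, hpy, hqy⟩ := h.two y hy
      obtain ⟨p', hp', hpy'⟩ := h'.one y hy1'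
      by_cases hpp' : p = p'
      · exact ⟨y, q, p', hy2, hq, hp', fun e => hpq (hpp'.trans e.symm), hqy, hpy'⟩
      · exact ⟨y, p, p', hy2, hp, hp', hpp', hpy, hpy'⟩
    · obtain ⟨p, q, hpq, hp, hq, hpy, hqy⟩ := h'.two y hy
      obtain ⟨p', hp', hpy'⟩ := h.one y hy1
      by_cases hpp' : p = p'
      · exact ⟨y, p', q, hy2, hp', hq, fun e => hpq (hpp'.trans e), hpy', hqy⟩
      · exact ⟨y, p', p, hy2, hp', hp, fun e => hpp' e.symm, hpy', hpy⟩

/-- The class consists of unprocessed vertices, and the neighbours of `v` come first. -/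
structure AvailCell (H : SimpleGraph ℕ) (U : Finset ℕ) (v : ℕ) (c : Cell) : Prop where
  pos : 0 < c.cnt
  bit : c.b = 2 ^ c.first
  mem : ∀ x ∈ c.labels, x ∈ U
  ne : ∀ x ∈ c.labels, x ≠ v
  masks : ∀ x ∈ c.labels, MasksAt H U c.m c.u1 c.u2 x
  adj : ∀ x ∈ c.labels, H.Adj v x ↔ x < c.first + degIn H c.labels v

theorem degIn_le_cnt {c : Cell} : degIn H c.labels v ≤ c.cnt := by
  classical
  exact (Finset.card_filter_le _ _).trans_eq (by simp [Cell.labels])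

theorem AvailCell.first_mem {c : Cell} (h : AvailCell H U v c) : c.first ∈ c.labels := by
  rw [Cell.mem_labels]
  have := h.pos
  omega

def IsPick (H : SimpleGraph ℕ) (U : Finset ℕ) (v : ℕ) (q : Pick) (w : ℕ) : Prop :=
  w ∈ U ∧ H.Adj v w ∧ q.b = 2 ^ w ∧ MasksAt H U q.m q.u1 q.u2 w

theorem clashAny_cons (nav m u1 u2 b' m' u1' u2' : ℕ) (t : Chosen) :
    clashAny nav m u1 u2 (.cons b' m' u1' u2' t) =
      if clash (Nat.land (Nat.land u1 u1') (Nat.xor nav b')) m m' u2 u2' = true then true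
      else clashAny nav m u1 u2 t := by
  change (IF clash (Nat.land (Nat.land u1 u1') (Nat.xor nav b')) m m' u2 u2' THEN true ELSE
    clashAny nav m u1 u2 t) = _
  simp only [rec_eq_ite]

theorem of_clashAny {nav m u1 u2 : ℕ} {h : Chosen} (hc : clashAny nav m u1 u2 h = true) :
    ∃ q ∈ h.toList, clash (Nat.land (Nat.land u1 q.u1) (Nat.xor nav q.b)) m q.m u2 q.u2 = true := by
  induction h with
  | nil => simp [clashAny] at hc
  | cons b' m' u1' u2' t ih =>
    rw [clashAny_cons] at hc
    split_ifs at hc with h1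
    · exact ⟨⟨b', m', u1', u2'⟩, List.mem_cons_self, h1⟩
    · obtain ⟨q, hq, h⟩ := ih hc
      exact ⟨q, List.mem_cons_of_mem _ hq, h⟩

theorem maxCount_eq (nav b m u1 u2 : ℕ) (h : Chosen) (cnt left : ℕ) :
    maxCount nav b m u1 u2 h cnt left =
      if left = 0 then 0 else if clashAny (Nat.xor nav b) m u1 u2 h = true then 0 else
      if cnt = 1 then 1 else
      if clash (Nat.land u1 (Nat.xor (Nat.xor nav b) (Nat.shiftLeft b 1))) m m u2 u2 = true then 1 else
      min cnt left := by
  rw [← sub_sub_eq_min]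
  unfold maxCount
  simp only [rec_eq_ite, Nat.beq_eq]

theorem le_maxCount (hv : v ∈ U) {full : ℕ} (hfull : ∀ i ∈ U, full.testBit i = true)
    (hH : ¬ HasHexagon H) {c : Cell} (hc : AvailCell H U v c) {h : Chosen}
    (hq : ∀ q ∈ h.toList, ∃ w, IsPick H U v q w ∧ w ∉ c.labels) {left : ℕ}
    (hleft : degIn H c.labels v ≤ left) :
    degIn H c.labels v ≤
      maxCount (Nat.xor full (2 ^ v)) c.b c.m c.u1 c.u2 h c.cnt left := by
  have hcnt := degIn_le_cnt (H := H) (v := v) (c := c)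
  rw [maxCount_eq, hc.bit]
  split_ifs with h1 h2 h3 h4
  · omega
  · by_contra! hpos
    obtain ⟨q, hq', hcl⟩ := of_clashAny h2
    obtain ⟨w, ⟨hwU, hvw, hqb, hwm⟩, hwc⟩ := hq q hq'
    have hf := hc.first_mem
    have hfU := hc.mem _ hf
    have hvf := (hc.adj _ hf).2 (by omega)
    have hfw : c.first ≠ w := by
      rintro rfl
      exact hwc hf
    refine hH (hasHexagon_of_clash hv hfU hwU hvf hvw hfw (hc.masks _ hf) hwm
      (nav := Nat.xor (Nat.xor (Nat.xor full (2 ^ v)) (2 ^ c.first)) (2 ^ w)) ?_ ?_ hcl)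
    · simp only [testBit_xor, Nat.testBit_two_pow, hfull _ hv, hfull _ hfU, hfull _ hwU]
      simp [hvf.ne, hvf.ne', hvw.ne, hvw.ne', hfw, hfw.symm]
    · intro i hi
      simpa only [testBit_land, Bool.and_eq_true, hqb, and_assoc] using hi
  · omega
  · by_contra! hpos
    have e : Nat.shiftLeft (2 ^ c.first) 1 = 2 ^ (c.first + 1) := by
      change 2 ^ c.first <<< 1 = _
      rw [Nat.shiftLeft_eq, ← pow_add]
    rw [e] at h4
    have hf := hc.first_mem
    have hfU := hc.mem _ hf
    have hs : c.first + 1 ∈ c.labels := by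
      rw [Cell.mem_labels]
      omega
    have hsU := hc.mem _ hs
    have hvf := (hc.adj _ hf).2 (by omega)
    have hvs := (hc.adj _ hs).2 (by omega)
    refine hH (hasHexagon_of_clash hv hfU hsU hvf hvs (by omega) (hc.masks _ hf) (hc.masks _ hs)
      (nav := Nat.xor (Nat.xor (Nat.xor full (2 ^ v)) (2 ^ c.first)) (2 ^ (c.first + 1))) ?_ ?_ h4)
    · simp only [testBit_xor, Nat.testBit_two_pow, hfull _ hv, hfull _ hfU, hfull _ hsU]
      simp [hvf.ne, hvf.ne', hvs.ne, hvs.ne']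
    · intro i hi
      rw [testBit_land, Bool.and_eq_true] at hi
      exact ⟨hi.1, hi.1, hi.2⟩
  · omega

/-- The mask of the chosen neighbours. -/
noncomputable def nbrMask (H : SimpleGraph ℕ) (v : ℕ) : Avail → ℕ → ℕ
  | .nil, nb => nb
  | .cons _ b cnt lim m u1 u2 l _ t, nb =>
    nbrMask H v t (Nat.lor nb (interval b (degIn H (Cell.labels ⟨b, cnt, lim, m, u1, u2, l⟩) v)))

/-- The classes after `v` has been processed with neighbourhood mask `rv`. -/
noncomputable def refined (H : SimpleGraph ℕ) (v vb dm rv : ℕ) : Avail → Cls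
  | .nil => .nil
  | .cons f b cnt lim m u1 u2 l _ t =>
    if degIn H (Cell.labels ⟨b, cnt, lim, m, u1, u2, l⟩) v = 0 then
      .cons b cnt (Nat.sub lim (Nat.sub lim (Nat.add f dm))) m u1 u2 l (refined H v vb dm rv t)
    else splitCls (degIn H (Cell.labels ⟨b, cnt, lim, m, u1, u2, l⟩) v) vb
      (Nat.sub lim (Nat.sub lim (Nat.add f dm))) b cnt m u1 u2 l rv (refined H v vb dm rv t)

def Avail.Sized : Avail → Prop
  | .nil => True
  | .cons _ _ cnt _ _ _ _ _ s t => s = cnt + size t ∧ t.Sized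

/-- The number of neighbours of `v` in the available classes. -/
noncomputable def availDeg (H : SimpleGraph ℕ) (v : ℕ) (a : Avail) : ℕ :=
  (a.toList.map fun e => degIn H e.2.labels v).sum

theorem Avail.Sized.availDeg_le {a : Avail} (h : a.Sized) : availDeg H v a ≤ size a := by
  induction a with
  | nil => rfl
  | cons f b cnt lim m u1 u2 l s t ih =>
    change _ ≤ s
    rw [h.1, availDeg, toList, List.map_cons, List.sum_cons]
    exact Nat.add_le_add degIn_le_cnt (ih h.2)

theorem tryCounts_spec {vb cap b cnt m u1 u2 : ℕ} {l : Rows} {K : ℕ → Cls → Cls} {h : Chosen}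
    {nb left : ℕ} {ih : (ℕ → Cls → Cls) → Chosen → ℕ → ℕ → Bool} {k : ℕ}
    (ht : tryCounts vb cap b cnt m u1 u2 l K h nb left ih k = true) :
    ih (fun rv rest => K rv (Cls.cons b cnt cap m u1 u2 l rest)) h nb left = true ∧
    ∀ j ≤ k, 0 < j → ih (fun rv rest => K rv (splitCls j vb cap b cnt m u1 u2 l rv rest))
      (Chosen.cons b m u1 u2 h) (Nat.lor nb (interval b j)) (left - j) = true := by
  induction k with
  | zero => exact ⟨ht, fun j h1 h2 => absurd h1 (by omega)⟩
  | succ k ihk =>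
    change (IF tryCounts vb cap b cnt m u1 u2 l K h nb left ih k THEN
      ih (fun rv rest => K rv (splitCls (k + 1) vb cap b cnt m u1 u2 l rv rest))
      (Chosen.cons b m u1 u2 h) (Nat.lor nb (interval b (k + 1))) (left - (k + 1)) ELSE false) = true
      at ht
    rw [rec_eq_ite] at ht
    split_ifs at ht with h1
    refine ⟨(ihk h1).1, fun j hj h0 => ?_⟩
    rcases Nat.lt_or_eq_of_le hj with hj | rfl
    · exact (ihk h1).2 j (by omega) h0
    · exact ht

theorem choose_nil (vb nav dm mv : ℕ) (F : ℕ → Cls → Bool) (K : ℕ → Cls → Cls) (h : Chosen)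
    (nb left : ℕ) : choose vb nav dm mv F .nil K h nb left =
      if left = 0 then F (Nat.lor mv nb) (K (Nat.lor mv nb) Cls.nil) else true := by
  change (IF Nat.beq left 0 THEN F (Nat.lor mv nb) (K (Nat.lor mv nb) Cls.nil) ELSE true) = _
  simp only [rec_eq_ite, Nat.beq_eq]

theorem choose_cons (vb nav dm mv : ℕ) (F : ℕ → Cls → Bool) (f b cnt lim m u1 u2 : ℕ) (l : Rows)
    (s : ℕ) (t : Avail) (K : ℕ → Cls → Cls) (h : Chosen) (nb left : ℕ) :
    choose vb nav dm mv F (.cons f b cnt lim m u1 u2 l s t) K h nb left =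
      if left ≤ s then tryCounts vb (Nat.sub lim (Nat.sub lim (Nat.add f dm))) b cnt m u1 u2 l K h nb
        left (choose vb nav dm mv F t) (maxCount nav b m u1 u2 h cnt left) else true := by
  change (IF Nat.ble left s THEN tryCounts vb (Nat.sub lim (Nat.sub lim (Nat.add f dm))) b cnt m u1 u2 l
    K h nb left (choose vb nav dm mv F t) (maxCount nav b m u1 u2 h cnt left) ELSE true) = _
  simp only [rec_eq_ite, Nat.ble_eq]

theorem choose_spec (hv : v ∈ U) {full : ℕ} (hfull : ∀ i ∈ U, full.testBit i = true)
    (hH : ¬ HasHexagon H) {dm mv : ℕ} {F : ℕ → Cls → Bool} {a : Avail}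
    (ha : ∀ e ∈ a.toList, AvailCell H U v e.2)
    (hd : a.toList.Pairwise fun e e' => Disjoint e.2.labels e'.2.labels) (hs : a.Sized)
    {K : ℕ → Cls → Cls} {h : Chosen} {nb : ℕ}
    (hq : ∀ q ∈ h.toList, ∃ w, IsPick H U v q w ∧ ∀ e ∈ a.toList, w ∉ e.2.labels)
    (hc : choose (2 ^ v) (Nat.xor full (2 ^ v)) dm mv F a K h nb (availDeg H v a) = true) :
    F (Nat.lor mv (nbrMask H v a nb))
      (K (Nat.lor mv (nbrMask H v a nb))
        (refined H v (2 ^ v) dm (Nat.lor mv (nbrMask H v a nb)) a)) = true := by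
  induction a generalizing K h nb with
  | nil =>
    rw [choose_nil] at hc
    exact hc
  | cons f b cnt lim m u1 u2 l s t ih =>
    simp only [Avail.toList] at ha hq hd
    have hle : availDeg H v (.cons f b cnt lim m u1 u2 l s t) ≤ s := hs.availDeg_le
    rw [choose_cons, if_pos hle] at hc
    set c : Cell := ⟨b, cnt, lim, m, u1, u2, l⟩ with hcdef
    have hcell : AvailCell H U v c := ha (f, c) List.mem_cons_self
    have e : availDeg H v (.cons f b cnt lim m u1 u2 l s t) = degIn H c.labels v + availDeg H v t := by
      simp [availDeg, Avail.toList, hcdef]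
    rw [e] at hc
    have hd' := List.pairwise_cons.1 hd
    have ih := fun {K h nb} => ih (fun e he => ha e (List.mem_cons_of_mem _ he)) hd'.2 hs.2
      (K := K) (h := h) (nb := nb)
    obtain ⟨h0, h1⟩ := tryCounts_spec hc
    have hmax : degIn H c.labels v ≤ maxCount (Nat.xor full (2 ^ v)) b m u1 u2 h cnt
        (degIn H c.labels v + availDeg H v t) := by
      refine le_maxCount hv hfull hH hcell (fun q hq' => ?_) (by omega)
      obtain ⟨w, hw, hwc⟩ := hq q hq'
      exact ⟨w, hw, hwc (f, c) List.mem_cons_self⟩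
    have hq' : ∀ q ∈ h.toList, ∃ w, IsPick H U v q w ∧ ∀ e ∈ t.toList, w ∉ e.2.labels := by
      intro q hq'
      obtain ⟨w, hw, hwc⟩ := hq q hq'
      exact ⟨w, hw, fun e he => hwc e (List.mem_cons_of_mem _ he)⟩
    by_cases hk : degIn H c.labels v = 0
    · rw [hk, zero_add] at h0
      have := ih hq' h0
      simp only [nbrMask, refined]
      rw [← hcdef, hk, if_pos rfl]
      have e0 : Nat.lor nb (interval b 0) = nb := by
        change nb ||| (b <<< 0 - b) = nb
        simp
      rw [e0]
      exact this
    · have := ih (K := fun rv rest => K rv (splitCls (degIn H c.labels v) (2 ^ v)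
        (Nat.sub lim (Nat.sub lim (Nat.add f dm))) b cnt m u1 u2 l rv rest))
        (h := Chosen.cons b m u1 u2 h) (nb := Nat.lor nb (interval b (degIn H c.labels v))) ?_ ?_
      · simp only [nbrMask, refined]
        rw [← hcdef, if_neg hk]
        exact this
      · intro q hqm
        rcases List.mem_cons.1 hqm with rfl | hqm
        · have hf := hcell.first_mem
          exact ⟨c.first, ⟨hcell.mem _ hf, (hcell.adj _ hf).2 (by omega), hcell.bit,
            hcell.masks _ hf⟩, fun e he => Finset.disjoint_left.1 (hd'.1 e he) hf⟩
        · exact hq' q hqm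
      · have := h1 _ hmax (Nat.pos_of_ne_zero hk)
        rwa [Nat.add_sub_cancel_left] at this

end

section

/-! ### The state after processing a vertex -/

variable {n : ℕ} {H : SimpleGraph ℕ} {U : Finset ℕ} {v : ℕ}

theorem degIn_eq_countP [DecidableRel H.Adj] (z : ℕ) :
    degIn H U z = U.val.countP (fun x => H.Adj z x) := by
  classical
  rw [Multiset.countP_eq_card_filter]
  unfold degIn
  rw [Finset.card_def, Finset.filter_val]
  congr!

theorem countP_labelSum [DecidableRel H.Adj] (z : ℕ) (L : List Cell) :
    (labelSum L).countP (fun x => H.Adj z x) = (L.map fun c => degIn H c.labels z).sum := by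
  induction L with
  | nil => simp
  | cons c L ih => rw [labelSum_cons, Multiset.countP_add, ih, List.map_cons, List.sum_cons,
      degIn_eq_countP]

theorem degIn_erase_of_not_adj {z : ℕ} (h : ¬ H.Adj z v) : degIn H (U.erase v) z = degIn H U z := by
  classical
  unfold degIn
  rw [Finset.filter_erase, Finset.erase_eq_of_notMem (by simp [h])]

theorem degIn_erase_of_adj {z : ℕ} (hv : v ∈ U) (h : H.Adj z v) :
    degIn H (U.erase v) z + 1 = degIn H U z := by
  classical
  unfold degIn
  rw [Finset.filter_erase, Finset.card_erase_add_one (by simp [hv, h])]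

theorem sum_degIn_erase (hv : v ∈ U) :
    ∑ z ∈ U, degIn H U z = 2 * degIn H U v + ∑ z ∈ U.erase v, degIn H (U.erase v) z := by
  classical
  have h1 : ∀ z ∈ U.erase v, degIn H U z = degIn H (U.erase v) z + if H.Adj v z then 1 else 0 := by
    intro z _
    split_ifs with h
    · exact (degIn_erase_of_adj hv h.symm).symm
    · rw [degIn_erase_of_not_adj fun h' => h h'.symm, add_zero]
  have h2 : ∑ z ∈ U.erase v, (if H.Adj v z then 1 else 0) = degIn H U v := by
    rw [← degIn_erase_of_not_adj (v := v) (H.loopless.irrefl v), Finset.sum_boole]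
    unfold degIn
    rw [Nat.cast_id]
  rw [← Finset.add_sum_erase _ _ hv, Finset.sum_congr rfl h1, Finset.sum_add_distrib, h2]
  ring

/-- The class without its last label. -/
def Cell.cut (c : Cell) : Cell := { c with cnt := c.cnt - 1 }

def Cell.last (c : Cell) : ℕ := c.first + (c.cnt - 1)

theorem Cell.labels_eq_cut {c : Cell} (h : 0 < c.cnt) :
    c.labels.val = c.cut.labels.val + {c.last} := by
  have e : (Multiset.Ico c.last (c.first + c.cnt)) = {c.last} := by
    rw [show c.first + c.cnt = c.last + 1 by unfold last; omega]
    exact congrArg Finset.val (Nat.Ico_succ_singleton c.last)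
  rw [← e]
  exact (Multiset.Ico_add_Ico_eq_Ico (show c.first ≤ c.first + (c.cnt - 1) by omega)
    (show c.first + (c.cnt - 1) ≤ c.first + c.cnt by omega)).symm

/-- Degree bounds: `f` up to the class with bit `bv`, and `d` from there on. -/
def DegBounds (H : SimpleGraph ℕ) (U : Finset ℕ) (bv d : ℕ) : ℕ → List Cell → Prop
  | _, [] => True
  | f, c :: t => if c.b = bv then (∀ x ∈ c.labels, degIn H U x ≤ d) ∧ DegBounds H U bv d d t
    else (∀ x ∈ c.labels, degIn H U x ≤ f) ∧ DegBounds H U bv d f t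

theorem avSelf_toList (b cnt lim m u1 u2 : ℕ) (l : Rows) (t : Avail) :
    (avSelf b cnt lim m u1 u2 l t).toList =
      if cnt = 0 then t.toList else (1, ⟨b, cnt, lim, m, u1, u2, l⟩) :: t.toList := by
  unfold avSelf
  simp only [rec_eq_ite, Nat.beq_eq]
  split_ifs <;> rfl

theorem unSelf_toList (b cnt lim m u1 u2 : ℕ) (l : Rows) (t : Cls) :
    (unSelf b cnt lim m u1 u2 l t).toList =
      if cnt = 0 then t.toList else ⟨b, cnt, lim, m, u1, u2, l⟩ :: t.toList := by
  unfold unSelf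
  simp only [rec_eq_ite, Nat.beq_eq]
  split_ifs <;> rfl

theorem available_cons (row bv b cnt lim m u1 u2 : ℕ) (l : Rows) (t : Cls) (f : ℕ) :
    available row bv (.cons b cnt lim m u1 u2 l t) f =
      if Nat.land row b = 0 then
        if b = bv then avSelf b (cnt - 1) lim m u1 u2 l (available row bv t 1)
        else avCons f b cnt lim m u1 u2 l (available row bv t f)
      else if b = bv then available row bv t 1 else available row bv t f := by
  change (IFA Nat.beq (Nat.land row b) 0 THEN
    IFA Nat.beq b bv THEN avSelf b (cnt - 1) lim m u1 u2 l (available row bv t 1) ELSE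
      avCons f b cnt lim m u1 u2 l (available row bv t f)
    ELSE (IFA Nat.beq b bv THEN available row bv t 1 ELSE available row bv t f)) = _
  simp only [rec_eq_ite, Nat.beq_eq]

theorem unavailable_cons (row bv d : ℕ) (b cnt lim m u1 u2 : ℕ) (l : Rows) (t R : Cls) (f : ℕ) :
    unavailable row bv d (.cons b cnt lim m u1 u2 l t) R f =
      if Nat.land row b = 0 then
        if b = bv then unavailable row bv d t R d else unavailable row bv d t R f
      else
        if b = bv then unSelf b (cnt - 1) (Nat.sub lim (Nat.sub lim d)) m u1 u2 l
          (unavailable row bv d t R d)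
        else .cons b cnt (Nat.sub lim (Nat.sub lim f)) m u1 u2 l (unavailable row bv d t R f) := by
  change (IFC Nat.beq (Nat.land row b) 0 THEN
      (IFC Nat.beq b bv THEN unavailable row bv d t R d ELSE unavailable row bv d t R f)
    ELSE
      IFC Nat.beq b bv THEN
        unSelf b (cnt - 1) (Nat.sub lim (Nat.sub lim d)) m u1 u2 l (unavailable row bv d t R d)
      ELSE Cls.cons b cnt (Nat.sub lim (Nat.sub lim f)) m u1 u2 l (unavailable row bv d t R f)) = _
  simp only [rec_eq_ite, Nat.beq_eq]

theorem sized_available (row bv : ℕ) (C : Cls) (f : ℕ) : (available row bv C f).Sized := by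
  induction C generalizing f with
  | nil => trivial
  | cons b cnt lim m u1 u2 l t ih =>
    rw [available_cons]
    split_ifs
    · unfold avSelf
      simp only [rec_eq_ite, Nat.beq_eq]
      split_ifs
      · exact ih 1
      · exact ⟨rfl, ih 1⟩
    · exact ⟨rfl, ih f⟩
    · exact ih 1
    · exact ih f

theorem unavailable_toList (row bv d : ℕ) (C R : Cls) (f : ℕ) :
    (unavailable row bv d C R f).toList = (unavailable row bv d C .nil f).toList ++ R.toList := by
  induction C generalizing f with
  | nil => rfl
  | cons b cnt lim m u1 u2 l t ih =>
    simp only [unavailable_cons]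
    split_ifs
    · exact ih d
    · exact ih f
    · rw [unSelf_toList, unSelf_toList]
      split_ifs
      · exact ih d
      · rw [ih d]
        rfl
    · change _ :: (unavailable row bv d t R f).toList = _ :: (unavailable row bv d t .nil f).toList ++ _
      rw [ih f]
      rfl

/-- A class of the list, possibly without its last label. -/
def FromCell (bv : ℕ) (c c' : Cell) : Prop :=
  c.b ≠ bv ∧ c' = c ∨ c.b = bv ∧ c' = c.cut ∧ 0 < c'.cnt

theorem mem_available {row bv d dm : ℕ} (hd : d = 1 + dm) {C : Cls} {f : ℕ}
    (h : DegBounds H U bv d (f + dm) C.toList) {e : ℕ × Cell}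
    (he : e ∈ (available row bv C f).toList) :
    ∃ c ∈ C.toList, Nat.land row c.b = 0 ∧ FromCell bv c e.2 ∧
      ∀ x ∈ c.labels, degIn H U x ≤ e.1 + dm := by
  induction C generalizing f with
  | nil => simp [available, Avail.toList] at he
  | cons b cnt lim m u1 u2 l t ih =>
    simp only [Cls.toList] at h ⊢
    set c : Cell := ⟨b, cnt, lim, m, u1, u2, l⟩ with hc
    have ih : ∀ {f}, DegBounds H U bv d (f + dm) t.toList → e ∈ (available row bv t f).toList →
        ∃ c' ∈ c :: t.toList, Nat.land row c'.b = 0 ∧ FromCell bv c' e.2 ∧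
      ∀ x ∈ c'.labels, degIn H U x ≤ e.1 + dm := by
      intro f h1 h2
      obtain ⟨c', hc', h⟩ := ih h1 h2
      exact ⟨c', List.mem_cons_of_mem _ hc', h⟩
    rw [available_cons] at he
    rw [DegBounds] at h
    split_ifs at he with h1 h2 h2
    · rw [if_pos h2] at h
      rw [avSelf_toList] at he
      split_ifs at he with h3
      · exact ih (hd ▸ h.2) he
      · rcases List.mem_cons.1 he with rfl | he
        · exact ⟨c, List.mem_cons_self, h1, .inr ⟨h2, rfl, Nat.pos_of_ne_zero h3⟩, hd ▸ h.1⟩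
        · exact ih (hd ▸ h.2) he
    · rw [if_neg h2] at h
      rcases List.mem_cons.1 he with rfl | he
      · exact ⟨c, List.mem_cons_self, h1, .inl ⟨h2, rfl⟩, h.1⟩
      · exact ih h.2 he
    · rw [if_pos h2] at h
      exact ih (hd ▸ h.2) he
    · rw [if_neg h2] at h
      exact ih h.2 he

theorem mem_unavailable {row bv d : ℕ} {C : Cls} {f : ℕ} (h : DegBounds H U bv d f C.toList)
    {c' : Cell} (he : c' ∈ (unavailable row bv d C .nil f).toList) :
    ∃ c ∈ C.toList, Nat.land row c.b ≠ 0 ∧ ∃ k, FromCell bv c { c' with lim := c.lim } ∧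
      c'.lim = min c.lim k ∧ ∀ x ∈ c.labels, degIn H U x ≤ k := by
  induction C generalizing f with
  | nil => simp [unavailable, Cls.toList] at he
  | cons b cnt lim m u1 u2 l t ih =>
    simp only [Cls.toList] at h ⊢
    set c : Cell := ⟨b, cnt, lim, m, u1, u2, l⟩ with hc
    have ih : ∀ {f}, DegBounds H U bv d f t.toList → c' ∈ (unavailable row bv d t .nil f).toList →
        ∃ c'' ∈ c :: t.toList, Nat.land row c''.b ≠ 0 ∧ ∃ k, FromCell bv c'' { c' with lim := c''.lim } ∧
      c'.lim = min c''.lim k ∧ ∀ x ∈ c''.labels, degIn H U x ≤ k := by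
      intro f h1 h2
      obtain ⟨c', hc', h⟩ := ih h1 h2
      exact ⟨c', List.mem_cons_of_mem _ hc', h⟩
    rw [unavailable_cons] at he
    rw [DegBounds] at h
    split_ifs at he with h1 h2 h2
    · rw [if_pos h2] at h
      exact ih h.2 he
    · rw [if_neg h2] at h
      exact ih h.2 he
    · rw [if_pos h2] at h
      rw [unSelf_toList] at he
      split_ifs at he with h3
      · exact ih h.2 he
      · rcases List.mem_cons.1 he with rfl | he
        · exact ⟨c, List.mem_cons_self, h1, d, .inr ⟨h2, rfl, Nat.pos_of_ne_zero h3⟩,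
            sub_sub_eq_min _ _, h.1⟩
        · exact ih h.2 he
    · rw [if_neg h2] at h
      rcases List.mem_cons.1 he with rfl | he
      · exact ⟨c, List.mem_cons_self, h1, f, .inl ⟨h2, rfl⟩, sub_sub_eq_min _ _, h.1⟩
      · exact ih h.2 he

theorem labelSum_available (row bv d : ℕ) (C : Cls) (hC : ∀ c ∈ C.toList, 0 < c.cnt) (f f' : ℕ) :
    labelSum ((available row bv C f).toList.map Prod.snd) +
      labelSum (unavailable row bv d C .nil f').toList +
      (C.toList.map fun c => if c.b = bv then ({c.last} : Multiset ℕ) else 0).sum =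
    labelSum C.toList := by
  induction C generalizing f f' with
  | nil => rfl
  | cons b cnt lim m u1 u2 l t ih =>
    rw [available_cons, unavailable_cons]
    simp only [Cls.toList, List.map_cons, List.sum_cons, labelSum_cons]
    set c : Cell := ⟨b, cnt, lim, m, u1, u2, l⟩ with hc
    have hpos : 0 < c.cnt := hC c List.mem_cons_self
    have ih := ih fun c hc => hC c (List.mem_cons_of_mem _ hc)
    have hcut : ∀ {k}, (Cell.labels ⟨b, cnt - 1, k, m, u1, u2, l⟩) = c.cut.labels := rfl
    have hcut0 : cnt - 1 = 0 → c.cut.labels.val = 0 := by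
      intro h0
      simp [Cell.labels, Cell.cut, hc, h0]
    split_ifs with h1 h2 h2
    · rw [avSelf_toList, ← ih 1 d, Cell.labels_eq_cut hpos]
      split_ifs with h3
      · rw [hcut0 h3, zero_add]
        abel
      · rw [List.map_cons, labelSum_cons, hcut]
        abel
    · rw [← ih f f']
      change labelSum (c :: (available row bv t f).toList.map Prod.snd) + _ + _ = _
      rw [labelSum_cons]
      abel
    · rw [unSelf_toList, ← ih 1 d, Cell.labels_eq_cut hpos]
      split_ifs with h3
      · rw [hcut0 h3, zero_add]
        abel
      · rw [labelSum_cons, hcut]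
        abel
    · rw [← ih f f']
      change _ + labelSum ({ c with lim := Nat.sub lim (Nat.sub lim f') } ::
        (unavailable row bv d t .nil f').toList) + _ = _
      rw [labelSum_cons]
      change _ + (c.labels.val + _) + _ = _
      abel

end

section

variable {n : ℕ} {H : SimpleGraph ℕ} {U : Finset ℕ} {v : ℕ} {L : List Cell} {P : Rows} {g : ℕ}

theorem interval_testBit (b k x : ℕ) :
    (interval (2 ^ b) k).testBit x = true ↔ b ≤ x ∧ x < b + k := by
  rw [interval_eq, testBit_sum_two_pow, Finset.mem_Ico]

theorem nbrMask_testBit {a : Avail} (ha : ∀ e ∈ a.toList, AvailCell H U v e.2) (nb x : ℕ) :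
    (nbrMask H v a nb).testBit x = true ↔
      nb.testBit x = true ∨ ∃ e ∈ a.toList, x ∈ e.2.labels ∧ H.Adj v x := by
  induction a generalizing nb with
  | nil => simp [nbrMask, Avail.toList]
  | cons f b cnt lim m u1 u2 l s t ih =>
    simp only [Avail.toList] at ha ⊢
    set c : Cell := ⟨b, cnt, lim, m, u1, u2, l⟩ with hcdef
    have hc : AvailCell H U v c := ha (f, c) List.mem_cons_self
    have hb : b = 2 ^ c.first := hc.bit
    rw [nbrMask, ih fun e he => ha e (List.mem_cons_of_mem _ he), ← hcdef, testBit_lor,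
      Bool.or_eq_true, hb, interval_testBit, List.exists_mem_cons_iff, or_assoc]
    refine or_congr_right (or_congr_left ⟨fun hx => ?_, fun hx => ?_⟩)
    · have hxl : x ∈ c.labels := by
        rw [Cell.mem_labels]
        have := degIn_le_cnt (H := H) (v := v) (c := c)
        omega
      exact ⟨hxl, (hc.adj x hxl).2 hx.2⟩
    · exact ⟨(Cell.mem_labels.1 hx.1).1, (hc.adj x hx.1).1 hx.2⟩

/-- In an interval, a downward closed set is an initial segment. -/
theorem adj_iff_of_down {c : Cell}
    (h : ∀ x ∈ c.labels, ∀ y ∈ c.labels, x < y → H.Adj v y → H.Adj v x) {x : ℕ} (hx : x ∈ c.labels) :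
    H.Adj v x ↔ x < c.first + degIn H c.labels v := by
  classical
  have hx' := Cell.mem_labels.1 hx
  unfold degIn
  constructor
  · intro hvx
    have hsub : Finset.Ico c.first (x + 1) ⊆ c.labels.filter (H.Adj v) := by
      intro y hy
      rw [Finset.mem_Ico] at hy
      have hyl : y ∈ c.labels := Cell.mem_labels.2 ⟨hy.1, by omega⟩
      rw [Finset.mem_filter]
      rcases eq_or_ne y x with rfl | hne
      · exact ⟨hyl, hvx⟩
      · exact ⟨hyl, h y hyl x hx (by omega) hvx⟩
    have := Finset.card_le_card hsub
    rw [Nat.card_Ico] at this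
    omega
  · intro hlt
    by_contra hvx
    have hsub : c.labels.filter (H.Adj v) ⊆ Finset.Ico c.first x := by
      intro y hy
      rw [Finset.mem_filter] at hy
      rw [Finset.mem_Ico]
      refine ⟨(Cell.mem_labels.1 hy.1).1, ?_⟩
      by_contra! hxy
      rcases eq_or_lt_of_le hxy with rfl | hxy
      · exact hvx hy.2
      · exact hvx (h x hx y hy.1 hxy hy.2)
    have := Finset.card_le_card hsub
    rw [Nat.card_Ico] at this
    omega

theorem IsRow.erase {e : ℕ × ℕ} (h : IsRow H U e) : IsRow H (U.erase v) e := by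
  obtain ⟨a, ha, h1⟩ := h
  exact ⟨a, fun h => ha (Finset.mem_of_mem_erase h), h1⟩

theorem MasksAt.erase_of_not_adj (hv : v ∈ U) {m u1 u2 x : ℕ} (h : MasksAt H U m u1 u2 x)
    (hx : ¬ H.Adj v x) : MasksAt H (U.erase v) m u1 u2 x := by
  refine ⟨fun p => ?_, h.one, h.two⟩
  rw [h.adj, Finset.mem_erase, not_and_or, not_not]
  constructor
  · exact fun ⟨h1, h2⟩ => ⟨.inr h1, h2⟩
  · rintro ⟨rfl | h1, h2⟩
    · exact absurd h2.symm hx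
    · exact ⟨h1, h2⟩

theorem MasksAt.erase_of_adj (hv : v ∈ U) {m u1 u2 x rv : ℕ} (h : MasksAt H U m u1 u2 x)
    (hx : H.Adj v x) (hrv : ∀ y, rv.testBit y = true ↔ H.Adj v y) :
    MasksAt H (U.erase v) (Nat.lor m (2 ^ v)) (Nat.lor u1 rv) (Nat.lor u2 (Nat.land u1 rv)) x := by
  have hm : ∀ p, (Nat.lor m (2 ^ v)).testBit p = true ↔ m.testBit p = true ∨ v = p := by
    intro p
    rw [testBit_lor, Bool.or_eq_true, Nat.testBit_two_pow, decide_eq_true_iff]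
  refine ⟨fun p => ?_, fun y hy => ?_, fun y hy => ?_⟩
  · rw [hm, h.adj, Finset.mem_erase, not_and_or, not_not]
    constructor
    · rintro (⟨h1, h2⟩ | rfl)
      · exact ⟨.inr h1, h2⟩
      · exact ⟨.inl rfl, hx.symm⟩
    · rintro ⟨rfl | h1, h2⟩
      · exact .inr rfl
      · exact .inl ⟨h1, h2⟩
  · rw [testBit_lor, Bool.or_eq_true] at hy
    rcases hy with hy | hy
    · obtain ⟨p, hp, hpy⟩ := h.one y hy
      exact ⟨p, (hm p).2 (.inl hp), hpy⟩
    · exact ⟨v, (hm v).2 (.inr rfl), (hrv y).1 hy⟩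
  · rw [testBit_lor, Bool.or_eq_true, testBit_land, Bool.and_eq_true] at hy
    rcases hy with hy | ⟨hy1, hy2⟩
    · obtain ⟨p, q, hpq, hp, hq, h1⟩ := h.two y hy
      exact ⟨p, q, hpq, (hm p).2 (.inl hp), (hm q).2 (.inl hq), h1⟩
    · obtain ⟨p, hp, hpy⟩ := h.one y hy1
      refine ⟨p, v, ?_, (hm p).2 (.inl hp), (hm v).2 (.inr rfl), hpy, (hrv y).1 hy2⟩
      rintro rfl
      exact ((h.adj p).1 hp).1 hv

theorem Cell.Valid.erase (hv : v ∈ U) {c : Cell} (h : c.Valid H U) (hc : ∀ x ∈ c.labels, ¬ H.Adj v x)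
    {k : ℕ} (hk : ∀ x ∈ c.labels, degIn H U x ≤ k) :
    Cell.Valid H (U.erase v) { c with lim := min c.lim k } := by
  refine ⟨h.pos, h.bit, fun x hx => (h.masks x hx).erase_of_not_adj hv (hc x hx),
    fun e he => (h.rows e he).erase, h.rows_mem, fun x hx => ?_⟩
  rw [degIn_erase_of_not_adj fun h' => hc x hx h'.symm]
  exact le_min (h.deg x hx) (hk x hx)

/-- A subclass. -/
theorem Cell.Valid.sub {c : Cell} (h : c.Valid H U) {b k : ℕ} (hk : 0 < k) (hb : b = 2 ^ Nat.log 2 b)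
    (hs : Cell.labels ⟨b, k, c.lim, c.m, c.u1, c.u2, c.l⟩ ⊆ c.labels) :
    Cell.Valid H U ⟨b, k, c.lim, c.m, c.u1, c.u2, c.l⟩ :=
  ⟨hk, hb, fun x hx => h.masks x (hs hx), h.rows, h.rows_mem, fun x hx => h.deg x (hs hx)⟩

theorem Cell.Valid.erase_of_adj (hv : v ∈ U) {c : Cell} (h : c.Valid H U)
    (hc : ∀ x ∈ c.labels, H.Adj v x) {k : ℕ} (hk : ∀ x ∈ c.labels, degIn H U x ≤ k) {rv : ℕ}
    (hrv : ∀ y, rv.testBit y = true ↔ H.Adj v y) :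
    Cell.Valid H (U.erase v) ⟨c.b, c.cnt, Nat.sub (min c.lim k) 1, Nat.lor c.m (2 ^ v),
      Nat.lor c.u1 rv, Nat.lor c.u2 (Nat.land c.u1 rv), .cons (2 ^ v) rv c.l⟩ := by
  refine ⟨h.pos, h.bit, fun x hx => (h.masks x hx).erase_of_adj hv (hc x hx) hrv, fun e he => ?_,
    fun e he a ha => ?_, fun x hx => ?_⟩
  · rcases List.mem_cons.1 he with rfl | he
    · exact ⟨v, by simp, rfl, hrv⟩
    · exact (h.rows e he).erase
  · rw [testBit_lor, Bool.or_eq_true, Nat.testBit_two_pow, decide_eq_true_iff]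
    rcases List.mem_cons.1 he with rfl | he
    · exact .inr (Nat.pow_right_injective le_rfl ha)
    · exact .inl (h.rows_mem e he a ha)
  · have h1 := degIn_erase_of_adj hv (hc x hx).symm
    have h2 := le_min (h.deg x hx) (hk x hx)
    change _ ≤ min c.lim k - 1
    omega

theorem shiftLeft_two_pow (a k : ℕ) : Nat.shiftLeft (2 ^ a) k = 2 ^ (a + k) := by
  change 2 ^ a <<< k = _
  rw [Nat.shiftLeft_eq, ← pow_add]

theorem splitCls_toList (k vb cap b cnt m u1 u2 : ℕ) (l : Rows) (rv : ℕ) (rest : Cls) :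
    (splitCls k vb cap b cnt m u1 u2 l rv rest).toList =
      ⟨b, k, Nat.sub cap 1, Nat.lor m vb, Nat.lor u1 rv, Nat.lor u2 (Nat.land u1 rv), .cons vb rv l⟩ ::
      if k = cnt then rest.toList
      else ⟨Nat.shiftLeft b k, cnt - k, cap, m, u1, u2, l⟩ :: rest.toList := by
  unfold splitCls
  simp only [rec_eq_ite, Nat.beq_eq, Cls.toList]
  split_ifs <;> rfl

theorem refined_valid (hv : v ∈ U) {dm rv : ℕ} (hrv : ∀ y, rv.testBit y = true ↔ H.Adj v y) {a : Avail}
    (ha : ∀ e ∈ a.toList, AvailCell H U v e.2 ∧ e.2.Valid H U ∧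
      ∀ x ∈ e.2.labels, degIn H U x ≤ e.1 + dm) :
    ∀ c ∈ (refined H v (2 ^ v) dm rv a).toList, c.Valid H (U.erase v) := by
  induction a with
  | nil => simp [refined, Cls.toList]
  | cons f b cnt lim m u1 u2 l s t ih =>
    simp only [Avail.toList] at ha
    set c : Cell := ⟨b, cnt, lim, m, u1, u2, l⟩ with hcdef
    obtain ⟨hc, hcv, hd⟩ := ha (f, c) List.mem_cons_self
    dsimp only at hc hcv hd
    have ih := ih fun e he => ha e (List.mem_cons_of_mem _ he)
    have hb : b = 2 ^ c.first := hc.bit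
    rw [refined, ← hcdef]
    split_ifs with h0
    · intro c' hc'
      rcases List.mem_cons.1 hc' with rfl | hc'
      · rw [sub_sub_eq_min]
        exact hcv.erase hv (degIn_eq_zero.1 h0) hd
      · exact ih c' hc'
    · set k := degIn H c.labels v with hk
      have hkc : k ≤ cnt := degIn_le_cnt (c := c)
      have hfst : Nat.log 2 b = c.first := rfl
      intro c' hc'
      rw [splitCls_toList, sub_sub_eq_min] at hc'
      rcases List.mem_cons.1 hc' with rfl | hc'
      · have hs : Cell.labels ⟨b, k, lim, m, u1, u2, l⟩ ⊆ c.labels :=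
          Finset.Ico_subset_Ico le_rfl (Nat.add_le_add_left hkc _)
        refine (hcv.sub (Nat.pos_of_ne_zero h0) hb hs).erase_of_adj hv (fun x hx => ?_)
          (fun x hx => hd x (hs hx)) hrv
        exact (hc.adj x (hs hx)).2 (Cell.mem_labels.1 hx).2
      · split_ifs at hc' with h1
        · exact ih c' hc'
        · rcases List.mem_cons.1 hc' with rfl | hc'
          · rw [hb, shiftLeft_two_pow]
            have hl : Nat.log 2 (2 ^ (c.first + k)) = c.first + k := Nat.log_pow (by omega) _
            have hs : Cell.labels ⟨2 ^ (c.first + k), cnt - k, lim, m, u1, u2, l⟩ ⊆ c.labels := by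
              refine Finset.Ico_subset_Ico ?_ ?_
              · change _ ≤ Nat.log 2 (2 ^ (c.first + k))
                omega
              · change Nat.log 2 (2 ^ (c.first + k)) + (cnt - k) ≤ c.first + cnt
                omega
            refine (hcv.sub (by omega) (by rw [hl]) hs).erase hv (fun x hx hvx => ?_)
              (fun x hx => hd x (hs hx))
            have h2 := (hc.adj x (hs hx)).1 hvx
            have h3 := (Cell.mem_labels.1 hx).1
            change Nat.log 2 (2 ^ (c.first + k)) ≤ x at h3
            omega
          · exact ih c' hc'

theorem labelSum_refined {vb dm rv : ℕ} {a : Avail} (ha : ∀ e ∈ a.toList, AvailCell H U v e.2) :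
    labelSum (refined H v vb dm rv a).toList = labelSum (a.toList.map Prod.snd) := by
  induction a with
  | nil => rfl
  | cons f b cnt lim m u1 u2 l s t ih =>
    simp only [Avail.toList] at ha
    set c : Cell := ⟨b, cnt, lim, m, u1, u2, l⟩ with hcdef
    have hc : AvailCell H U v c := ha (f, c) List.mem_cons_self
    have ih := ih fun e he => ha e (List.mem_cons_of_mem _ he)
    have hb : b = 2 ^ c.first := hc.bit
    rw [refined, ← hcdef]
    simp only [Avail.toList, List.map_cons, labelSum_cons]
    rw [← ih]
    split_ifs with h0
    · simp only [Cls.toList, labelSum_cons]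
      rfl
    · set k := degIn H c.labels v with hk
      have hkc : k ≤ cnt := degIn_le_cnt (c := c)
      rw [splitCls_toList, labelSum_cons]
      split_ifs with h1
      · rw [← h1]
        rfl
      · rw [labelSum_cons, ← add_assoc]
        congr 1
        have hl : Nat.log 2 (Nat.shiftLeft b k) = c.first + k := by
          rw [hb, shiftLeft_two_pow, Nat.log_pow (by omega)]
        change Multiset.Ico c.first (c.first + k) + Multiset.Ico (Nat.log 2 (Nat.shiftLeft b k))
          (Nat.log 2 (Nat.shiftLeft b k) + (cnt - k)) = Multiset.Ico c.first (c.first + cnt)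
        rw [hl, Multiset.Ico_add_Ico_eq_Ico (by omega) (by omega)]
        congr 1
        omega

end

section

variable {n : ℕ} {H : SimpleGraph ℕ} {U : Finset ℕ} {v : ℕ} {L : List Cell} {P : Rows} {g : ℕ}

theorem Cell.last_mem {c : Cell} (h : 0 < c.cnt) : c.last ∈ c.labels := by
  rw [Cell.mem_labels]
  unfold last
  omega

theorem Cell.mem_cut {c : Cell} (h : 0 < c.cnt) {x : ℕ} :
    x ∈ c.cut.labels ↔ x ∈ c.labels ∧ x ≠ c.last := by
  have h1 : x ∈ c.cut.labels ↔ c.first ≤ x ∧ x < c.first + (c.cnt - 1) := Cell.mem_labels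
  rw [h1, Cell.mem_labels]
  unfold last
  omega

theorem Compat.b_eq_iff (h : Compat n H U L P g) {c c' : Cell} (hc : c ∈ L) (hc' : c' ∈ L) :
    c.b = c'.b ↔ c = c' := by
  refine ⟨fun e => ?_, fun e => e ▸ rfl⟩
  have e' : c.first = c'.first := congrArg (Nat.log 2) e
  exact h.eq_of_mem hc hc' (h.valid c hc).first_mem (e' ▸ (h.valid c' hc').first_mem)

theorem Compat.fromCell (h : Compat n H U L P g) {c₀ c c' : Cell} (hc₀ : c₀ ∈ L) (hc : c ∈ L)
    (hf : FromCell c₀.b c c') :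
    c'.Valid H U ∧ c'.first = c.first ∧ ∀ x, x ∈ c'.labels ↔ x ∈ c.labels ∧ x ≠ c₀.last := by
  have hv := h.valid c hc
  rcases hf with ⟨hne, rfl⟩ | ⟨he, rfl, hpos⟩
  · refine ⟨hv, rfl, fun x => ⟨fun hx => ⟨hx, ?_⟩, And.left⟩⟩
    rintro rfl
    exact hne (congrArg _ (h.eq_of_mem hc hc₀ hx (Cell.last_mem (h.valid c₀ hc₀).pos)))
  · obtain rfl := (h.b_eq_iff hc hc₀).1 he
    have key : ∀ x, x ∈ c.cut.labels ↔ x ∈ c.labels ∧ x ≠ c.last := fun x => Cell.mem_cut hv.pos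
    exact ⟨hv.sub hpos hv.bit fun x hx => ((key x).1 hx).1, rfl, key⟩

theorem sum_ite_eq_singleton {c₀ : Cell} (hn : L.Nodup) (hc : c₀ ∈ L)
    (h : ∀ c ∈ L, c.b = c₀.b → c = c₀) :
    (L.map fun c => if c.b = c₀.b then ({c.last} : Multiset ℕ) else 0).sum = {c₀.last} := by
  induction L with
  | nil => simp at hc
  | cons c L ih =>
    rw [List.nodup_cons] at hn
    rw [List.map_cons, List.sum_cons]
    rcases List.mem_cons.1 hc with rfl | hc'
    · rw [if_pos rfl, List.sum_eq_zero, add_zero]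
      intro s hs
      obtain ⟨c, hcL, rfl⟩ := List.mem_map.1 hs
      refine if_neg fun e => hn.1 ?_
      exact h c (List.mem_cons_of_mem _ hcL) e ▸ hcL
    · rw [ih hn.2 hc' fun c hc => h c (List.mem_cons_of_mem _ hc), if_neg, zero_add]
      intro e
      exact hn.1 (h c List.mem_cons_self e ▸ hc')

theorem pairwise_disjoint_of_nodup (hn : (labelSum L).Nodup) :
    L.Pairwise fun c c' => Disjoint c.labels c'.labels := by
  induction L with
  | nil => exact List.Pairwise.nil
  | cons c L ih =>
    rw [labelSum_cons, Multiset.nodup_add, Multiset.disjoint_left] at hn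
    refine List.pairwise_cons.2 ⟨fun c' hc' => ?_, ih hn.2.1⟩
    rw [Finset.disjoint_left]
    exact fun x hx hx' => hn.2.2 hx (mem_labelSum.2 ⟨c', hc', hx'⟩)

variable {C : Cls} {c₀ : Cell} {dm row : ℕ}

/-- The hypotheses under which the last label of the class `c₀` is processed as a vertex of degree
`dm + 1`. -/
structure Ready (n : ℕ) (H : SimpleGraph ℕ) (U : Finset ℕ) (C : Cls) (P : Rows) (g : ℕ) (c₀ : Cell)
    (dm row : ℕ) : Prop where
  compat : Compat n H U C.toList P g
  mem : c₀ ∈ C.toList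
  deg : degIn H U c₀.last = dm + 1
  bounds : DegBounds H U c₀.b (dm + 1) dm C.toList
  row : ∀ c ∈ C.toList, row.testBit c.first = true → NoEdge H c₀ c
  first : NbrsFirst H C.toList c₀.last

namespace Ready

variable (h : Ready n H U C P g c₀ dm row)
include h

theorem last_mem_labels : c₀.last ∈ c₀.labels := Cell.last_mem (h.compat.valid c₀ h.mem).pos

theorem last_mem : c₀.last ∈ U := h.compat.mem h.mem h.last_mem_labels

theorem avail {e : ℕ × Cell} (he : e ∈ (available row c₀.b C 0).toList) :
    AvailCell H U c₀.last e.2 ∧ e.2.Valid H U ∧ ∀ x ∈ e.2.labels, degIn H U x ≤ e.1 + dm := by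
  obtain ⟨c, hc, -, hf, hd⟩ := mem_available (add_comm dm 1) (by simpa using h.bounds) he
  obtain ⟨hv, -, hl⟩ := h.compat.fromCell h.mem hc hf
  refine ⟨⟨hv.pos, hv.bit, fun x hx => h.compat.mem hc ((hl x).1 hx).1, fun x hx => ((hl x).1 hx).2,
    hv.masks, fun x hx => adj_iff_of_down ?_ hx⟩, hv, fun x hx => hd x ((hl x).1 hx).1⟩
  intro x hx y hy hxy hvy
  exact h.first c hc x ((hl x).1 hx).1 y ((hl y).1 hy).1 hxy ((hl x).1 hx).2 hvy

theorem unavail {c' : Cell} (hc' : c' ∈ (unavailable row c₀.b (dm + 1) C .nil dm).toList) :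
    c'.Valid H (U.erase c₀.last) ∧ ∀ x ∈ c'.labels, ¬ H.Adj c₀.last x := by
  obtain ⟨c, hc, hr, k, hf, hlim, hd⟩ := mem_unavailable h.bounds hc'
  rw [(h.compat.valid c hc).bit, Ne, land_two_pow_eq_zero, Bool.not_eq_false] at hr
  obtain ⟨hv, -, hl⟩ := h.compat.fromCell h.mem hc hf
  have hno : ∀ x ∈ c'.labels, ¬ H.Adj c₀.last x := fun x hx =>
    h.row c hc hr _ h.last_mem_labels x ((hl x).1 hx).1
  refine ⟨?_, hno⟩
  have := hv.erase h.last_mem hno (k := k) fun x hx => hd x ((hl x).1 hx).1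
  dsimp only at this
  rwa [← hlim] at this

theorem labels :
    labelSum ((available row c₀.b C 0).toList.map Prod.snd) +
      labelSum (unavailable row c₀.b (dm + 1) C .nil dm).toList + {c₀.last} = U.val := by
  rw [← h.compat.labels, ← labelSum_available row c₀.b (dm + 1) C
    (fun c hc => (h.compat.valid c hc).pos) 0 dm,
    sum_ite_eq_singleton h.compat.nodup_cells h.mem fun c hc e => (h.compat.b_eq_iff hc h.mem).1 e]

theorem pairwise : (available row c₀.b C 0).toList.Pairwise
    fun e e' => Disjoint e.2.labels e'.2.labels := by
  have hn := h.labels ▸ U.nodup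
  rw [add_assoc, Multiset.nodup_add] at hn
  have := pairwise_disjoint_of_nodup hn.1
  rwa [List.pairwise_map] at this

theorem availDeg_eq : availDeg H c₀.last (available row c₀.b C 0) = dm + 1 := by
  classical
  rw [← h.deg, degIn_eq_countP, ← h.labels, Multiset.countP_add, Multiset.countP_add,
    countP_labelSum, List.map_map, Multiset.countP_eq_zero.2, Multiset.countP_eq_zero.2]
  · rfl
  · intro x hx
    rw [Multiset.mem_singleton.1 hx]
    exact H.loopless.irrefl _
  · intro x hx
    obtain ⟨c', hc', hx⟩ := mem_labelSum.1 hx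
    exact (h.unavail hc').2 x hx

theorem mask_testBit (x : ℕ) :
    (Nat.lor c₀.m (nbrMask H c₀.last (available row c₀.b C 0) 0)).testBit x = true ↔
      H.Adj c₀.last x := by
  rw [testBit_lor, Bool.or_eq_true, nbrMask_testBit fun e he => (h.avail he).1, Nat.zero_testBit,
    (((h.compat.valid c₀ h.mem).masks _ h.last_mem_labels).adj x)]
  constructor
  · rintro (hx | hx | ⟨e, -, -, hx⟩)
    · exact hx.2
    · exact absurd hx Bool.false_ne_true
    · exact hx
  · intro hx
    by_cases hxU : x ∈ U
    · right; right
      rw [← Finset.mem_val, ← h.labels, Multiset.mem_add, Multiset.mem_add, mem_labelSum,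
        mem_labelSum] at hxU
      rcases hxU with (⟨c, hc, hxc⟩ | ⟨c, hc, hxc⟩) | hxU
      · obtain ⟨e, he, rfl⟩ := List.mem_map.1 hc
        exact ⟨e, he, hxc, hx⟩
      · exact absurd hx ((h.unavail hc).2 x hxc)
      · exact absurd (Multiset.mem_singleton.1 hxU) hx.ne'
    · exact .inl ⟨hxU, hx⟩

/-- The state after the vertex has been processed. -/
theorem child {rv : ℕ} (hrv : rv = Nat.lor c₀.m (nbrMask H c₀.last (available row c₀.b C 0) 0)) :
    Compat n H (U.erase c₀.last) (unavailable row c₀.b (dm + 1) C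
      (refined H c₀.last (2 ^ c₀.last) dm rv (available row c₀.b C 0)) dm).toList
      (.cons (2 ^ c₀.last) rv P) (Nat.sub g (Nat.mul 2 (dm + 1))) := by
  have hm : ∀ y, rv.testBit y = true ↔ H.Adj c₀.last y := fun y => hrv ▸ h.mask_testBit y
  refine ⟨h.compat.lt, fun e he => ?_, fun a ha haU => ?_, fun a ha =>
    h.compat.unprocessed a (Finset.mem_of_mem_erase ha), ?_, fun c hc => ?_, ?_⟩
  · rcases List.mem_cons.1 he with rfl | he
    · exact ⟨c₀.last, by simp, rfl, hm⟩
    · exact (h.compat.rows e he).erase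
  · by_cases hav : a = c₀.last
    · exact ⟨_, List.mem_cons_self, by rw [hav]⟩
    · obtain ⟨e, he, h1⟩ := h.compat.processed a ha fun h' => haU (Finset.mem_erase.2 ⟨hav, h'⟩)
      exact ⟨e, List.mem_cons_of_mem _ he, h1⟩
  · rw [unavailable_toList, labelSum_append, labelSum_refined fun e he => (h.avail he).1,
      Finset.erase_val, ← h.labels, add_comm _ ({_} : Multiset ℕ), Multiset.singleton_add,
      Multiset.erase_cons_head, add_comm]
  · rw [unavailable_toList, List.mem_append] at hc
    rcases hc with hc | hc
    · exact (h.unavail hc).1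
    · exact refined_valid h.last_mem hm (fun e he => h.avail he) c hc
  · have h1 := h.compat.edges
    have h2 := sum_degIn_erase (H := H) h.last_mem
    have h3 := h.deg
    change g - 2 * (dm + 1) ≤ _
    omega

theorem choose_next {full : ℕ} (hfull : ∀ i ∈ U, full.testBit i = true) (hH : ¬ HasHexagon H)
    {next : Cls → Rows → ℕ → Bool}
    (hc : choose (2 ^ c₀.last) (Nat.xor full (2 ^ c₀.last)) dm c₀.m
        (fun rv R => next (unavailable row c₀.b (dm + 1) C R dm) (Rows.cons (2 ^ c₀.last) rv P)
          (Nat.sub g (Nat.mul 2 (dm + 1)))) (available row c₀.b C 0)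
        (fun _ r => r) Chosen.nil 0 (dm + 1) = true) :
    let rv := Nat.lor c₀.m (nbrMask H c₀.last (available row c₀.b C 0) 0)
    next (unavailable row c₀.b (dm + 1) C
      (refined H c₀.last (2 ^ c₀.last) dm rv (available row c₀.b C 0)) dm)
      (.cons (2 ^ c₀.last) rv P) (Nat.sub g (Nat.mul 2 (dm + 1))) = true := by
  rw [← h.availDeg_eq] at hc
  have := choose_spec h.last_mem hfull hH (fun e he => (h.avail he).1) h.pairwise
    (sized_available row c₀.b C 0) (fun q hq => by simp [Chosen.toList] at hq) hc
  rwa [h.availDeg_eq] at this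

end Ready

end

section

/-! ### Soundness of the search -/

variable {n : ℕ} {H : SimpleGraph ℕ} {U : Finset ℕ} {v : ℕ} {L : List Cell} {P : Rows} {g : ℕ}
variable {C C' : Cls} {c₀ : Cell} {dm : ℕ} {leaf : Rows → Bool} {good : SimpleGraph ℕ → Prop}

theorem degBound_eq (C : Cls) (d : ℕ) :
    degBound C d = (C.toList.map fun c => c.cnt * min c.lim d).sum := by
  induction C with
  | nil => rfl
  | cons b cnt lim m u1 u2 l t ih =>
    change cnt * Nat.sub lim (Nat.sub lim d) + degBound t d = _
    rw [ih, sub_sub_eq_min]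
    rfl

theorem limSum_eq (C : Cls) : limSum C = (C.toList.map fun c => c.cnt * c.lim).sum := by
  induction C with
  | nil => rfl
  | cons b cnt lim m u1 u2 l t ih =>
    change cnt * lim + limSum t = _
    rw [ih]
    rfl

theorem finish_eq (leaf : Rows → Bool) (P : Rows) (g : ℕ) :
    finish leaf P g = if g = 0 then leaf P else true := by
  unfold finish
  simp only [rec_eq_ite, Nat.beq_eq]

theorem degLoop_succ (leaf : Rows → Bool) (P : Rows) (C C' : Cls) (g : ℕ) (body : ℕ → ℕ → Bool)
    (k : ℕ) : degLoop leaf P C C' g body (k + 1) =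
      if g ≤ degBound C k - degBound C' k + degBound C' (k + 1) then
        if body k (k + 1) = true then degLoop leaf P C C' g body k else false
      else true := by
  change (IF Nat.ble g (degBound C k - degBound C' k + degBound C' (k + 1)) THEN
    (IF body k (k + 1) THEN degLoop leaf P C C' g body k ELSE false) ELSE true) = _
  simp only [rec_eq_ite, Nat.ble_eq]

theorem degLoop_body {pre : List Cell} (hC : C.toList = pre ++ C'.toList)
    (hg : g ≤ (pre.map fun c => c.cnt * min c.lim dm).sum + degBound C' (dm + 1))
    {body : ℕ → ℕ → Bool} {lim : ℕ} (hlim : dm < lim) (h : degLoop leaf P C C' g body lim = true) :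
    body dm (dm + 1) = true := by
  induction lim with
  | zero => omega
  | succ k ih =>
    have hk : g ≤ degBound C k - degBound C' k + degBound C' (k + 1) := by
      refine hg.trans (Nat.add_le_add ?_ ?_)
      · rw [degBound_eq C, degBound_eq C', hC, List.map_append, List.sum_append, Nat.add_sub_cancel]
        refine List.sum_le_sum fun c _ => Nat.mul_le_mul_left _ ?_
        omega
      · rw [degBound_eq, degBound_eq]
        refine List.sum_le_sum fun c _ => Nat.mul_le_mul_left _ ?_
        omega
    rw [degLoop_succ, if_pos hk] at h
    split_ifs at h with hb
    rcases Nat.lt_or_eq_of_le (Nat.le_of_lt_succ hlim) with hlt | rfl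
    · exact ih hlt h
    · exact hb

theorem degLoop_zero {body : ℕ → ℕ → Bool} {lim : ℕ}
    (h : degLoop leaf P C C' 0 body lim = true) : leaf P = true := by
  induction lim with
  | zero =>
    change finish leaf P 0 = true at h
    rwa [finish_eq, if_pos rfl] at h
  | succ k ih =>
    rw [degLoop_succ, if_pos (Nat.zero_le _)] at h
    split_ifs at h
    exact ih h

theorem expandAll_cons (leaf : Rows → Bool) (full M : ℕ) (P : Rows) (g : ℕ)
    (next : Cls → Rows → ℕ → Bool) (C : Cls) (b cnt lim m u1 u2 : ℕ) (l : Rows) (t : Cls) :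
    expandAll leaf full M P g next C (.cons b cnt lim m u1 u2 l t) =
      if expand leaf C (.cons b cnt lim m u1 u2 l t) P g (Nat.shiftLeft b (cnt - 1))
        (Nat.xor full (Nat.shiftLeft b (cnt - 1))) b m (Nat.div M (shiftUnit b)) lim next = true
      then expandAll leaf full M P g next C t else false := by
  change (IF expand leaf C (.cons b cnt lim m u1 u2 l t) P g (Nat.shiftLeft b (cnt - 1))
        (Nat.xor full (Nat.shiftLeft b (cnt - 1))) b m (Nat.div M (shiftUnit b)) lim next
      THEN expandAll leaf full M P g next C t ELSE false) = _
  simp only [rec_eq_ite]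

theorem of_expandAll {full M : ℕ} {pre suf : List Cell} (hC : C'.toList = pre ++ c₀ :: suf) :
    ∃ t : Cls, t.toList = suf ∧ ∀ next : Cls → Rows → ℕ → Bool,
      expandAll leaf full M P g next C C' = true →
      expand leaf C (.cons c₀.b c₀.cnt c₀.lim c₀.m c₀.u1 c₀.u2 c₀.l t) P g
        (Nat.shiftLeft c₀.b (c₀.cnt - 1)) (Nat.xor full (Nat.shiftLeft c₀.b (c₀.cnt - 1)))
        c₀.b c₀.m (Nat.div M (shiftUnit c₀.b)) c₀.lim next = true := by
  induction C' generalizing pre with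
  | nil => simp [Cls.toList] at hC
  | cons b cnt lim m u1 u2 l t ih =>
    cases pre with
    | nil =>
      rw [Cls.toList, List.nil_append, List.cons.injEq] at hC
      obtain ⟨rfl, hC⟩ := hC
      refine ⟨t, hC, fun next h => ?_⟩
      rw [expandAll_cons] at h
      split_ifs at h with h1
      exact h1
    | cons c pre =>
      rw [Cls.toList, List.cons_append, List.cons.injEq] at hC
      obtain ⟨t', ht', h'⟩ := ih hC.2
      refine ⟨t', ht', fun next h => h' next ?_⟩
      rw [expandAll_cons] at h
      split_ifs at h with h1
      exact h

theorem sum_degIn_eq (L : List Cell) (f : ℕ → ℕ) (h : labelSum L = U.val) :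
    ∑ z ∈ U, f z = (L.map fun c => ∑ z ∈ c.labels, f z).sum := by
  change (U.val.map f).sum = _
  rw [← h]
  clear h
  induction L with
  | nil => rfl
  | cons c L ih =>
    rw [labelSum_cons, Multiset.map_add, Multiset.sum_add, List.map_cons, List.sum_cons, ih]
    rfl

theorem degBounds_append {pre suf : List Cell} {bv f d : ℕ} (hpre : ∀ c ∈ pre, c.b ≠ bv)
    (h1 : ∀ c ∈ pre, ∀ x ∈ c.labels, degIn H U x ≤ f)
    (h2 : ∀ c ∈ suf, ∀ x ∈ c.labels, degIn H U x ≤ d) (hb : c₀.b = bv)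
    (h0 : ∀ x ∈ c₀.labels, degIn H U x ≤ d) : DegBounds H U bv d f (pre ++ c₀ :: suf) := by
  have key : ∀ L : List Cell, (∀ c ∈ L, ∀ x ∈ c.labels, degIn H U x ≤ d) → DegBounds H U bv d d L := by
    intro L hL
    induction L with
    | nil => trivial
    | cons c L ih =>
      have h1 := hL c List.mem_cons_self
      have h2 := ih fun c hc => hL c (List.mem_cons_of_mem _ hc)
      unfold DegBounds
      split_ifs
      · exact ⟨h1, h2⟩
      · exact ⟨h1, h2⟩
  induction pre with
  | nil =>
    rw [List.nil_append, DegBounds, if_pos hb]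
    exact ⟨h0, key suf h2⟩
  | cons c pre ih =>
    rw [List.cons_append, DegBounds, if_neg (hpre c List.mem_cons_self)]
    exact ⟨h1 c List.mem_cons_self, ih (fun c hc => hpre c (List.mem_cons_of_mem _ hc))
      fun c hc => h1 c (List.mem_cons_of_mem _ hc)⟩

theorem exists_first {α : Type*} {p : α → Prop} {L : List α} (h : ∃ c ∈ L, p c) :
    ∃ pre c suf, L = pre ++ c :: suf ∧ p c ∧ ∀ c' ∈ pre, ¬ p c' := by
  induction L with
  | nil => simp at h
  | cons c L ih =>
    by_cases hc : p c
    · exact ⟨[], c, L, rfl, hc, by simp⟩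
    · have : ∃ c ∈ L, p c := by
        obtain ⟨c', hc', h⟩ := h
        rcases List.mem_cons.1 hc' with rfl | hc'
        · exact absurd h hc
        · exact ⟨c', hc', h⟩
      obtain ⟨pre, c', suf, rfl, h1, h2⟩ := ih this
      refine ⟨c :: pre, c', suf, rfl, h1, fun c'' hc'' => ?_⟩
      rcases List.mem_cons.1 hc'' with rfl | hc''
      · exact hc
      · exact h2 _ hc''

theorem Compat.le_limSum (h : Compat n H U C.toList P g) : g ≤ limSum C := by
  refine h.edges.trans ?_
  rw [limSum_eq, sum_degIn_eq C.toList _ h.labels]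
  refine List.sum_le_sum fun c hc => (Finset.sum_le_card_nsmul _ _ _ (h.valid c hc).deg).trans ?_
  simp [Cell.labels]

theorem node_eq (leaf : Rows → Bool) (full M : ℕ) (P : Rows) (g : ℕ) (next : Cls → Rows → ℕ → Bool)
    (C : Cls) (hg : g ≤ limSum C) (hC : C.toList ≠ []) :
    node leaf full M P g next C = expandAll leaf full M P g next C C := by
  unfold node
  rw [rec_eq_ite, if_pos (Nat.ble_eq ▸ hg)]
  cases C with
  | nil => simp [Cls.toList] at hC
  | cons => rfl

/-- If no edges are left, then the leaf test has been passed. -/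
theorem Compat.leaf_of_node (h : Compat n H U C.toList P g) (h0 : ∀ x ∈ U, degIn H U x = 0)
    {full M : ℕ} {next : Cls → Rows → ℕ → Bool} (hn : node leaf full M P g next C = true) :
    leaf P = true := by
  have hg : g = 0 := by
    have := h.edges
    rw [Finset.sum_eq_zero h0] at this
    omega
  subst hg
  cases C with
  | nil =>
    change finish leaf P 0 = true at hn
    rwa [finish_eq, if_pos rfl] at hn
  | cons b cnt lim m u1 u2 l t =>
    rw [node_eq _ _ _ _ _ _ _ (Nat.zero_le _) (by simp [Cls.toList]), expandAll_cons] at hn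
    split_ifs at hn with h1
    exact degLoop_zero h1

theorem Compat.step_sound (hg : IsGood n good) {full : ℕ} (hfull : ∀ i < n, full.testBit i = true)
    (hn : n ≤ 16) {r : ℕ} (hr : U.card ≤ r) (h : Compat n H U C.toList P g) (hH : good H) :
    ((∀ x ∈ U, degIn H U x = 0) ∧ ∀ next, step leaf full r next C P g = true → leaf P = true) ∨
    ∃ (C' : Cls) (P' : Rows) (g' : ℕ) (H' : SimpleGraph ℕ), ∃ v ∈ U, Compat n H' (U.erase v) C'.toList P' g' ∧ good H' ∧ g' ≤ g ∧
      ∀ next, step leaf full r next C P g = true → next C' P' g' = true := by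
  set M := forbidden full P C with hM
  by_cases h0 : ∀ x ∈ U, degIn H U x = 0
  · exact .inl ⟨h0, fun next hs => (h.clip hg hH hfull hn hr).leaf_of_node h0 hs⟩
  right
  push Not at h0
  obtain ⟨x₀, hx₀, hpos⟩ := h0
  obtain ⟨x₁, hx₁, hmax⟩ := Finset.exists_max_image U (degIn H U) ⟨x₀, hx₀⟩
  obtain ⟨dm, hdm⟩ : ∃ dm, degIn H U x₁ = dm + 1 :=
    ⟨degIn H U x₁ - 1, by have := hmax x₀ hx₀; omega⟩
  rw [hdm] at hmax
  obtain ⟨c₁, hc₁, hxc₁⟩ := h.exists_cell hx₁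
  obtain ⟨pre, c₀, suf, hC, ⟨x, hxc, hxd⟩, hpre⟩ :=
    exists_first (p := fun c : Cell => ∃ x ∈ c.labels, degIn H U x = dm + 1) ⟨c₁, hc₁, x₁, hxc₁, hdm⟩
  have hc₀ : c₀ ∈ C.toList := by simp [hC]
  have hpreC : ∀ c ∈ pre, c ∈ C.toList := fun c hc => by simp [hC, hc]
  have hsufC : ∀ c ∈ suf, c ∈ C.toList := fun c hc => by simp [hC, hc]
  have hlast : c₀.last ∈ c₀.labels := Cell.last_mem (h.valid c₀ hc₀).pos
  let Q : SimpleGraph ℕ → Prop := fun H => good H ∧ (∀ c ∈ pre, ∀ x ∈ c.labels, degIn H U x ≤ dm) ∧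
    ∀ x ∈ U, degIn H U x ≤ dm + 1
  have hQswap : ∀ H, Compat n H U C.toList P g → Q H → ∀ c ∈ C.toList, ∀ x ∈ c.labels,
      ∀ y ∈ c.labels, Q (CycleSearch.swapped H x y) := by
    intro H h hQ c hc x hx y hy
    have hU : x ∈ U ↔ y ∈ U := iff_of_true (h.mem hc hx) (h.mem hc hy)
    refine ⟨hg.swapped H x y (h.unprocessed _ (h.mem hc hx)) (h.unprocessed _ (h.mem hc hy)) hQ.1,
      fun c' hc' z hz => ?_, fun z hz => ?_⟩
    · rw [degIn_swapped hU]
      refine hQ.2.1 c' hc' _ ?_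
      rwa [swap_mem (labels_iff_of_nodup h.nodup hc hx hy c' (hpreC c' hc'))]
    · rw [degIn_swapped hU]
      exact hQ.2.2 _ ((swap_mem hU).2 hz)
  have hQ : Q H := by
    refine ⟨hH, fun c hc x hx => ?_, hmax⟩
    have h1 := hmax x (h.mem (hpreC c hc) hx)
    have h2 : degIn H U x ≠ dm + 1 := fun e => hpre c hc ⟨x, hx, e⟩
    omega
  have hd₁ : degIn (CycleSearch.swapped H x c₀.last) U c₀.last = dm + 1 := by
    rw [degIn_swapped (iff_of_true (h.mem hc₀ hxc) (h.mem hc₀ hlast)), Equiv.swap_apply_right, hxd]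
  obtain ⟨H', h', ⟨hQ', hd'⟩, hfirst⟩ := Compat.exists_nbrsFirst
    (fun H' => Q H' ∧ degIn H' U c₀.last = dm + 1) (v := c₀.last) (fun H' h' hQ' c hc x hx y hy hxv hyv =>
      ⟨hQswap H' h' hQ'.1 c hc x hx y hy, by
        rw [degIn_swapped (iff_of_true (h'.mem hc hx) (h'.mem hc hy)),
          Equiv.swap_apply_of_ne_of_ne hxv.symm hyv.symm]
        exact hQ'.2⟩) (h.swapped hc₀ hxc hlast) ⟨hQswap H h hQ c₀ hc₀ x hxc _ hlast, hd₁⟩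
  obtain ⟨hgood, hpre', hmax'⟩ := hQ'
  have hclip := h'.clip hg hgood hfull hn hr
  have hlist : (CycleSearch.clip M (Nat.sub r 1) C).toList = pre.map (Cell.clip M (Nat.sub r 1)) ++
      c₀.clip M (Nat.sub r 1) :: suf.map (Cell.clip M (Nat.sub r 1)) := by
    rw [toList_clip, hC, List.map_append, List.map_cons]
  have hmem : c₀.clip M (Nat.sub r 1) ∈ (CycleSearch.clip M (Nat.sub r 1) C).toList := by
    rw [hlist]
    exact List.mem_append_right _ List.mem_cons_self
  have hmemC : ∀ c ∈ (CycleSearch.clip M (Nat.sub r 1) C).toList, ∃ c' ∈ C.toList, c'.clip M (Nat.sub r 1) = c := by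
    intro c hc
    rwa [toList_clip, List.mem_map] at hc
  have hready : Ready n H' U (CycleSearch.clip M (Nat.sub r 1) C) P g (c₀.clip M (Nat.sub r 1)) dm
      (Nat.div M (shiftUnit c₀.b)) := by
    refine ⟨hclip, hmem, hd', ?_, fun c hc hrow => ?_, fun c hc => ?_⟩
    · rw [hlist]
      refine degBounds_append ?_ ?_ ?_ rfl fun x hx => hmax' x (h'.mem hc₀ hx)
      · intro c hc e
        obtain ⟨c', hc', rfl⟩ := List.mem_map.1 hc
        have h1 := (h'.b_eq_iff (hpreC c' hc') hc₀).1 e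
        have h2 := h'.nodup_cells
        rw [hC, List.nodup_append] at h2
        exact h2.2.2 c' hc' c₀ List.mem_cons_self h1
      · intro c hc
        obtain ⟨c', hc', rfl⟩ := List.mem_map.1 hc
        exact hpre' c' hc'
      · intro c hc x hx
        obtain ⟨c', hc', rfl⟩ := List.mem_map.1 hc
        exact hmax' x (h'.mem (hsufC c' hc') hx)
    · obtain ⟨c', hc', rfl⟩ := hmemC c hc
      exact (h'.forbidden_spec hg hgood hfull hn hc₀).1 c' hc' hrow
    · obtain ⟨c', hc', rfl⟩ := hmemC c hc
      exact hfirst c' hc'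
  obtain ⟨t, ht, hexp⟩ := of_expandAll (leaf := leaf) (full := full) (M := M) (P := P) (g := g)
    (C := CycleSearch.clip M (Nat.sub r 1) C) hlist
  refine ⟨_, _, _, H', c₀.last, h.mem hc₀ hlast, hready.child rfl, hgood, Nat.sub_le _ _, fun next hs => ?_⟩
  change node leaf full M P g next (CycleSearch.clip M (Nat.sub r 1) C) = true at hs
  rw [node_eq _ _ _ _ _ _ _ hclip.le_limSum (List.ne_nil_of_mem hmem)] at hs
  have hb : (c₀.clip M (Nat.sub r 1)).b = 2 ^ c₀.first := (h.valid c₀ hc₀).bit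
  have hvb : Nat.shiftLeft (c₀.clip M (Nat.sub r 1)).b ((c₀.clip M (Nat.sub r 1)).cnt - 1) =
      2 ^ (c₀.clip M (Nat.sub r 1)).last := by
    rw [hb, shiftLeft_two_pow]
    rfl
  have he := hexp next hs
  rw [hvb] at he
  refine hready.choose_next (full := full) (fun i hi => hfull i (h.unprocessed i hi))
    (hg.not_hasHexagon _ hgood) (next := next) ?_
  refine degLoop_body (pre := pre.map (Cell.clip M (Nat.sub r 1))) ?_ ?_ ?_ he
  · rw [hlist, Cls.toList, ht]
  · refine hclip.edges.trans ?_
    rw [sum_degIn_eq _ _ hclip.labels, hlist, List.map_append, List.sum_append]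
    refine Nat.add_le_add (List.sum_le_sum fun c hc => ?_) ?_
    · have hcC : c ∈ (CycleSearch.clip M (Nat.sub r 1) C).toList := by rw [hlist]; exact List.mem_append_left _ hc
      refine (Finset.sum_le_card_nsmul _ _ (min c.lim dm) fun x hx => ?_).trans (by simp [Cell.labels])
      refine le_min ((hclip.valid c hcC).deg x hx) ?_
      obtain ⟨c', hc', rfl⟩ := List.mem_map.1 hc
      exact hpre' c' hc' x hx
    · rw [degBound_eq, Cls.toList, ht]
      refine List.sum_le_sum fun c hc => ?_
      have hcC : c ∈ (CycleSearch.clip M (Nat.sub r 1) C).toList := by rw [hlist]; exact List.mem_append_right _ hc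
      refine (Finset.sum_le_card_nsmul _ _ (min c.lim (dm + 1)) fun x hx => ?_).trans
        (by simp [Cell.labels])
      exact le_min ((hclip.valid c hcC).deg x hx) (hmax' x (hclip.mem hcC hx))
  · have := (hclip.valid _ hmem).deg c₀.last hlast
    rw [hd'] at this
    exact this

theorem Compat.search_sound (hg : IsGood n good) {full : ℕ} (hfull : ∀ i < n, full.testBit i = true)
    (hn : n ≤ 16) {fuel : ℕ} (hr : U.card < fuel) (h : Compat n H U C.toList P g) (hH : good H)
    (hs : search leaf full fuel C P g = true) :
    ∃ (C' : Cls) (P' : Rows) (g' : ℕ) (H' : SimpleGraph ℕ) (U' : Finset ℕ), Compat n H' U' C'.toList P' g' ∧ good H' ∧ (∀ x ∈ U', degIn H' U' x = 0) ∧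
      leaf P' = true := by
  induction fuel generalizing C P g H U with
  | zero => omega
  | succ r ih =>
    rcases h.step_sound (leaf := leaf) hg hfull hn (r := r) (by omega) hH with
      ⟨h0, h1⟩ | ⟨C', P', g', H', v, hv, h', hH', -, hnext⟩
    · exact ⟨C, P, g, H, U, h, hH, h0, h1 _ hs⟩
    · have := Finset.card_erase_lt_of_mem hv
      exact ih (by omega) h' hH' (hnext _ hs)

theorem degIn_le_card (z : ℕ) : degIn H U z ≤ U.card := by
  classical
  exact Finset.card_filter_le _ _

theorem compat_start (hn : 0 < n) (hlt : ∀ a b, H.Adj a b → a < n)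
    (hg : g ≤ ∑ z ∈ Finset.range n, degIn H (Finset.range n) z) :
    Compat n H (Finset.range n) (start n).toList .nil g := by
  have hlog : Nat.log 2 1 = 0 := rfl
  have hl : Cell.labels ⟨1, n, n - 1, 0, 0, 0, .nil⟩ = Finset.range n := by
    unfold Cell.labels Cell.first
    rw [hlog, zero_add, Nat.Ico_zero_eq_range]
  refine ⟨hlt, by simp [Rows.toList], fun a ha h => absurd (Finset.mem_range.2 ha) h,
    fun a ha => Finset.mem_range.1 ha, ?_, fun c hc => ?_, hg⟩
  · simp [start, Cls.toList, hl]
  · obtain rfl : c = ⟨1, n, n - 1, 0, 0, 0, .nil⟩ := by simpa [start, Cls.toList] using hc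
    refine ⟨hn, rfl, fun x hx => ⟨fun p => ?_, by simp, by simp⟩, by simp [Rows.toList],
      by simp [Rows.toList], fun x hx => ?_⟩
    · rw [hl] at hx
      simp only [Nat.zero_testBit, Bool.false_eq_true, false_iff, not_and, Finset.mem_range]
      exact fun hp hxp => hp (hlt p x hxp.symm)
    · rw [hl] at hx
      have h1 := degIn_erase_of_not_adj (U := Finset.range n) (H.loopless.irrefl x)
      have h2 := degIn_le_card (H := H) (U := (Finset.range n).erase x) x
      rw [Finset.card_erase_of_mem hx, Finset.card_range] at h2
      exact h1 ▸ h2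

end

section

/-! ### Hexagon-free graphs on fifteen vertices -/

theorem searchPart_57_100 : searchPart 57 100 0 100 = true := by decide +kernel

theorem searchPart_55_56 : searchPart 55 56 46 100 = true := by decide +kernel

theorem searchPart_55_56' : searchPart 55 56 0 45 = true := by decide +kernel

theorem searchPart_53_54 : searchPart 53 54 44 100 = true := by decide +kernel

theorem searchPart_53_54' : searchPart 53 54 0 43 = true := by decide +kernel

theorem searchPart_51_52 : searchPart 51 52 42 100 = true := by decide +kernel

theorem searchPart_51_52' : searchPart 51 52 0 41 = true := by decide +kernel

theorem searchPart_49_50 : searchPart 49 50 0 100 = true := by decide +kernel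

theorem searchPart_0_48 : searchPart 0 48 0 100 = true := by decide +kernel

theorem exists_searchPart {g₁ g₂ : ℕ} (h₁ : g₁ ≤ 68) (h₂ : g₂ ≤ 68) :
    ∃ lo hi lo' hi', searchPart lo hi lo' hi' = true ∧ lo ≤ g₁ ∧ g₁ ≤ hi ∧ lo' ≤ g₂ ∧ g₂ ≤ hi' := by
  rcases le_or_gt g₁ 48 with h | h
  · exact ⟨_, _, _, _, searchPart_0_48, by omega⟩
  rcases le_or_gt g₁ 50 with h | h
  · exact ⟨_, _, _, _, searchPart_49_50, by omega⟩
  rcases le_or_gt g₁ 52 with h | h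
  · rcases le_or_gt g₂ 41 with h' | h'
    · exact ⟨_, _, _, _, searchPart_51_52', by omega⟩
    · exact ⟨_, _, _, _, searchPart_51_52, by omega⟩
  rcases le_or_gt g₁ 54 with h | h
  · rcases le_or_gt g₂ 43 with h' | h'
    · exact ⟨_, _, _, _, searchPart_53_54', by omega⟩
    · exact ⟨_, _, _, _, searchPart_53_54, by omega⟩
  rcases le_or_gt g₁ 56 with h | h
  · rcases le_or_gt g₂ 45 with h' | h'
    · exact ⟨_, _, _, _, searchPart_55_56', by omega⟩
    · exact ⟨_, _, _, _, searchPart_55_56, by omega⟩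
  · exact ⟨_, _, _, _, searchPart_57_100, by omega⟩

theorem within_eq {lo hi g : ℕ} {next : Cls → Rows → ℕ → Bool} {C : Cls} {P : Rows} (h : lo ≤ g)
    (h' : g ≤ hi) : within lo hi next C P g = next C P g := by
  unfold within
  rw [Nat.ble_eq_true_of_le h, Nat.ble_eq_true_of_le h']

theorem isGood_not_hasHexagon (n : ℕ) : IsGood n fun H => ¬ HasHexagon H :=
  ⟨fun _ => id, fun _ _ _ _ _ h h' => h h'.of_swapped⟩

/-- A graph on `15` vertices without hexagon has at most `33` edges. -/
theorem sum_degIn_lt_of_not_hasHexagon {H : SimpleGraph ℕ} (hlt : ∀ a b, H.Adj a b → a < 15)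
    (hH : ¬ HasHexagon H) : ∑ z ∈ Finset.range 15, degIn H (Finset.range 15) z < 68 := by
  by_contra! hg
  have hgood := isGood_not_hasHexagon 15
  have hfull : ∀ i < 15, (2 ^ 15 - 1 : ℕ).testBit i = true := by decide
  rcases (compat_start (by norm_num) hlt hg).step_sound (leaf := fun _ => false) hgood hfull
    (by norm_num) (r := 15) (by simp) hH with ⟨-, h⟩ | ⟨C₁, P₁, g₁, H₁, v, hv, h₁, hH₁, hg₁, hnext⟩
  · exact absurd (h _ searchPart_57_100) (by simp)
  have hc₁ : ((Finset.range 15).erase v).card = 14 := by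
    rw [Finset.card_erase_of_mem hv, Finset.card_range]
  rcases h₁.step_sound (leaf := fun _ => false) hgood hfull (by norm_num) (r := 14) hc₁.le hH₁ with
    ⟨-, h⟩ | ⟨C₂, P₂, g₂, H₂, w, hw, h₂, hH₂, hg₂, hnext₂⟩
  · obtain ⟨lo, hi, lo', hi', hs, h1, h2, -, -⟩ := exists_searchPart hg₁ (Nat.zero_le 68)
    have := hnext _ hs
    rw [within_eq h1 h2] at this
    exact absurd (h _ this) (by simp)
  · obtain ⟨lo, hi, lo', hi', hs, h1, h2, h3, h4⟩ := exists_searchPart hg₁ (hg₂.trans hg₁)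
    have := hnext _ hs
    rw [within_eq h1 h2] at this
    have := hnext₂ _ this
    rw [within_eq h3 h4] at this
    obtain ⟨-, -, -, -, -, -, -, -, h⟩ := h₂.search_sound hgood hfull (by norm_num)
      (by rw [Finset.card_erase_of_mem hw, hc₁]; norm_num) hH₂ this
    exact absurd h (by simp)

end

section

/-! ### Two-colourings of the complete graph on eight vertices without one edge -/

noncomputable section

/-- The neighbourhood of the vertex with bit `b`, when every edge has a processed end. -/
def rowOf (P : Rows) (b : Nat) : Nat :=
  @Rows.rec (fun _ => Nat) 0 (fun ba ra _ ih =>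
    IFN Nat.beq ba b THEN Nat.lor ra ih ELSE
    IFN Nat.beq (Nat.land ra b) 0 THEN ih ELSE Nat.lor ba ih) P

def pairBit (x y i : Nat) : Nat :=
  IFN Nat.beq i x THEN Nat.pow 2 y ELSE (IFN Nat.beq i y THEN Nat.pow 2 x ELSE 0)

/-- The rows of the complement of the graph described by `P`, without the edge between `x` and `y`. -/
def coTable (P : Rows) (x y : Nat) (k : Nat) : Rows :=
  @Nat.rec (fun _ => Rows) Rows.nil (fun i T => Rows.cons (Nat.pow 2 i)
    (remove 255 (Nat.lor (Nat.lor (Nat.pow 2 i) (rowOf P (Nat.pow 2 i))) (pairBit x y i))) T) k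

def anyRow (T : Rows) (m : Nat) (f : Nat → Nat → Bool) : Bool :=
  @Rows.rec (fun _ => Bool) false (fun b r _ ih =>
    IF Nat.beq (Nat.land m b) 0 THEN ih ELSE (IF f b r THEN true ELSE ih)) T

def hexagonIn (T : Rows) : Bool :=
  anyRow T 255 fun a ra => anyRow T ra fun b rb => anyRow T (remove rb a) fun c rc =>
    anyRow T (remove rc (Nat.lor a b)) fun d rd =>
    anyRow T (remove rd (Nat.lor a (Nat.lor b c))) fun _ re =>
      IF Nat.beq (remove (Nat.land re ra) (Nat.lor b (Nat.lor c d))) 0 THEN false ELSE true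

def allBelow (f : Nat → Bool) (k : Nat) : Bool :=
  @Nat.rec (fun _ => Bool) true (fun i ih => IF f i THEN ih ELSE false) k

def coHexagons (P : Rows) : Bool :=
  allBelow (fun y => allBelow (fun x => hexagonIn (coTable P x y 8)) y) 8

end

theorem search_coHexagons : search coHexagons 255 9 (start 8) Rows.nil 28 = true := by
  decide +kernel

variable {H B : SimpleGraph ℕ} {U : Finset ℕ} {L : List Cell} {P T : Rows} {g : ℕ}

theorem rowOf_cons (ba ra : ℕ) (t : Rows) (b : ℕ) : rowOf (.cons ba ra t) b =
    if ba = b then Nat.lor ra (rowOf t b) else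
    if Nat.land ra b = 0 then rowOf t b else Nat.lor ba (rowOf t b) := by
  trans if Nat.beq ba b = true then Nat.lor ra (rowOf t b) else
    if Nat.beq (Nat.land ra b) 0 = true then rowOf t b else Nat.lor ba (rowOf t b)
  · rw [← rec_eq_ite, ← rec_eq_ite]
    rfl
  · simp only [Nat.beq_eq]

theorem testBit_rowOf_self {a r j : ℕ} (h : (2 ^ a, r) ∈ P.toList) (hj : r.testBit j = true) :
    (rowOf P (2 ^ a)).testBit j = true := by
  induction P with
  | nil => simp [Rows.toList] at h
  | cons b s t ih =>
    rw [rowOf_cons]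
    rcases List.mem_cons.1 h with h | h
    · obtain ⟨rfl, rfl⟩ := Prod.mk.inj h
      rw [if_pos rfl, testBit_lor, hj, Bool.true_or]
    · split_ifs <;> simp [ih h]

theorem testBit_rowOf_other {a r i : ℕ} (h : (2 ^ a, r) ∈ P.toList) (hi : r.testBit i = true)
    (hai : a ≠ i) : (rowOf P (2 ^ i)).testBit a = true := by
  induction P with
  | nil => simp [Rows.toList] at h
  | cons b s t ih =>
    rw [rowOf_cons]
    rcases List.mem_cons.1 h with h | h
    · obtain ⟨rfl, rfl⟩ := Prod.mk.inj h
      rw [if_neg (fun h => hai (Nat.pow_right_injective le_rfl h)), if_neg, testBit_lor,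
        Nat.testBit_two_pow_self, Bool.true_or]
      rw [land_two_pow_eq_zero, hi]
      simp
    · split_ifs <;> simp [ih h]

theorem Compat.testBit_rowOf {n : ℕ} (h : Compat n H U L P g) (h0 : ∀ x ∈ U, degIn H U x = 0) {i j : ℕ}
    (hij : H.Adj i j) : (rowOf P (2 ^ i)).testBit j = true := by
  classical
  by_cases hi : i ∈ U
  · have hj : j ∉ U := fun hj => by
      have := h0 i hi
      rw [degIn, Finset.card_eq_zero, Finset.filter_eq_empty_iff] at this
      exact this hj hij
    obtain ⟨⟨b, r⟩, he, hb⟩ := h.processed j (h.lt j i hij.symm) hj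
    obtain rfl : b = 2 ^ j := hb
    obtain ⟨a, -, ha, hr⟩ := h.rows _ he
    obtain rfl : j = a := Nat.pow_right_injective le_rfl ha
    exact testBit_rowOf_other he ((hr i).2 hij.symm) hij.ne'
  · obtain ⟨⟨b, r⟩, he, hb⟩ := h.processed i (h.lt i j hij) hi
    obtain rfl : b = 2 ^ i := hb
    obtain ⟨a, -, ha, hr⟩ := h.rows _ he
    obtain rfl : i = a := Nat.pow_right_injective le_rfl ha
    exact testBit_rowOf_self he ((hr j).2 hij)

theorem of_anyRow {m : ℕ} {f : ℕ → ℕ → Bool} (h : anyRow T m f = true) :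
    ∃ e ∈ T.toList, Nat.land m e.1 ≠ 0 ∧ f e.1 e.2 = true := by
  induction T with
  | nil => simp [anyRow] at h
  | cons b r t ih =>
    have h' : (if Nat.land m b = 0 then anyRow t m f else if f b r = true then true else
        anyRow t m f) = true := by
      trans if Nat.beq (Nat.land m b) 0 = true then anyRow t m f else
        if f b r = true then true else anyRow t m f
      · simp only [Nat.beq_eq]
      · rw [← rec_eq_ite, ← rec_eq_ite]
        exact h
    split_ifs at h' with h1 h2
    · obtain ⟨e, he, h⟩ := ih h'
      exact ⟨e, List.mem_cons_of_mem _ he, h⟩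
    · exact ⟨(b, r), List.mem_cons_self .., h1, h2⟩
    · obtain ⟨e, he, h⟩ := ih h'
      exact ⟨e, List.mem_cons_of_mem _ he, h⟩

theorem hasHexagon_of_hexagonIn
    (hT : ∀ e ∈ T.toList, ∃ i, e.1 = 2 ^ i ∧ ∀ j, e.2.testBit j = true → B.Adj i j)
    (h : hexagonIn T = true) : HasHexagon B := by
  obtain ⟨⟨_, ra⟩, ha, -, h⟩ := of_anyRow h
  obtain ⟨a, rfl, hra⟩ := hT _ ha
  obtain ⟨⟨_, rb⟩, hb, hab, h⟩ := of_anyRow h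
  obtain ⟨b, rfl, hrb⟩ := hT _ hb
  obtain ⟨⟨_, rc⟩, hc, hbc, h⟩ := of_anyRow h
  obtain ⟨c, rfl, hrc⟩ := hT _ hc
  obtain ⟨⟨_, rd⟩, hd, hcd, h⟩ := of_anyRow h
  obtain ⟨d, rfl, hrd⟩ := hT _ hd
  obtain ⟨⟨_, re⟩, he, hde, h⟩ := of_anyRow h
  obtain ⟨e, rfl, hre⟩ := hT _ he
  rw [rec_eq_ite] at h
  split_ifs at h with h0
  rw [Nat.beq_eq] at h0
  obtain ⟨f, hf⟩ := exists_testBit_of_ne_zero h0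
  simp only [ne_eq, land_two_pow_eq_zero, Bool.not_eq_false, testBit_remove, testBit_lor, testBit_land,
    Nat.testBit_two_pow, Bool.and_eq_true, Bool.not_eq_true', Bool.or_eq_false_iff,
    decide_eq_false_iff_not] at hab hbc hcd hde hf
  have h1 := hra _ hab
  have h2 := hrb _ hbc.1
  have h3 := hrc _ hcd.1
  have h4 := hrd _ hde.1
  have h5 := hre _ hf.1.1
  have h6 := hra _ hf.1.2
  refine ⟨a, b, c, d, e, f, ?_, h1, h2, h3, h4, h5, h6.symm⟩
  have := h1.ne; have := h2.ne; have := h3.ne; have := h4.ne; have := h5.ne; have := h6.ne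
  simp only [List.nodup_cons, List.mem_cons, List.not_mem_nil, or_false, not_or, not_false_eq_true,
    List.nodup_nil, and_true]
  tauto

theorem mem_coTable {x y k : ℕ} {e : ℕ × ℕ} (h : e ∈ (coTable P x y k).toList) :
    ∃ i < k, e.1 = 2 ^ i ∧
      e.2 = remove 255 (Nat.lor (Nat.lor (2 ^ i) (rowOf P (2 ^ i))) (pairBit x y i)) := by
  induction k with
  | zero => simp [coTable, Rows.toList] at h
  | succ k ih =>
    rcases List.mem_cons.1 h with h | h
    · exact ⟨k, k.lt_succ_self, by rw [h]; exact ⟨rfl, rfl⟩⟩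
    · obtain ⟨i, hi, h⟩ := ih h
      exact ⟨i, hi.trans k.lt_succ_self, h⟩

theorem of_allBelow {f : ℕ → Bool} {k : ℕ} (h : allBelow f k = true) {i : ℕ} (hi : i < k) : f i = true := by
  induction k with
  | zero => omega
  | succ k ih =>
    have h' : (if f k = true then allBelow f k else false) = true := by
      rw [← rec_eq_ite]
      exact h
    split_ifs at h' with hk
    rcases Nat.lt_succ_iff_lt_or_eq.1 hi with hi | rfl
    · exact ih h' hi
    · exact hk

theorem pairBit_left (x y : ℕ) : pairBit x y x = 2 ^ y := by
  rw [pairBit, rec_eq_ite, if_pos (Nat.beq_refl x)]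
  rfl

theorem pairBit_right {x y : ℕ} (h : x ≠ y) : pairBit x y y = 2 ^ x := by
  rw [pairBit, rec_eq_ite, rec_eq_ite, if_neg, if_pos (Nat.beq_refl y)]
  · rfl
  · rw [Nat.beq_eq]
    exact h.symm

/-- `H` and `B` cover the complete graph on eight vertices except for one edge. -/
def AlmostCovers (H B : SimpleGraph ℕ) : Prop :=
  ∃ x y, x < y ∧ y < 8 ∧ ∀ a b, a < 8 → b < 8 → a ≠ b → ¬ (a = x ∧ b = y) → ¬ (a = y ∧ b = x) →
    H.Adj a b ∨ B.Adj a b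

theorem AlmostCovers.symm (h : AlmostCovers H B) : AlmostCovers B H := by
  obtain ⟨x, y, hxy, hy, h⟩ := h
  exact ⟨x, y, hxy, hy, fun a b ha hb hab h1 h2 => (h a b ha hb hab h1 h2).symm⟩

theorem AlmostCovers.swapped (h : AlmostCovers H B) {p q : ℕ} (hp : p < 8) (hq : q < 8) :
    AlmostCovers (swapped H p q) (swapped B p q) := by
  obtain ⟨x, y, hxy, hy, h⟩ := h
  have hlt : ∀ {a}, a < 8 → Equiv.swap p q a < 8 := by
    intro a ha
    rw [Equiv.swap_apply_def]
    split_ifs <;> assumption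
  have hinj := (Equiv.swap p q).injective
  have hs := Equiv.swap_swap p q
  have main : ∀ a b, a < 8 → b < 8 → a ≠ b → ¬ (a = Equiv.swap p q x ∧ b = Equiv.swap p q y) →
      ¬ (a = Equiv.swap p q y ∧ b = Equiv.swap p q x) →
      (CycleSearch.swapped H p q).Adj a b ∨ (CycleSearch.swapped B p q).Adj a b := by
    intro a b ha hb hab h1 h2
    refine h _ _ (hlt ha) (hlt hb) (hinj.ne hab) (fun h => h1 ?_) (fun h => h2 ?_)
    · rw [← h.1, ← h.2, Equiv.swap_apply_self, Equiv.swap_apply_self]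
      exact ⟨rfl, rfl⟩
    · rw [← h.1, ← h.2, Equiv.swap_apply_self, Equiv.swap_apply_self]
      exact ⟨rfl, rfl⟩
  rcases lt_or_gt_of_ne (hinj.ne hxy.ne) with hlt' | hlt'
  · exact ⟨_, _, hlt', hlt hy, main⟩
  · exact ⟨_, _, hlt', hlt (hxy.trans hy), fun a b ha hb hab h1 h2 => main a b ha hb hab h2 h1⟩

theorem Compat.hasHexagon_of_coHexagons (h : Compat 8 H U L P g) (h0 : ∀ x ∈ U, degIn H U x = 0)
    (hB : AlmostCovers H B) (hP : coHexagons P = true) : HasHexagon B := by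
  obtain ⟨x, y, hxy, hy, hB⟩ := hB
  refine hasHexagon_of_hexagonIn (fun e he => ?_) (of_allBelow (of_allBelow hP hy) hxy)
  obtain ⟨i, hi, h1, h2⟩ := mem_coTable he
  refine ⟨i, h1, fun j hj => ?_⟩
  rw [h2, testBit_remove, testBit_lor, testBit_lor, Bool.and_eq_true, Bool.not_eq_true',
    Bool.or_eq_false_iff, Bool.or_eq_false_iff] at hj
  obtain ⟨h255, ⟨hij, hrow⟩, hpair⟩ := hj
  have hj : j < 8 := by
    by_contra! hj
    rw [Nat.testBit_lt_two_pow (lt_of_lt_of_le (by norm_num : 255 < 2 ^ 8) (Nat.pow_le_pow_right two_pos hj))]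
      at h255
    exact absurd h255 (by simp)
  refine (hB i j hi hj ?_ ?_ ?_).resolve_left fun hadj => ?_
  · rintro rfl
    simp at hij
  · rintro ⟨rfl, rfl⟩
    simp [pairBit_left] at hpair
  · rintro ⟨rfl, rfl⟩
    simp [pairBit_right hxy.ne] at hpair
  · rw [h.testBit_rowOf h0 hadj] at hrow
    exact absurd hrow (by simp)

theorem hasHexagon_of_sum_degIn {H B : SimpleGraph ℕ} (hlt : ∀ a b, H.Adj a b → a < 8)
    (hB : AlmostCovers H B) (hg : 28 ≤ ∑ z ∈ Finset.range 8, degIn H (Finset.range 8) z) :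
    HasHexagon H ∨ HasHexagon B := by
  by_contra! hH
  have hgood : IsGood 8 fun H => ¬ HasHexagon H ∧ ∃ B, ¬ HasHexagon B ∧ AlmostCovers H B :=
    ⟨fun _ => And.left, fun H x y hx hy ⟨h, B, hB, hc⟩ =>
      ⟨fun h' => h h'.of_swapped, swapped B x y, fun h' => hB h'.of_swapped, hc.swapped hx hy⟩⟩
  obtain ⟨C', P', g', H', U', hC, ⟨-, B', hB', hc⟩, h0, hleaf⟩ :=
    (compat_start (by norm_num) hlt hg).search_sound hgood (full := 255) (by decide) (by norm_num)
      (fuel := 9) (by simp) ⟨hH.1, B, hH.2, hB⟩ search_coHexagons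
  exact hB' (hC.hasHexagon_of_coHexagons h0 hc hleaf)

end

end CycleSearch

end

namespace PentagonFree

open Finset

set_option linter.unusedSectionVars false

section

/-! ### Counting edges in graphs without pentagon -/

variable {V : Type*} [DecidableEq V] {G : SimpleGraph V} [DecidableRel G.Adj]

/-- `G` does not contain a cycle of length five. -/
def Holds (G : SimpleGraph V) : Prop :=
  ∀ a b c d e, G.Adj a b → G.Adj b c → G.Adj c d → G.Adj d e → G.Adj e a →
    a ≠ c → b ≠ d → c ≠ e → d ≠ a → e ≠ b → False

variable (G) in
/-- The number of neighbours of `x` in `S`. -/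
def degOn (S : Finset V) (x : V) : ℕ := #{y ∈ S | G.Adj x y}

variable (G) in
/-- The number of ordered pairs of adjacent vertices in `S × T`. -/
def darts (S T : Finset V) : ℕ := ∑ x ∈ S, degOn G T x

variable {S T : Finset V}

theorem degOn_eq_sum (S : Finset V) (x : V) : degOn G S x = ∑ y ∈ S, if G.Adj x y then 1 else 0 :=
  card_filter _ _

theorem darts_comm (S T : Finset V) : darts G S T = darts G T S := by
  simp only [darts, degOn_eq_sum]
  rw [sum_comm]
  simp only [G.adj_comm]

theorem darts_union_left {S S' : Finset V} (h : Disjoint S S') (T : Finset V) :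
    darts G (S ∪ S') T = darts G S T + darts G S' T :=
  sum_union h

theorem darts_union_right {S S' : Finset V} (h : Disjoint S S') (T : Finset V) :
    darts G T (S ∪ S') = darts G T S + darts G T S' := by
  rw [darts_comm, darts_union_left h, darts_comm, darts_comm S']

theorem darts_union_self {S S' : Finset V} (h : Disjoint S S') :
    darts G (S ∪ S') (S ∪ S') = darts G S S + 2 * darts G S' S + darts G S' S' := by
  rw [darts_union_left h, darts_union_right h, darts_union_right h, darts_comm S S']
  ring

theorem degOn_le_card (S : Finset V) (x : V) : degOn G S x ≤ #S := card_filter_le _ _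

theorem degOn_mono (h : S ⊆ T) (x : V) : degOn G S x ≤ degOn G T x :=
  card_le_card (filter_subset_filter _ h)

theorem degOn_eq_zero {x : V} : degOn G S x = 0 ↔ ∀ y ∈ S, ¬ G.Adj x y := by
  rw [degOn, card_eq_zero, filter_eq_empty_iff]

theorem degOn_self_le {x : V} (hx : x ∈ S) : degOn G S x ≤ #S - 1 := by
  rw [← card_erase_of_mem hx]
  refine card_le_card fun y hy => ?_
  rw [mem_filter] at hy
  exact mem_erase.2 ⟨hy.2.ne', hy.1⟩

theorem darts_le (S T : Finset V) : darts G S T ≤ #S * #T :=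
  sum_le_card_nsmul S _ _ fun x _ => degOn_le_card (G := G) T x

theorem darts_self_le (S : Finset V) : darts G S S ≤ #S * (#S - 1) :=
  sum_le_card_nsmul S _ _ fun _ hx => degOn_self_le (G := G) hx

theorem darts_erase {x : V} (hx : x ∈ S) : darts G S S = darts G (S.erase x) (S.erase x) + 2 * degOn G S x := by
  have hd : Disjoint (S.erase x) {x} := by simp
  have h := darts_union_self (G := G) hd
  have hu : S.erase x ∪ {x} = S := by
    rw [union_comm, ← insert_eq, insert_erase hx]
  have h1 : degOn G S x = degOn G (S.erase x) x := by
    unfold degOn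
    congr 1
    ext y
    simp only [mem_filter, mem_erase]
    exact ⟨fun h => ⟨⟨h.2.ne', h.1⟩, h.2⟩, fun h => ⟨h.1.2, h.2⟩⟩
  have h2 : darts G {x} {x} = 0 := by simp [darts, degOn, filter_singleton]
  have h3 : darts G {x} (S.erase x) = degOn G (S.erase x) x := by simp [darts]
  rw [hu, h2, h3] at h
  rw [h1, h]
  rfl

/-- The edges of a graph whose components are triangles and stars. -/
theorem darts_self_le_of_pathFree (S : Finset V) (h : ∀ a ∈ S, ∀ b ∈ S, ∀ c ∈ S, ∀ d ∈ S,
    G.Adj a b → G.Adj b c → G.Adj c d → a ≠ c → b ≠ d → a ≠ d → False) :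
    darts G S S ≤ 2 * #{x ∈ S | degOn G S x ≠ 0} := by
  have hle : ∀ x ∈ S, ∀ y ∈ S, G.Adj x y → 2 ≤ degOn G S y → degOn G S x ≤ 2 := by
    intro x hx y hy hxy hdy
    by_contra! hdx
    obtain ⟨u, hu, hux⟩ := exists_mem_ne hdy x
    rw [mem_filter] at hu
    obtain ⟨z, hz, hzy⟩ : ∃ z ∈ ({z ∈ S | G.Adj x z} : Finset V), z ∉ ({y, u} : Finset V) :=
      exists_mem_notMem_of_card_lt_card (lt_of_le_of_lt card_le_two hdx)
    simp only [mem_insert, mem_singleton, not_or] at hzy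
    rw [mem_filter] at hz
    exact h z hz.1 x hx y hy u hu.1 hz.2.symm hxy hu.2 hzy.1 hux.symm hzy.2
  have hpos : ∀ x, ∀ y ∈ S, G.Adj x y → 0 < degOn G S x := fun x y hy hxy =>
    card_pos.2 ⟨y, mem_filter.2 ⟨hy, hxy⟩⟩
  have key : ∀ x ∈ S, ∀ y ∈ S, G.Adj x y →
      (1 : ℚ) ≤ 1 / degOn G S x + 1 / degOn G S y := by
    intro x hx y hy hxy
    have h1 := hpos x y hy hxy
    have h2 := hpos y x hx hxy.symm
    have h3 := hle x hx y hy hxy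
    have h4 := hle y hy x hx hxy.symm
    generalize degOn G S x = p at *
    generalize degOn G S y = q at *
    have : p = 1 ∨ q = 1 ∨ (p = 2 ∧ q = 2) := by omega
    rcases this with rfl | rfl | ⟨rfl, rfl⟩
    · have : (0 : ℚ) ≤ 1 / q := by positivity
      simp
    · have : (0 : ℚ) ≤ 1 / p := by positivity
      simp
    · norm_num
  have h1 : ∑ x ∈ S, ∑ y ∈ S, (if G.Adj x y then (1 : ℚ) / degOn G S x else 0) =
      #{x ∈ S | degOn G S x ≠ 0} := by
    rw [card_filter, Nat.cast_sum]
    refine sum_congr rfl fun x _ => ?_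
    rw [← sum_filter, sum_const, nsmul_eq_mul]
    change (degOn G S x : ℚ) * _ = _
    split_ifs with h0
    · have : (degOn G S x : ℚ) ≠ 0 := by exact_mod_cast h0
      field_simp
      simp
    · rw [not_not] at h0
      simp [h0]
  have h2 : ∑ x ∈ S, ∑ y ∈ S, (if G.Adj x y then (1 : ℚ) / degOn G S y else 0) =
      #{x ∈ S | degOn G S x ≠ 0} := by
    rw [sum_comm, ← h1]
    simp only [G.adj_comm]
  have h3 : (darts G S S : ℚ) ≤ 2 * #{x ∈ S | degOn G S x ≠ 0} := by
    rw [two_mul]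
    nth_rw 1 [← h1]
    rw [← h2, ← sum_add_distrib]
    simp only [darts, degOn_eq_sum, Nat.cast_sum]
    refine sum_le_sum fun x hx => ?_
    rw [← sum_add_distrib]
    refine sum_le_sum fun y hy => ?_
    have := key x hx y hy
    simp only [degOn_eq_sum, Nat.cast_sum] at this
    split_ifs with hxy
    · simpa using this hxy
    · simp
  exact_mod_cast h3

theorem exists_degOn_mul_le (hS : S.Nonempty) : ∃ x ∈ S, degOn G S x * #S ≤ darts G S S := by
  obtain ⟨x, hx, h⟩ := exists_min_image S (degOn G S) hS
  refine ⟨x, hx, ?_⟩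
  rw [mul_comm, ← smul_eq_mul]
  exact card_nsmul_le_sum S _ _ h

theorem darts_even (S : Finset V) : Even (darts G S S) := by
  induction S using Finset.induction_on with
  | empty => simp [darts]
  | insert x S hx ih =>
    rw [darts_erase (mem_insert_self x S), erase_insert hx]
    exact ih.add (even_two_mul _)

end

section

/-! ### Pentagon-free graphs on at most eight vertices -/

/-- Given the adjacencies between `u`, `w` and the vertices `x`, `y`, `u`, `w` of the complete graph on five
vertices, is there a pentagon in which the fifth vertex is next to `x` and `y`? -/
def pathAround (ax ay xu xw yu yw uw : Bool) : Bool :=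
  ax && (ay && (uw && (xu && yw || xw && yu)))

def pentagonOn (ab ac ad ae bc bd be cd ce de : Bool) : Bool :=
  pathAround ab ac bd be cd ce de || (pathAround ab ad bc be cd de ce ||
  (pathAround ab ae bc bd ce de cd || (pathAround ac ad bc ce bd de be ||
  (pathAround ac ae bc cd be de bd || pathAround ad ae bd cd be ce bc))))

def pentagonIn (ab ac ad ae af bc bd be bf cd ce cf de df ef : Bool) : Bool :=
  pentagonOn ab ac ad ae bc bd be cd ce de || (pentagonOn ab ac ad af bc bd bf cd cf df ||
  (pentagonOn ab ac ae af bc be bf ce cf ef || (pentagonOn ab ad ae af bd be bf de df ef ||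
  (pentagonOn ac ad ae af cd ce cf de df ef || pentagonOn bc bd be bf cd ce cf de df ef))))

/-- Checks `f` for both values of the next adjacency, as long as at most `k` pairs are not adjacent. -/
def forEdge (k : ℕ) (f : ℕ → Bool → Bool) : Bool :=
  f k true && Nat.rec true (fun m _ => f m false) k

theorem pentagonIn_of_nine_lt :
    forEdge 5 (fun k ab => forEdge k fun k ac => forEdge k fun k ad => forEdge k fun k ae =>
      forEdge k fun k af => forEdge k fun k bc => forEdge k fun k bd => forEdge k fun k be =>
      forEdge k fun k bf => forEdge k fun k cd => forEdge k fun k ce => forEdge k fun k cf =>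
      forEdge k fun k de => forEdge k fun k df => forEdge k fun _ ef =>
        pentagonIn ab ac ad ae af bc bd be bf cd ce cf de df ef) = true := by
  decide +kernel

theorem of_forEdge {k : ℕ} {f : ℕ → Bool → Bool} (h : forEdge k f = true) {b : Bool}
    (hb : (!b).toNat ≤ k) : f (k - (!b).toNat) b = true := by
  rw [forEdge, Bool.and_eq_true] at h
  cases b with
  | true => exact h.1
  | false =>
    obtain ⟨m, rfl⟩ : ∃ m, k = m + 1 := ⟨k - 1, by simp at hb; omega⟩
    exact h.2

variable {V : Type*} [DecidableEq V] {G : SimpleGraph V} [DecidableRel G.Adj] {S : Finset V}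

theorem Holds.pathAround_eq (hG : Holds G) {a x y u w : V} (h : [a, x, y, u, w].Nodup) :
    pathAround (G.Adj a x) (G.Adj a y) (G.Adj x u) (G.Adj x w) (G.Adj y u) (G.Adj y w) (G.Adj u w) =
      false := by
  rw [← Bool.not_eq_true]
  intro h'
  simp only [pathAround, Bool.and_eq_true, Bool.or_eq_true, decide_eq_true_eq] at h'
  simp only [List.nodup_cons, List.mem_cons, List.not_mem_nil, not_or, or_false] at h
  obtain ⟨h1, h2, h3, ⟨h4, h5⟩ | ⟨h4, h5⟩⟩ := h'
  · exact hG a x u w y h1 h4 h3 h5.symm h2.symm (by tauto) (by tauto) (by tauto) (by tauto) (by tauto)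
  · exact hG a x w u y h1 h4 h3.symm h5.symm h2.symm (by tauto) (by tauto) (by tauto) (by tauto) (by tauto)

theorem Holds.pentagonOn_eq (hG : Holds G) {a b c d e : V} (h : [a, b, c, d, e].Nodup) :
    pentagonOn (G.Adj a b) (G.Adj a c) (G.Adj a d) (G.Adj a e) (G.Adj b c) (G.Adj b d) (G.Adj b e)
      (G.Adj c d) (G.Adj c e) (G.Adj d e) = false := by
  have hs : ∀ x y, decide (G.Adj x y) = decide (G.Adj y x) := fun x y => by simp only [G.adj_comm]
  simp only [List.nodup_cons, List.mem_cons, List.not_mem_nil, not_or, or_false] at h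
  have hp : ∀ {x y u w}, [a, x, y, u, w].Nodup → _ := fun hn => hG.pathAround_eq hn
  have h1 := hp (x := b) (y := c) (u := d) (w := e) (by simp; tauto)
  have h2 := hp (x := b) (y := d) (u := c) (w := e) (by simp; tauto)
  have h3 := hp (x := b) (y := e) (u := c) (w := d) (by simp; tauto)
  have h4 := hp (x := c) (y := d) (u := b) (w := e) (by simp; tauto)
  have h5 := hp (x := c) (y := e) (u := b) (w := d) (by simp; tauto)
  have h6 := hp (x := d) (y := e) (u := b) (w := c) (by simp; tauto)
  rw [hs d c] at h2
  rw [hs e c, hs e d] at h3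
  rw [hs c b, hs d b] at h4
  rw [hs c b, hs e b, hs e d] at h5
  rw [hs d b, hs d c, hs e b, hs e c] at h6
  rw [pentagonOn, h1, h2, h3, h4, h5, h6]
  rfl

theorem pentagonIn_eq_true {ab ac ad ae af bc bd be bf cd ce cf de df ef : Bool}
    (h : (!ab).toNat + (!ac).toNat + (!ad).toNat + (!ae).toNat + (!af).toNat + (!bc).toNat + (!bd).toNat +
      (!be).toNat + (!bf).toNat + (!cd).toNat + (!ce).toNat + (!cf).toNat + (!de).toNat + (!df).toNat +
      (!ef).toNat ≤ 5) : pentagonIn ab ac ad ae af bc bd be bf cd ce cf de df ef = true := by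
  have h1 := of_forEdge (of_forEdge (of_forEdge (of_forEdge (of_forEdge pentagonIn_of_nine_lt
    (b := ab) (by omega)) (b := ac) (by omega)) (b := ad) (by omega)) (b := ae) (by omega))
    (b := af) (by omega)
  have h2 := of_forEdge (of_forEdge (of_forEdge (of_forEdge (of_forEdge h1
    (b := bc) (by omega)) (b := bd) (by omega)) (b := be) (by omega)) (b := bf) (by omega))
    (b := cd) (by omega)
  exact of_forEdge (of_forEdge (of_forEdge (of_forEdge (of_forEdge h2
    (b := ce) (by omega)) (b := cf) (by omega)) (b := de) (by omega)) (b := df) (by omega))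
    (b := ef) (by omega)

theorem Holds.darts_of_card_eq_six (hG : Holds G) (hS : #S = 6) : darts G S S ≤ 18 := by
  obtain ⟨a, b, c, d, e, f, hl⟩ : ∃ a b c d e f, S.toList = [a, b, c, d, e, f] := by
    rw [← length_toList] at hS
    match S.toList, hS with
    | [a, b, c, d, e, f], _ => exact ⟨a, b, c, d, e, f, rfl⟩
  have hn := S.nodup_toList
  rw [hl] at hn
  have hs : ∀ g : V → ℕ, ∑ x ∈ S, g x = g a + (g b + (g c + (g d + (g e + g f)))) := fun g => by
    rw [← sum_map_toList, hl]
    simp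
  by_contra! hlt
  have hpent : pentagonIn (G.Adj a b) (G.Adj a c) (G.Adj a d) (G.Adj a e) (G.Adj a f) (G.Adj b c)
      (G.Adj b d) (G.Adj b e) (G.Adj b f) (G.Adj c d) (G.Adj c e) (G.Adj c f) (G.Adj d e) (G.Adj d f)
      (G.Adj e f) = true := by
    apply pentagonIn_eq_true
    have hb : ∀ x y, (if G.Adj x y then 1 else 0) + (!decide (G.Adj x y)).toNat = 1 := fun x y => by
      split_ifs with h <;> simp [h]
    have hab := hb a b; have hac := hb a c; have had := hb a d; have hae := hb a e; have haf := hb a f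
    have hbc := hb b c; have hbd := hb b d; have hbe := hb b e; have hbf := hb b f; have hcd := hb c d
    have hce := hb c e; have hcf := hb c f; have hde := hb d e; have hdf := hb d f; have hef := hb e f
    simp only [darts, degOn_eq_sum, hs, SimpleGraph.irrefl, if_false, G.adj_comm b a, G.adj_comm c a,
      G.adj_comm d a, G.adj_comm e a, G.adj_comm f a, G.adj_comm c b, G.adj_comm d b, G.adj_comm e b,
      G.adj_comm f b, G.adj_comm d c, G.adj_comm e c, G.adj_comm f c, G.adj_comm e d, G.adj_comm f d,
      G.adj_comm f e] at hlt
    omega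
  have hp : ∀ {p q r s t}, [p, q, r, s, t].Sublist [a, b, c, d, e, f] →
    pentagonOn (G.Adj p q) (G.Adj p r) (G.Adj p s) (G.Adj p t) (G.Adj q r) (G.Adj q s) (G.Adj q t)
      (G.Adj r s) (G.Adj r t) (G.Adj s t) = false := fun hsub => hG.pentagonOn_eq (hsub.nodup hn)
  simp only [pentagonIn] at hpent
  rw [hp, hp, hp, hp, hp, hp] at hpent
  · simp at hpent
  all_goals simp

theorem Holds.darts_of_card_eq_seven (hG : Holds G) (hS : #S = 7) : darts G S S ≤ 24 := by
  obtain ⟨k, hk⟩ := darts_even (G := G) S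
  obtain ⟨x, hx, hd⟩ := exists_degOn_mul_le (G := G) (card_pos.1 (by omega : 0 < #S))
  have h := darts_erase (G := G) hx
  have := hG.darts_of_card_eq_six (by rw [card_erase_of_mem hx, hS] : #(S.erase x) = 6)
  rw [hS] at hd
  omega

/-- A pentagon-free graph on eight vertices has at most `16` edges. -/
theorem Holds.darts_of_card_eq_eight (hG : Holds G) (hS : #S = 8) : darts G S S ≤ 32 := by
  obtain ⟨x, hx, hd⟩ := exists_degOn_mul_le (G := G) (card_pos.1 (by omega : 0 < #S))
  have h := darts_erase (G := G) hx
  have := hG.darts_of_card_eq_seven (by rw [card_erase_of_mem hx, hS] : #(S.erase x) = 7)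
  rw [hS] at hd
  omega

end

section

variable {V : Type*} [Fintype V] [DecidableEq V] {G : SimpleGraph V} [DecidableRel G.Adj]
variable {S W : Finset V} {v x y z : V}

/-! ### Sets spanning at most one edge -/

variable (G) in
/-- There is no edge inside `S`, except possibly between `x` and `y`. -/
def OnlyEdge (S : Finset V) (x y : V) : Prop :=
  ∀ a ∈ S, ∀ b ∈ S, G.Adj a b → (a = x ∧ b = y) ∨ (a = y ∧ b = x)

variable (G) in
def Indep (S : Finset V) : Prop := ∀ a ∈ S, ∀ b ∈ S, ¬ G.Adj a b

theorem Indep.onlyEdge (h : Indep G S) (x y : V) : OnlyEdge G S x y :=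
  fun a ha b hb hab => absurd hab (h a ha b hb)

theorem Indep.mono (h : Indep G S) (hW : W ⊆ S) : Indep G W :=
  fun a ha b hb => h a (hW ha) b (hW hb)

theorem OnlyEdge.insert (h : OnlyEdge G S x y) (hz : ∀ a ∈ S, ¬ G.Adj z a) :
    OnlyEdge G (insert z S) x y := by
  intro a ha b hb hab
  rcases mem_insert.1 ha with rfl | ha'
  · rcases mem_insert.1 hb with rfl | hb'
    · exact absurd hab (G.irrefl)
    · exact absurd hab (hz b hb')
  · rcases mem_insert.1 hb with rfl | hb'
    · exact absurd hab.symm (hz a ha')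
    · exact h a ha' b hb' hab

theorem Indep.insert (h : Indep G S) (hz : ∀ a ∈ S, ¬ G.Adj z a) : Indep G (insert z S) := by
  intro a ha b hb hab
  rcases mem_insert.1 ha with rfl | ha'
  · rcases mem_insert.1 hb with rfl | hb'
    · exact G.irrefl hab
    · exact hz b hb' hab
  · rcases mem_insert.1 hb with rfl | hb'
    · exact hz a ha' hab.symm
    · exact h a ha' b hb' hab

theorem Indep.union (h : Indep G S) (h' : Indep G W) (hSW : ∀ a ∈ S, ∀ b ∈ W, ¬ G.Adj a b) :
    Indep G (S ∪ W) := by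
  intro a ha b hb hab
  rcases mem_union.1 ha with ha | ha <;> rcases mem_union.1 hb with hb | hb
  · exact h a ha b hb hab
  · exact hSW a ha b hb hab
  · exact hSW b hb a ha hab.symm
  · exact h' a ha b hb hab

theorem Indep.onlyEdge_insert (h : Indep G S) (hx : ∀ a ∈ S, G.Adj x a → a = y) :
    OnlyEdge G (Insert.insert x S) x y := by
  intro a ha b hb hab
  rcases mem_insert.1 ha with rfl | ha'
  · rcases mem_insert.1 hb with rfl | hb'
    · exact absurd hab (G.irrefl)
    · exact Or.inl ⟨rfl, hx b hb' hab⟩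
  · rcases mem_insert.1 hb with rfl | hb'
    · exact Or.inr ⟨hx a ha' hab.symm, rfl⟩
    · exact absurd hab (h a ha' b hb')

theorem Indep.onlyEdge_insert_insert (h : Indep G S) (hx : ∀ a ∈ S, ¬ G.Adj x a)
    (hy : ∀ a ∈ S, ¬ G.Adj y a) : OnlyEdge G (Insert.insert x (Insert.insert y S)) x y := by
  refine (h.insert hy).onlyEdge_insert fun a ha hxa => ?_
  rcases mem_insert.1 ha with rfl | ha
  · rfl
  · exact absurd hxa (hx a ha)

theorem not_indep_iff : ¬ Indep G S ↔ ∃ a ∈ S, ∃ b ∈ S, G.Adj a b := by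
  simp only [Indep]
  push Not
  rfl

theorem Indep.darts_eq (h : Indep G S) : darts G S S = 0 :=
  sum_eq_zero fun x hx => degOn_eq_zero.2 (h x hx)

/-- Sets spanning at most one edge have at most seven elements. -/
def NoSparse (G : SimpleGraph V) : Prop := ∀ S x y, OnlyEdge G S x y → #S ≤ 7

theorem NoSparse.indep (hP : NoSparse G) (h : Indep G S) : #S ≤ 7 := by
  rcases S.eq_empty_or_nonempty with rfl | ⟨x, -⟩
  · simp
  · exact hP S x x (h.onlyEdge x x)

/-! ### The vertices around a vertex -/

variable (G v)

def nbr : Finset V := {y | G.Adj v y}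

def free : Finset V := {y ∈ nbr G v | degOn G (nbr G v) y = 0}

def bound : Finset V := {y ∈ nbr G v | ¬ degOn G (nbr G v) y = 0}

def far : Finset V := {y | y ≠ v ∧ ¬ G.Adj v y}

def rest₀ : Finset V := {y ∈ far G v | degOn G (nbr G v) y = 0}

def rest : Finset V := {y ∈ far G v | ¬ degOn G (nbr G v) y = 0}

def rest₁ : Finset V := {y ∈ rest G v | degOn G (nbr G v) y = 1}

def rest₂ : Finset V := {y ∈ rest G v | ¬ degOn G (nbr G v) y = 1}

variable {G v}

theorem mem_nbr : x ∈ nbr G v ↔ G.Adj v x := by simp [nbr]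

theorem mem_far : x ∈ far G v ↔ x ≠ v ∧ ¬ G.Adj v x := by simp [far]

theorem mem_free : x ∈ free G v ↔ G.Adj v x ∧ ∀ y, G.Adj v y → ¬ G.Adj x y := by
  simp [free, mem_nbr, degOn_eq_zero]

theorem mem_bound : x ∈ bound G v ↔ G.Adj v x ∧ ∃ y, G.Adj v y ∧ G.Adj x y := by
  simp [bound, mem_nbr, degOn_eq_zero]

theorem mem_rest₀ : x ∈ rest₀ G v ↔ x ∈ far G v ∧ ∀ y, G.Adj v y → ¬ G.Adj x y := by
  simp [rest₀, mem_nbr, degOn_eq_zero]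

theorem mem_rest : x ∈ rest G v ↔ x ∈ far G v ∧ ∃ y, G.Adj v y ∧ G.Adj x y := by
  simp [rest, mem_nbr, degOn_eq_zero]

theorem free_union_bound : free G v ∪ bound G v = nbr G v := filter_union_filter_not_eq _ _

theorem rest₀_union_rest : rest₀ G v ∪ rest G v = far G v := filter_union_filter_not_eq _ _

theorem rest₁_union_rest₂ : rest₁ G v ∪ rest₂ G v = rest G v := filter_union_filter_not_eq _ _

theorem disjoint_free_bound : Disjoint (free G v) (bound G v) := disjoint_filter_filter_not _ _ _

theorem disjoint_rest₀_rest : Disjoint (rest₀ G v) (rest G v) := disjoint_filter_filter_not _ _ _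

theorem disjoint_rest₁_rest₂ : Disjoint (rest₁ G v) (rest₂ G v) := disjoint_filter_filter_not _ _ _

theorem card_free_add_card_bound : #(free G v) + #(bound G v) = #(nbr G v) := by
  rw [← card_union_of_disjoint disjoint_free_bound, free_union_bound]

theorem card_rest₀_add_card_rest : #(rest₀ G v) + #(rest G v) = #(far G v) := by
  rw [← card_union_of_disjoint disjoint_rest₀_rest, rest₀_union_rest]

theorem card_rest₁_add_card_rest₂ : #(rest₁ G v) + #(rest₂ G v) = #(rest G v) := by
  rw [← card_union_of_disjoint disjoint_rest₁_rest₂, rest₁_union_rest₂]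

theorem disjoint_nbr_far : Disjoint (nbr G v) (far G v) :=
  disjoint_left.2 fun _ h h' => (mem_far.1 h').2 (mem_nbr.1 h)

theorem notMem_nbr_union_far : v ∉ nbr G v ∪ far G v := by
  simp [mem_nbr, mem_far]

theorem insert_nbr_union_far : insert v (nbr G v ∪ far G v) = univ := by
  ext x
  simp only [mem_insert, mem_union, mem_nbr, mem_far, mem_univ, iff_true]
  tauto

theorem card_nbr_add_card_far : #(nbr G v) + #(far G v) + 1 = Fintype.card V := by
  rw [← card_union_of_disjoint disjoint_nbr_far, ← card_insert_of_notMem notMem_nbr_union_far,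
    insert_nbr_union_far, card_univ]

theorem darts_univ : darts G univ univ = 2 * #(nbr G v) + darts G (nbr G v) (nbr G v) +
    2 * darts G (rest G v) (nbr G v) + darts G (far G v) (far G v) := by
  have h1 := darts_erase (G := G) (mem_univ v)
  have h2 : (univ : Finset V).erase v = nbr G v ∪ far G v := by
    rw [← insert_nbr_union_far (G := G) (v := v), erase_insert notMem_nbr_union_far]
  have h3 := darts_union_self (G := G) (disjoint_nbr_far (G := G) (v := v))
  have h4 := darts_union_left (G := G) (disjoint_rest₀_rest (G := G) (v := v)) (nbr G v)
  have h5 : darts G (rest₀ G v) (nbr G v) = 0 := sum_eq_zero fun x hx => (mem_filter.1 hx).2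
  have h6 : degOn G univ v = #(nbr G v) := rfl
  rw [rest₀_union_rest] at h4
  rw [h2] at h1
  omega

theorem darts_far : darts G (far G v) (far G v) = darts G (rest₀ G v) (rest₀ G v) +
    2 * darts G (rest G v) (rest₀ G v) + darts G (rest G v) (rest G v) := by
  rw [← rest₀_union_rest, darts_union_self disjoint_rest₀_rest]

/-! ### Consequences of pentagon-freeness -/

theorem Holds.eq_of_far (hG : Holds G) (hx : x ∈ far G v) (hy : y ∈ far G v) (hxy : G.Adj x y) {a b : V}
    (ha : G.Adj v a) (hb : G.Adj v b) (hxa : G.Adj x a) (hyb : G.Adj y b) : a = b := by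
  by_contra hab
  rw [mem_far] at hx hy
  refine hG v a x y b ha hxa.symm hxy hyb hb.symm hx.1.symm ?_ ?_ hy.1 (Ne.symm hab)
  · rintro rfl
    exact hy.2 ha
  · rintro rfl
    exact hx.2 hb

theorem far_of_mem_rest (hx : x ∈ rest G v) : x ∈ far G v := (mem_rest.1 hx).1

theorem Holds.degOn_of_adj (hG : Holds G) (hx : x ∈ rest G v) (hy : y ∈ rest G v) (hxy : G.Adj x y) :
    degOn G (nbr G v) x = 1 := by
  obtain ⟨hx, a, ha, hxa⟩ := mem_rest.1 hx
  obtain ⟨hy, b, hb, hyb⟩ := mem_rest.1 hy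
  rw [degOn, card_eq_one]
  refine ⟨b, ?_⟩
  ext c
  rw [mem_filter, mem_nbr, mem_singleton]
  refine ⟨fun hc => hG.eq_of_far hx hy hxy hc.1 hb hc.2 hyb, ?_⟩
  rintro rfl
  rw [← hG.eq_of_far hx hy hxy ha hb hxa hyb]
  exact ⟨ha, hxa⟩

theorem Holds.mem_rest₁_of_adj (hG : Holds G) (hx : x ∈ rest G v) (hy : y ∈ rest G v) (hxy : G.Adj x y) :
    x ∈ rest₁ G v := mem_filter.2 ⟨hx, hG.degOn_of_adj hx hy hxy⟩

theorem rest₁_subset : rest₁ G v ⊆ rest G v := filter_subset _ _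

theorem rest₂_subset : rest₂ G v ⊆ rest G v := filter_subset _ _

theorem Holds.indep_rest₂ (hG : Holds G) : Indep G (rest₂ G v) := fun _ hx _ hy hxy =>
  (mem_filter.1 hx).2 (hG.degOn_of_adj (rest₂_subset hx) (rest₂_subset hy) hxy)

theorem Holds.not_adj_of_mem_rest₂ (hG : Holds G) (hx : x ∈ rest G v) : ∀ y ∈ rest₂ G v, ¬ G.Adj x y :=
  fun _ hy hxy => (mem_filter.1 hy).2 (hG.degOn_of_adj (rest₂_subset hy) hx hxy.symm)

theorem Holds.darts_rest (hG : Holds G) : darts G (rest G v) (rest G v) ≤ 2 * #(rest₁ G v) := by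
  refine (darts_self_le_of_pathFree _ ?_).trans (Nat.mul_le_mul_left 2 (card_le_card fun x hx => ?_))
  · intro p hp q hq r hr s hs hpq hqr hrs hpr hqs hps
    obtain ⟨hp, a, ha, hpa⟩ := mem_rest.1 hp
    obtain ⟨hq, b, hb, hqb⟩ := mem_rest.1 hq
    obtain ⟨hr, c, hc, hrc⟩ := mem_rest.1 hr
    obtain ⟨hs, d, hd, hsd⟩ := mem_rest.1 hs
    obtain rfl := hG.eq_of_far hp hq hpq ha hb hpa hqb
    obtain rfl := hG.eq_of_far hq hr hqr ha hc hqb hrc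
    obtain rfl := hG.eq_of_far hr hs hrs ha hd hrc hsd
    have hne : ∀ {z}, z ∈ far G v → a ≠ z := by
      rintro z hz rfl
      exact (mem_far.1 hz).2 ha
    exact hG a p q r s hpa.symm hpq hqr hrs hsd (hne hq) hpr hqs (hne hr).symm hps.symm
  · rw [mem_filter, Ne, degOn_eq_zero] at hx
    obtain ⟨hx, h⟩ := hx
    push Not at h
    obtain ⟨y, hy, hxy⟩ := h
    exact hG.mem_rest₁_of_adj hx hy hxy

theorem Holds.darts_nbr (hG : Holds G) : darts G (nbr G v) (nbr G v) ≤ 2 * #(bound G v) := by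
  refine darts_self_le_of_pathFree _ fun p hp q hq r hr s hs hpq hqr hrs hpr hqs hps => ?_
  rw [mem_nbr] at hp hq hr hs
  exact hG v p q r s hp hpq hqr hrs hs.symm hq.ne hpr hqs hr.ne' hps.symm

theorem darts_nbr_le : darts G (nbr G v) (nbr G v) ≤ #(bound G v) * (#(bound G v) - 1) := by
  have h0 : ∀ y ∈ nbr G v, ∀ x ∈ free G v, ¬ G.Adj y x := fun y hy x hx h =>
    (mem_free.1 hx).2 y (mem_nbr.1 hy) h.symm
  have hsub : bound G v ⊆ nbr G v := filter_subset _ _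
  have h1 := darts_union_self (G := G) (disjoint_free_bound (G := G) (v := v))
  have h2 : darts G (bound G v) (free G v) = 0 :=
    sum_eq_zero fun y hy => degOn_eq_zero.2 (h0 y (hsub hy))
  have h3 : darts G (free G v) (free G v) = 0 :=
    sum_eq_zero fun y hy => degOn_eq_zero.2 (h0 y (filter_subset _ _ hy))
  rw [free_union_bound, h2, h3] at h1
  have := darts_self_le (G := G) (bound G v)
  omega

/-- A vertex at distance two from `v` with a neighbour in `bound G v` has at most two neighbours in
common with `v`. -/
theorem Holds.degOn_le_two (hG : Holds G) (hx : x ∈ far G v) {a : V} (ha : a ∈ bound G v)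
    (hxa : G.Adj x a) : degOn G (nbr G v) x ≤ 2 := by
  by_contra! h
  obtain ⟨ha, c, hc, hac⟩ := mem_bound.1 ha
  obtain ⟨b, hb, hbac⟩ : ∃ b ∈ ({b ∈ nbr G v | G.Adj x b} : Finset V), b ∉ ({a, c} : Finset V) :=
    exists_mem_notMem_of_card_lt_card (lt_of_le_of_lt card_le_two h)
  rw [mem_filter, mem_nbr] at hb
  simp only [mem_insert, mem_singleton, not_or] at hbac
  rw [mem_far] at hx
  refine hG x a c v b hxa hac hc.symm hb.1 hb.2.symm ?_ ha.ne' (Ne.symm hbac.2) hx.1.symm hbac.1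
  rintro rfl
  exact hx.2 hc

theorem Holds.subset_free_or (hG : Holds G) (hx : x ∈ far G v) :
    {b ∈ nbr G v | G.Adj x b} ⊆ free G v ∨ degOn G (nbr G v) x ≤ 2 := by
  by_contra! h
  obtain ⟨a, ha, ha'⟩ := not_subset.1 h.1
  rw [mem_filter] at ha
  refine absurd (hG.degOn_le_two hx (a := a) ?_ ha.2) (by omega)
  rw [← free_union_bound, mem_union] at ha
  exact ha.1.resolve_left ha'

theorem Holds.degOn_le_max (hG : Holds G) (hx : x ∈ far G v) :
    degOn G (nbr G v) x ≤ max #(free G v) 2 :=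
  (hG.subset_free_or hx).elim (fun h => le_max_of_le_left (card_le_card h)) le_max_of_le_right

theorem Holds.darts_rest_nbr (hG : Holds G) :
    darts G (rest G v) (nbr G v) ≤ #(rest₁ G v) + max #(free G v) 2 * #(rest₂ G v) := by
  rw [← rest₁_union_rest₂, darts_union_left disjoint_rest₁_rest₂]
  refine Nat.add_le_add ?_ ?_
  · simpa [darts] using sum_le_card_nsmul (rest₁ G v) (degOn G (nbr G v)) 1 fun x hx => (mem_filter.1 hx).2.le
  · rw [mul_comm]
    exact sum_le_card_nsmul (rest₂ G v) _ _ fun x hx => hG.degOn_le_max (far_of_mem_rest (rest₂_subset hx))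

/-- Adjacent vertices at distance three from `v` have no neighbours in `rest G v` which share neighbours
with `v`. -/
theorem Holds.degOn_add_degOn_le (hG : Holds G) (hi : 2 ≤ #(free G v)) (hx : x ∈ rest G v)
    (hy : y ∈ rest G v) (hxy : x ≠ y) {w w' : V} (hw : w ∈ rest₀ G v) (hw' : w' ∈ rest₀ G v)
    (hww' : G.Adj w w') (hxw : G.Adj x w) (hyw' : G.Adj y w') :
    degOn G (nbr G v) x + degOn G (nbr G v) y ≤ #(free G v) + 2 := by
  have hdis : Disjoint {b ∈ nbr G v | G.Adj x b} {b ∈ nbr G v | G.Adj y b} := by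
    refine disjoint_left.2 fun a ha ha' => ?_
    rw [mem_filter, mem_nbr] at ha ha'
    have hne : ∀ {z}, z ∈ far G v → a ≠ z := by
      rintro z hz rfl
      exact (mem_far.1 hz).2 ha.1
    refine hG a x w w' y ha.2.symm hxw hww' hyw'.symm ha'.2 (hne (mem_rest₀.1 hw).1) ?_ ?_
      (hne (mem_rest₀.1 hw').1).symm hxy.symm
    · rintro rfl
      exact (mem_rest₀.1 hw').2 a ha.1 ha.2
    · rintro rfl
      exact (mem_rest₀.1 hw).2 a ha.1 ha'.2
  have h1 := hG.degOn_le_max (far_of_mem_rest hx)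
  have h2 := hG.degOn_le_max (far_of_mem_rest hy)
  rcases hG.subset_free_or (far_of_mem_rest hx) with hx' | hx'
  · rcases hG.subset_free_or (far_of_mem_rest hy) with hy' | hy'
    · have := card_le_card (union_subset hx' hy')
      rw [card_union_of_disjoint hdis] at this
      exact this.trans (by omega)
    · omega
  · omega

end

section

variable {V : Type*} [Fintype V] [DecidableEq V] {G : SimpleGraph V} [DecidableRel G.Adj]
variable {S W : Finset V} {v x y z : V}

theorem two_mul_sum_le_of_pairs (f : V → ℕ) {s : ℕ} (hS : 2 ≤ #S)
    (h : ∀ x ∈ S, ∀ y ∈ S, x ≠ y → f x + f y ≤ s) : 2 * ∑ x ∈ S, f x ≤ #S * s := by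
  have h1 : ∀ x ∈ S, (#S - 1) * f x + ∑ y ∈ S.erase x, f y ≤ (#S - 1) * s := by
    intro x hx
    have : ∑ y ∈ S.erase x, (f x + f y) ≤ #(S.erase x) • s :=
      sum_le_card_nsmul _ _ _ fun y hy => h x hx y (mem_of_mem_erase hy) (ne_of_mem_erase hy).symm
    rwa [sum_add_distrib, sum_const, card_erase_of_mem hx, smul_eq_mul, smul_eq_mul] at this
  obtain ⟨k, hk⟩ : ∃ k, #S = k + 2 := ⟨#S - 2, by omega⟩
  have h2 : ∀ x ∈ S, k * f x + ∑ y ∈ S, f y ≤ (k + 1) * s := by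
    intro x hx
    have h3 := h1 x hx
    have h4 := add_sum_erase S f hx
    rw [hk, show k + 2 - 1 = k + 1 from rfl, add_one_mul] at h3
    omega
  have h3 := sum_le_card_nsmul S _ _ h2
  rw [sum_add_distrib, ← mul_sum, sum_const, hk, smul_eq_mul, smul_eq_mul] at h3
  rw [hk]
  nlinarith

theorem sum_le_of_exists (f : V → ℕ) {m k : ℕ} (hx : x ∈ S) (hm : f x ≤ m) (h : ∀ y ∈ S, f y ≤ k) :
    ∑ y ∈ S, f y ≤ m + (#S - 1) * k := by
  rw [← add_sum_erase S f hx, ← card_erase_of_mem hx]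
  exact Nat.add_le_add hm (sum_le_card_nsmul _ _ _ fun y hy => h y (mem_of_mem_erase hy))

/-! ### Sparse sets around a vertex -/

theorem ne_of_mem_far (hx : x ∈ far G v) : v ≠ x := (mem_far.1 hx).1.symm

theorem not_adj_of_mem_far (hx : x ∈ far G v) : ¬ G.Adj v x := (mem_far.1 hx).2

theorem rest_subset : rest G v ⊆ far G v := filter_subset _ _

theorem rest₀_subset : rest₀ G v ⊆ far G v := filter_subset _ _

theorem indep_insert_of_subset_far (h : Indep G S) (hS : S ⊆ far G v) : Indep G (insert v S) :=
  h.insert fun _ ha => not_adj_of_mem_far (hS ha)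

theorem NoSparse.card_le_of_subset_far (hP : NoSparse G) (h : Indep G S) (hS : S ⊆ far G v) : #S ≤ 6 := by
  have := hP.indep (indep_insert_of_subset_far h hS)
  rw [card_insert_of_notMem fun hv => ne_of_mem_far (hS hv) rfl] at this
  omega

theorem notMem_rest₂ (hG : Holds G) (hy : y ∈ rest G v) (hxy : G.Adj x y) :
    x ∉ rest₂ G v := fun h => hG.not_adj_of_mem_rest₂ hy x h hxy.symm

theorem NoSparse.card_rest₂_le (hP : NoSparse G) (hG : Holds G) (hx : x ∈ rest G v) (hy : y ∈ rest G v)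
    (hxy : G.Adj x y) : #(rest₂ G v) ≤ 4 := by
  have h1 := (hG.indep_rest₂ (v := v)).onlyEdge_insert_insert (hG.not_adj_of_mem_rest₂ hx)
    (hG.not_adj_of_mem_rest₂ hy)
  have h2 : insert x (insert y (rest₂ G v)) ⊆ far G v :=
    insert_subset (far_of_mem_rest hx) (insert_subset (far_of_mem_rest hy) (rest₂_subset.trans rest_subset))
  have h3 := hP _ _ _ (h1.insert fun _ ha => not_adj_of_mem_far (v := v) (h2 ha))
  rw [card_insert_of_notMem fun hv => ne_of_mem_far (h2 hv) rfl, card_insert_of_notMem,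
    card_insert_of_notMem (notMem_rest₂ hG hx hxy.symm)] at h3
  · omega
  · rw [mem_insert, not_or]
    exact ⟨hxy.ne, notMem_rest₂ hG hy hxy⟩

theorem two_le_card_rest₁ (hG : Holds G) (hx : x ∈ rest G v) (hy : y ∈ rest G v) (hxy : G.Adj x y) :
    2 ≤ #(rest₁ G v) := by
  rw [← card_pair hxy.ne]
  refine card_le_card (insert_subset (hG.mem_rest₁_of_adj hx hy hxy) ?_)
  exact singleton_subset_iff.2 (hG.mem_rest₁_of_adj hy hx hxy.symm)

theorem indep_free : Indep G (free G v) :=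
  fun _ ha b hb => (mem_free.1 ha).2 b (mem_free.1 hb).1

theorem Indep.free_union (h : Indep G W) (hW : W ⊆ rest₀ G v) : Indep G (free G v ∪ W) :=
  indep_free.union h fun a ha _ hb hab => (mem_rest₀.1 (hW hb)).2 a (mem_free.1 ha).1 hab.symm

theorem disjoint_nbr_of_subset (hW : W ⊆ rest₀ G v) : Disjoint (nbr G v) W :=
  disjoint_nbr_far.mono_right (hW.trans rest₀_subset)

theorem exists_adj_of_bound_nonempty (h : (bound G v).Nonempty) :
    ∃ a ∈ bound G v, ∃ b ∈ bound G v, G.Adj a b := by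
  obtain ⟨a, ha⟩ := h
  obtain ⟨ha', b, hb, hab⟩ := mem_bound.1 ha
  exact ⟨a, ha, b, mem_bound.2 ⟨hb, a, ha', hab.symm⟩, hab⟩

theorem NoSparse.card_free_add_card_le (hP : NoSparse G) (hJ : (bound G v).Nonempty) (hW : W ⊆ rest₀ G v)
    (h : Indep G W) : #(free G v) + #W ≤ 5 := by
  obtain ⟨a, ha, b, hb, hab⟩ := exists_adj_of_bound_nonempty hJ
  have h0 : ∀ c ∈ bound G v, ∀ x ∈ free G v ∪ W, ¬ G.Adj c x := by
    intro c hc x hx hcx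
    rcases mem_union.1 hx with hx | hx
    · exact (mem_free.1 hx).2 c (mem_bound.1 hc).1 hcx.symm
    · exact (mem_rest₀.1 (hW hx)).2 c (mem_bound.1 hc).1 hcx.symm
  have h1 : ∀ c ∈ bound G v, c ∉ free G v ∪ W := by
    intro c hc hx
    rcases mem_union.1 hx with hx | hx
    · exact disjoint_left.1 disjoint_free_bound hx hc
    · exact disjoint_left.1 (disjoint_nbr_of_subset hW) (filter_subset _ _ hc) hx
  have h2 := hP _ _ _ ((h.free_union hW).onlyEdge_insert_insert (h0 a ha) (h0 b hb))
  rw [card_insert_of_notMem, card_insert_of_notMem (h1 b hb), card_union_of_disjoint] at h2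
  · omega
  · exact (disjoint_nbr_of_subset hW).mono_left (filter_subset _ _)
  · rw [mem_insert, not_or]
    exact ⟨hab.ne, h1 a ha⟩

theorem NoSparse.exists_degOn_le_two (hP : NoSparse G) (hG : Holds G) (hJ : (bound G v).Nonempty)
    (h : Indep G (rest G v)) (hq : #(rest G v) = 6) : ∃ x ∈ rest G v, degOn G (nbr G v) x ≤ 2 := by
  obtain ⟨a, ha, b, hb, hab⟩ := exists_adj_of_bound_nonempty hJ
  by_contra! hlt
  have h0 : ∀ c ∈ bound G v, ∀ x ∈ rest G v, ¬ G.Adj c x := fun c hc x hx hcx =>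
    absurd (hG.degOn_le_two (far_of_mem_rest hx) hc hcx.symm) (hlt x hx).not_ge
  have h1 : ∀ c ∈ bound G v, c ∉ rest G v := fun c hc hc' =>
    disjoint_left.1 disjoint_nbr_far (filter_subset _ _ hc) (far_of_mem_rest hc')
  have h2 := hP _ _ _ (h.onlyEdge_insert_insert (h0 a ha) (h0 b hb))
  rw [card_insert_of_notMem, card_insert_of_notMem (h1 b hb)] at h2
  · omega
  · rw [mem_insert, not_or]
    exact ⟨hab.ne, h1 a ha⟩

theorem degOn_eq_zero_or_of_not_cross (h : ∀ a ∈ W, ∀ b ∈ W, a ≠ b → G.Adj x a → ¬ G.Adj y b) :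
    degOn G W x = 0 ∨ degOn G W y = 0 ∨ degOn G W x + degOn G W y ≤ 2 := by
  by_contra! hne
  obtain ⟨hx, hy, h2⟩ := hne
  have key : ∀ a ∈ W, ∀ b ∈ W, G.Adj x a → G.Adj y b → a = b := fun a ha b hb hxa hyb => by
    by_contra hab
    exact h a ha b hb hab hxa hyb
  obtain ⟨a, ha⟩ := card_pos.1 (Nat.pos_of_ne_zero hx)
  obtain ⟨b, hb⟩ := card_pos.1 (Nat.pos_of_ne_zero hy)
  rw [mem_filter] at ha hb
  have h3 : degOn G W x ≤ 1 := card_le_one.2 fun c hc c' hc' => by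
    rw [mem_filter] at hc hc'
    rw [key c hc.1 b hb.1 hc.2 hb.2, key c' hc'.1 b hb.1 hc'.2 hb.2]
  have h4 : degOn G W y ≤ 1 := card_le_one.2 fun c hc c' hc' => by
    rw [mem_filter] at hc hc'
    rw [← key a ha.1 c hc.1 ha.2 hc.2, ← key a ha.1 c' hc'.1 ha.2 hc'.2]
  omega

theorem Holds.degOn_cases (hG : Holds G) (hi : 2 ≤ #(free G v)) (hx : x ∈ rest G v) (hy : y ∈ rest G v)
    (hxy : x ≠ y) (hW : W ⊆ rest₀ G v) (hW' : ∀ a ∈ W, ∀ b ∈ W, a ≠ b → G.Adj a b) :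
    degOn G (nbr G v) x + degOn G (nbr G v) y ≤ #(free G v) + 2 ∨
      degOn G W x = 0 ∨ degOn G W y = 0 ∨ degOn G W x + degOn G W y ≤ 2 := by
  by_cases h : ∀ a ∈ W, ∀ b ∈ W, a ≠ b → G.Adj x a → ¬ G.Adj y b
  · exact Or.inr (degOn_eq_zero_or_of_not_cross h)
  · push Not at h
    obtain ⟨a, ha, b, hb, hab, hxa, hyb⟩ := h
    exact Or.inl (hG.degOn_add_degOn_le hi hx hy hxy (hW ha) (hW hb) (hW' a ha b hb hab) hxa hyb)

theorem Holds.degOn_add_degOn_le_two (hG : Holds G) (hx : x ∈ rest G v) (hy : y ∈ rest G v)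
    (hxy : G.Adj x y) (hW : W ⊆ rest₀ G v) (hW' : ∀ a ∈ W, ∀ b ∈ W, a ≠ b → G.Adj a b) (h2 : #W ≤ 2) :
    degOn G W x + degOn G W y ≤ 2 := by
  have hWx := degOn_le_card (G := G) W x
  have hWy := degOn_le_card (G := G) W y
  have h0 : ∀ a ∈ W, ∀ b ∈ W, a ≠ b → G.Adj x a → ¬ G.Adj y b := by
    intro a ha b hb hab hxa hyb
    obtain ⟨hx, c, hc, hxc⟩ := mem_rest.1 hx
    obtain ⟨hy, d, hd, hyd⟩ := mem_rest.1 hy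
    obtain rfl := hG.eq_of_far hx hy hxy hc hd hxc hyd
    have ha := mem_rest₀.1 (hW ha)
    have hb := mem_rest₀.1 (hW hb)
    refine hG c x a b y hxc.symm hxa (hW' a ‹_› b ‹_› hab) hyb.symm hyd ?_ ?_ ?_ ?_ hxy.ne'
    · rintro rfl
      exact not_adj_of_mem_far ha.1 hc
    · rintro rfl
      exact hb.2 _ hc hxc
    · rintro rfl
      exact ha.2 _ hc hyd
    · rintro rfl
      exact not_adj_of_mem_far hb.1 hc
  rcases degOn_eq_zero_or_of_not_cross h0 with h | h | h <;> omega

end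

section

variable {V : Type*} [Fintype V] [DecidableEq V] {G : SimpleGraph V} [DecidableRel G.Adj]
variable {S W : Finset V} {v x y z : V}

theorem NoSparse.rest_cases (hP : NoSparse G) (hG : Holds G) :
    (∃ x ∈ rest G v, ∃ y ∈ rest G v, G.Adj x y) ∧ 2 ≤ #(rest₁ G v) ∧ #(rest₂ G v) ≤ 4 ∨
      Indep G (rest G v) ∧ darts G (rest G v) (rest G v) = 0 ∧ #(rest G v) ≤ 6 := by
  by_cases h : Indep G (rest G v)
  · exact Or.inr ⟨h, h.darts_eq, hP.card_le_of_subset_far h rest_subset⟩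
  · obtain ⟨x, hx, y, hy, hxy⟩ := not_indep_iff.1 h
    exact Or.inl ⟨⟨x, hx, y, hy, hxy⟩, two_le_card_rest₁ hG hx hy hxy, hP.card_rest₂_le hG hx hy hxy⟩

theorem Holds.darts_univ_le_of_card_free_le_two (hG : Holds G) (hV : Fintype.card V = 15)
    (hd : 6 ≤ #(nbr G v)) (hi : #(free G v) ≤ 2) : darts G univ univ ≤ 76 := by
  have h1 := darts_univ (G := G) (v := v)
  have h2 := darts_far (G := G) (v := v)
  have h3 := card_nbr_add_card_far (G := G) (v := v)
  have h4 := card_free_add_card_bound (G := G) (v := v)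
  have h5 := card_rest₀_add_card_rest (G := G) (v := v)
  have h6 := card_rest₁_add_card_rest₂ (G := G) (v := v)
  have h7 := hG.darts_rest_nbr (v := v)
  have h8 := hG.darts_rest (v := v)
  have h9 := hG.darts_nbr (v := v)
  have h10 := darts_le (G := G) (rest G v) (rest₀ G v)
  have h11 := darts_self_le (G := G) (rest₀ G v)
  have h12 := hG.darts_of_card_eq_eight (S := far G v)
  rw [max_eq_right hi] at h7
  rw [hV] at h3
  generalize darts G univ univ = t at *
  generalize darts G (nbr G v) (nbr G v) = n at *
  generalize darts G (rest G v) (nbr G v) = m at *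
  generalize darts G (rest G v) (rest G v) = e at *
  generalize darts G (rest G v) (rest₀ G v) = f at *
  generalize darts G (rest₀ G v) (rest₀ G v) = g at *
  generalize darts G (far G v) (far G v) = k at *
  generalize #(nbr G v) = d at *
  generalize #(far G v) = r at *
  generalize #(rest G v) = q at *
  have h13 : #(rest₀ G v) ≤ 8 := by omega
  generalize #(rest₀ G v) = r₀ at *
  have h14 : d ≤ 14 := by omega
  interval_cases r₀ <;> interval_cases d <;> omega

theorem Holds.counts (hG : Holds G) (hV : Fintype.card V = 15) (v : V) :
    darts G univ univ = 2 * #(nbr G v) + darts G (nbr G v) (nbr G v) +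
      2 * darts G (rest G v) (nbr G v) + darts G (far G v) (far G v) ∧
    darts G (far G v) (far G v) = darts G (rest₀ G v) (rest₀ G v) +
      2 * darts G (rest G v) (rest₀ G v) + darts G (rest G v) (rest G v) ∧
    #(nbr G v) + #(rest₀ G v) + #(rest G v) = 14 ∧ #(free G v) + #(bound G v) = #(nbr G v) ∧
    #(rest₁ G v) + #(rest₂ G v) = #(rest G v) ∧ #(rest₀ G v) + #(rest G v) = #(far G v) ∧
    darts G (nbr G v) (nbr G v) ≤ 2 * #(bound G v) ∧
    darts G (rest G v) (rest G v) ≤ 2 * #(rest₁ G v) := by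
  have h3 := card_nbr_add_card_far (G := G) (v := v)
  have h5 := card_rest₀_add_card_rest (G := G) (v := v)
  exact ⟨darts_univ, darts_far, by omega, card_free_add_card_bound, card_rest₁_add_card_rest₂, h5,
    hG.darts_nbr, hG.darts_rest⟩

theorem Holds.darts_rest_nbr_of_two_le (hG : Holds G) (hi : 2 ≤ #(free G v)) :
    darts G (rest G v) (nbr G v) ≤ #(rest₁ G v) + #(free G v) * #(rest₂ G v) := by
  have := hG.darts_rest_nbr (v := v)
  rwa [max_eq_left hi] at this

theorem degOn_le_card_free (hG : Holds G) (hi : 2 ≤ #(free G v)) (hx : x ∈ far G v) :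
    degOn G (nbr G v) x ≤ #(free G v) := by
  have := hG.degOn_le_max hx
  rwa [max_eq_left hi] at this

/-! ### The case where the neighbourhood is independent -/

theorem indep_nbr (hJ : bound G v = ∅) : Indep G (nbr G v) := by
  rw [← free_union_bound, hJ, union_empty]
  exact indep_free

theorem onlyEdge_of_degOn_le_one (h : Indep G S) (hx : degOn G S x ≤ 1) :
    ∃ y, OnlyEdge G (insert x S) x y := by
  rcases Nat.eq_zero_or_pos (degOn G S x) with h0 | h0
  · exact ⟨x, (h.insert (degOn_eq_zero.1 h0)).onlyEdge x x⟩
  · obtain ⟨y, hy⟩ := card_eq_one.1 (Nat.le_antisymm hx h0)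
    refine ⟨y, h.onlyEdge_insert fun a ha hxa => ?_⟩
    rw [← mem_singleton, ← hy, mem_filter]
    exact ⟨ha, hxa⟩

theorem NoSparse.two_le_degOn (hP : NoSparse G) (h : Indep G S) (hS : #S = 7) (hx : x ∉ S) :
    2 ≤ degOn G S x := by
  by_contra! hlt
  obtain ⟨y, hy⟩ := onlyEdge_of_degOn_le_one h (Nat.le_of_lt_succ hlt)
  have := hP _ _ _ hy
  rw [card_insert_of_notMem hx, hS] at this
  omega

theorem NoSparse.card_nbr_ne_seven (hP : NoSparse G) (hG : Holds G) (hV : Fintype.card V = 15)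
    (hJ : bound G v = ∅) : #(nbr G v) ≠ 7 := by
  intro h7
  have h1 : ∀ x ∈ far G v, 2 ≤ degOn G (nbr G v) x := fun x hx =>
    hP.two_le_degOn (indep_nbr hJ) h7 (disjoint_right.1 disjoint_nbr_far hx)
  have h2 : far G v ⊆ rest₂ G v := fun x hx => by
    have := h1 x hx
    exact mem_filter.2 ⟨mem_filter.2 ⟨hx, by omega⟩, by omega⟩
  have h3 := hP.card_le_of_subset_far (hG.indep_rest₂.mono h2) Subset.rfl
  have h4 := card_nbr_add_card_far (G := G) (v := v)
  omega

theorem NoSparse.darts_univ_le_of_bound_eq_empty (hP : NoSparse G) (hG : Holds G)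
    (hV : Fintype.card V = 15) (hd : 6 ≤ #(nbr G v)) (hJ : bound G v = ∅) : darts G univ univ ≤ 76 := by
  have hN := indep_nbr hJ
  have h7 := hP.card_nbr_ne_seven hG hV hJ
  have h8 := hP.indep hN
  obtain ⟨h9, h10, h11, h12, h13, h14, h15, h16⟩ := hG.counts hV v
  have h17 := hG.darts_rest_nbr_of_two_le (v := v) (by rw [hJ, card_empty] at h12; omega)
  have hNR : Disjoint (nbr G v) (rest₀ G v) := disjoint_nbr_of_subset Subset.rfl
  have h0 : ∀ w ∈ rest₀ G v, ∀ a ∈ nbr G v, ¬ G.Adj w a := fun w hw a ha =>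
    (mem_rest₀.1 hw).2 a (mem_nbr.1 ha)
  have hR₀ : #(rest₀ G v) ≤ 1 := by
    refine card_le_one.2 fun w hw w' hw' => ?_
    by_contra hne
    have := hP _ _ _ (hN.onlyEdge_insert_insert (h0 w hw) (h0 w' hw'))
    rw [card_insert_of_notMem, card_insert_of_notMem (disjoint_right.1 hNR hw')] at this
    · omega
    · rw [mem_insert, not_or]
      exact ⟨hne, disjoint_right.1 hNR hw⟩
  rw [hJ, card_empty] at h12
  have h18 := card_free_add_card_bound (G := G) (v := v)
  have h19 : #(free G v) = 6 := by omega
  rw [h19] at h17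
  rcases Nat.eq_zero_or_pos #(rest₀ G v) with hz | hz
  · rw [card_eq_zero] at hz
    have : darts G (rest₀ G v) (rest₀ G v) = 0 := by rw [hz]; rfl
    have : darts G (rest G v) (rest₀ G v) = 0 := by rw [darts_comm, hz]; rfl
    rw [hz, card_empty] at h11 h14
    rcases hP.rest_cases hG (v := v) with ⟨-, h20, h21⟩ | ⟨-, h20, h21⟩ <;> omega
  obtain ⟨w, hw⟩ := card_eq_one.1 (Nat.le_antisymm hR₀ hz)
  have hww : w ∈ rest₀ G v := by rw [hw]; exact mem_singleton_self w
  have hN' := hN.insert (h0 w hww)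
  have hN'' : #(insert w (nbr G v)) = 7 := by
    rw [card_insert_of_notMem (disjoint_right.1 hNR hww)]
    omega
  have hxw : ∀ x ∈ rest₁ G v, G.Adj x w := by
    intro x hx
    by_contra hxw
    have hx' := rest₁_subset hx
    have h20 := hP.two_le_degOn hN' hN'' (x := x) ?_
    · have h21 := (mem_filter.1 hx).2
      rw [degOn, filter_insert, if_neg hxw] at h20
      rw [degOn] at h21
      omega
    · rw [mem_insert, not_or]
      refine ⟨?_, disjoint_right.1 disjoint_nbr_far (far_of_mem_rest hx')⟩
      rintro rfl
      exact disjoint_left.1 disjoint_rest₀_rest hww hx'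
  rcases hP.rest_cases hG (v := v) with ⟨⟨p, hp, p', hp', hpp'⟩, -, h21⟩ | ⟨-, -, h21⟩
  swap
  · omega
  have hp₁ := hG.mem_rest₁_of_adj hp hp' hpp'
  have hp₁' := hG.mem_rest₁_of_adj hp' hp hpp'.symm
  obtain ⟨hpf, a, ha, hpa⟩ := mem_rest.1 hp
  obtain ⟨hpf', b, hb, hpb⟩ := mem_rest.1 hp'
  obtain rfl := hG.eq_of_far hpf hpf' hpp' ha hb hpa hpb
  have hpent : ∀ x, x ≠ p → x ≠ p' → G.Adj x a → ¬ G.Adj x w := by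
    intro x hxp hxp' hxa hxw'
    refine hG a x w p p' hxa.symm hxw' (hxw p hp₁).symm hpp' hpb ?_ hxp (hxw p' hp₁').ne' hpa.ne hxp'.symm
    rintro rfl
    exact not_adj_of_mem_far (rest₀_subset hww) ha
  have h22 : ∑ x ∈ rest₂ G v, (degOn G (nbr G v) x + degOn G (rest₀ G v) x) ≤ #(rest₂ G v) • 6 := by
    refine sum_le_card_nsmul _ _ _ fun x hx => ?_
    have hxp : x ≠ p := by
      rintro rfl
      exact notMem_rest₂ hG hp' hpp' hx
    have hxp' : x ≠ p' := by
      rintro rfl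
      exact notMem_rest₂ hG hp hpp'.symm hx
    have h23 : degOn G (nbr G v) x ≤ #(nbr G v) := degOn_le_card _ _
    by_cases hxw' : G.Adj x w
    · have h24 : degOn G (nbr G v) x ≤ #((nbr G v).erase a) := card_le_card fun c hc => by
        rw [mem_filter] at hc
        refine mem_erase.2 ⟨?_, hc.1⟩
        rintro rfl
        exact hpent x hxp hxp' hc.2 hxw'
      have h25 : degOn G (rest₀ G v) x ≤ #(rest₀ G v) := degOn_le_card _ _
      rw [card_erase_of_mem (mem_nbr.2 ha)] at h24
      omega
    · have : degOn G (rest₀ G v) x = 0 := by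
        rw [hw, degOn_eq_zero]
        intro y hy
        rwa [mem_singleton.1 hy]
      omega
  rw [sum_add_distrib, smul_eq_mul] at h22
  change darts G (rest₂ G v) (nbr G v) + darts G (rest₂ G v) (rest₀ G v) ≤ _ at h22
  have h23 : darts G (rest₁ G v) (nbr G v) ≤ #(rest₁ G v) • 1 :=
    sum_le_card_nsmul _ _ _ fun x hx => (mem_filter.1 hx).2.le
  have h24 := darts_le (G := G) (rest₁ G v) (rest₀ G v)
  have h25 := darts_union_left (G := G) (disjoint_rest₁_rest₂ (G := G) (v := v)) (nbr G v)
  have h26 := darts_union_left (G := G) (disjoint_rest₁_rest₂ (G := G) (v := v)) (rest₀ G v)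
  rw [rest₁_union_rest₂] at h25 h26
  rw [smul_eq_mul, mul_one] at h23
  have hz1 : #(rest₀ G v) = 1 := Nat.le_antisymm hR₀ hz
  have h27 := darts_self_le (G := G) (rest₀ G v)
  rw [hz1] at h24 h27
  suffices #(rest₂ G v) ≤ 3 by omega
  obtain ⟨s, hs, hspp⟩ : ∃ s ∈ rest₁ G v, s ∉ ({p, p'} : Finset V) :=
    exists_mem_notMem_of_card_lt_card (lt_of_le_of_lt card_le_two (by omega))
  simp only [mem_insert, mem_singleton, not_or] at hspp
  have hsr := rest₁_subset hs
  have hsa : ¬ G.Adj s a := fun h => hpent s hspp.1 hspp.2 h (hxw s hs)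
  obtain ⟨hsf, c, hc, hsc⟩ := mem_rest.1 hsr
  have hsp : ¬ G.Adj s p := fun h => hsa (hG.eq_of_far hsf hpf h hc ha hsc hpa ▸ hsc)
  have hsp' : ¬ G.Adj s p' := fun h => hsa (hG.eq_of_far hsf hpf' h hc ha hsc hpb ▸ hsc)
  have h28 := ((hG.indep_rest₂ (v := v)).onlyEdge_insert_insert (hG.not_adj_of_mem_rest₂ hp)
    (hG.not_adj_of_mem_rest₂ hp')).insert (z := s) fun y hy => by
      rcases mem_insert.1 hy with rfl | hy
      · exact hsp
      · rcases mem_insert.1 hy with rfl | hy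
        · exact hsp'
        · exact hG.not_adj_of_mem_rest₂ hsr y hy
  have h29 : insert s (insert p (insert p' (rest₂ G v))) ⊆ far G v :=
    insert_subset hsf (insert_subset hpf (insert_subset hpf' (rest₂_subset.trans rest_subset)))
  have h30 := hP _ _ _ (h28.insert fun _ ha => not_adj_of_mem_far (v := v) (h29 ha))
  rw [card_insert_of_notMem fun hv => ne_of_mem_far (h29 hv) rfl, card_insert_of_notMem,
    card_insert_of_notMem, card_insert_of_notMem (notMem_rest₂ hG hp hpp'.symm)] at h30
  · omega
  · rw [mem_insert, not_or]
    exact ⟨hpp'.ne, notMem_rest₂ hG hp' hpp'⟩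
  · simp only [mem_insert, not_or]
    exact ⟨hspp.1, hspp.2, disjoint_left.1 disjoint_rest₁_rest₂ hs⟩

end

section

variable {V : Type*} [Fintype V] [DecidableEq V] {G : SimpleGraph V} [DecidableRel G.Adj]
variable {S W : Finset V} {v x y z : V}

theorem NoSparse.card_free_le_five (hP : NoSparse G) (hJ : (bound G v).Nonempty) : #(free G v) ≤ 5 :=
  hP.card_free_add_card_le hJ (W := ∅) (empty_subset _) fun _ h => absurd h (notMem_empty _)

theorem NoSparse.card_free_le_four (hP : NoSparse G) (hJ : (bound G v).Nonempty)
    (h : (rest₀ G v).Nonempty) : #(free G v) ≤ 4 := by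
  obtain ⟨w, hw⟩ := h
  have := hP.card_free_add_card_le hJ (W := {w}) (singleton_subset_iff.2 hw) fun a ha b hb hab => by
    rw [mem_singleton.1 ha, mem_singleton.1 hb] at hab
    exact G.irrefl hab
  rw [card_singleton] at this
  omega

theorem darts_rest_nbr_le_of_exists (hG : Holds G) (hi : 2 ≤ #(free G v))
    (h : ∃ x ∈ rest G v, degOn G (nbr G v) x ≤ 2) :
    darts G (rest G v) (nbr G v) ≤ 2 + (#(rest G v) - 1) * #(free G v) := by
  obtain ⟨x, hx, h2⟩ := h
  exact sum_le_of_exists _ hx h2 fun y hy => degOn_le_card_free hG hi (far_of_mem_rest hy)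

theorem NoSparse.darts_univ_le_of_rest₀_eq_empty (hP : NoSparse G) (hG : Holds G)
    (hV : Fintype.card V = 15) (hd : 6 ≤ #(nbr G v)) (hJ : (bound G v).Nonempty)
    (hi : 3 ≤ #(free G v)) (hR₀ : rest₀ G v = ∅) : darts G univ univ ≤ 76 := by
  have h2 := hP.card_free_le_five hJ
  obtain ⟨h9, h10, h11, h12, h13, h14, h15, h16⟩ := hG.counts hV v
  have h17 := hG.darts_rest_nbr_of_two_le (v := v) (by omega)
  have h18 : darts G (rest₀ G v) (rest₀ G v) = 0 := by rw [hR₀]; rfl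
  have h19 : darts G (rest G v) (rest₀ G v) = 0 := by rw [darts_comm, hR₀]; rfl
  have h20 := fun h h' => darts_rest_nbr_le_of_exists hG (by omega) (hP.exists_degOn_le_two hG hJ h h')
  rw [hR₀, card_empty] at h11 h14
  rcases hP.rest_cases hG (v := v) with ⟨-, h21, h22⟩ | ⟨h21, h22, h23⟩
  · clear h20
    generalize #(free G v) = i at *
    interval_cases i <;> omega
  · have h24 := h20 h21
    generalize #(free G v) = i at *
    clear h20
    have h25 : #(nbr G v) ≤ 14 := by omega
    generalize #(rest G v) = q at *
    generalize #(nbr G v) = d at *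
    interval_cases i <;> interval_cases d <;> omega

theorem darts_rest_rest₀_le (hΔ : ∀ x, degOn G univ x ≤ #(nbr G v)) :
    darts G (rest G v) (rest₀ G v) ≤ #(rest₀ G v) * #(nbr G v) := by
  rw [darts_comm]
  exact sum_le_card_nsmul _ _ _ fun x _ => (degOn_mono (subset_univ _) x).trans (hΔ x)

theorem NoSparse.darts_univ_le_of_card_rest₀_eq_one (hP : NoSparse G) (hG : Holds G)
    (hV : Fintype.card V = 15) (hd : 6 ≤ #(nbr G v)) (hΔ : ∀ x, degOn G univ x ≤ #(nbr G v))
    (hJ : (bound G v).Nonempty) (hi : 3 ≤ #(free G v)) (hR₀ : #(rest₀ G v) = 1) :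
    darts G univ univ ≤ 76 := by
  have h2 := hP.card_free_le_four hJ (card_pos.1 (by omega))
  obtain ⟨h9, h10, h11, h12, h13, h14, h15, h16⟩ := hG.counts hV v
  have h17 := hG.darts_rest_nbr_of_two_le (v := v) (by omega)
  have h18 := darts_self_le (G := G) (rest₀ G v)
  have h19 := darts_le (G := G) (rest G v) (rest₀ G v)
  have h20 := darts_rest_rest₀_le hΔ
  have h21 := fun h h' => darts_rest_nbr_le_of_exists hG (by omega) (hP.exists_degOn_le_two hG hJ h h')
  rw [hR₀] at h11 h14 h18 h19 h20
  rcases hP.rest_cases hG (v := v) with ⟨-, h22, h23⟩ | ⟨h22, h23, h24⟩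
  · clear h21
    generalize #(free G v) = i at *
    interval_cases i <;> omega
  · have h25 := h21 h22
    clear h21
    generalize #(free G v) = i at *
    have h26 : #(nbr G v) ≤ 14 := by omega
    generalize #(rest G v) = q at *
    generalize #(nbr G v) = d at *
    interval_cases i <;> interval_cases d <;> omega

end

section

variable {V : Type*} [Fintype V] [DecidableEq V] {G : SimpleGraph V} [DecidableRel G.Adj]
variable {S W : Finset V} {v x y z : V}

theorem indep_pair (h : ¬ G.Adj x y) : Indep G {x, y} := by
  refine Indep.insert (S := {y}) (fun a ha b hb hab => ?_) fun a ha => ?_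
  · rw [mem_singleton.1 ha, mem_singleton.1 hb] at hab
    exact G.irrefl hab
  · rwa [mem_singleton.1 ha]

theorem NoSparse.adj_of_card_free_eq_four (hP : NoSparse G) (hJ : (bound G v).Nonempty)
    (hi : #(free G v) = 4) : ∀ a ∈ rest₀ G v, ∀ b ∈ rest₀ G v, a ≠ b → G.Adj a b := by
  intro a ha b hb hab
  by_contra h
  have := hP.card_free_add_card_le hJ (insert_subset ha (singleton_subset_iff.2 hb)) (indep_pair h)
  rw [card_pair hab] at this
  omega

theorem Holds.two_mul_darts_le (hG : Holds G) (hi : 2 ≤ #(free G v)) (hi' : #(free G v) ≤ 4)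
    (hq : 2 ≤ #(rest G v)) (hW : W ⊆ rest₀ G v) (hW' : ∀ a ∈ W, ∀ b ∈ W, a ≠ b → G.Adj a b)
    (h2 : #W ≤ 2) :
    2 * (darts G (rest G v) (nbr G v) + darts G (rest G v) W) ≤ #(rest G v) * (#(free G v) + 6) := by
  have := two_mul_sum_le_of_pairs (S := rest G v) (fun x => degOn G (nbr G v) x + degOn G W x) hq
    (s := #(free G v) + 6) fun x hx y hy hxy => by
      have h3 := hG.degOn_cases hi hx hy hxy hW hW'
      have h4 := degOn_le_card_free hG hi (far_of_mem_rest hx)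
      have h5 := degOn_le_card_free hG hi (far_of_mem_rest hy)
      have h6 := degOn_le_card (G := G) W x
      have h7 := degOn_le_card (G := G) W y
      omega
  rwa [sum_add_distrib] at this

theorem darts_rest_add_le (hΔ : ∀ x, degOn G univ x ≤ #(nbr G v)) :
    darts G (rest G v) (nbr G v) + darts G (rest G v) (rest₀ G v) + darts G (rest G v) (rest G v) ≤
      #(rest G v) * #(nbr G v) := by
  have h1 := darts_union_right (G := G) (disjoint_nbr_far (G := G) (v := v)) (rest G v)
  have h2 := darts_union_right (G := G) (disjoint_rest₀_rest (G := G) (v := v)) (rest G v)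
  have h3 : darts G (rest G v) (nbr G v ∪ far G v) ≤ #(rest G v) * #(nbr G v) :=
    sum_le_card_nsmul _ _ _ fun x _ => (degOn_mono (subset_univ _) x).trans (hΔ x)
  rw [rest₀_union_rest] at h2
  omega

/-! ### Two vertices at distance three -/

theorem NoSparse.darts_univ_le_of_seven_four_two (hP : NoSparse G) (hG : Holds G)
    (hV : Fintype.card V = 15) (hJ : (bound G v).Nonempty) (hd : #(nbr G v) = 7)
    (hi : #(free G v) = 4) (hR₀ : #(rest₀ G v) = 2) : darts G univ univ ≤ 76 := by
  obtain ⟨h9, h10, h11, h12, h13, h14, h15, h16⟩ := hG.counts hV v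
  have h17 := hG.darts_rest_nbr_of_two_le (v := v) (by omega)
  have h18 := darts_self_le (G := G) (rest₀ G v)
  have h19 := darts_le (G := G) (rest G v) (rest₀ G v)
  have h20 := hG.two_mul_darts_le (by omega) hi.le (by omega) Subset.rfl
    (hP.adj_of_card_free_eq_four hJ hi) hR₀.le
  rw [hi] at h17 h20 h12
  rw [hR₀] at h18 h19 h11
  rcases hP.rest_cases hG (v := v) with ⟨-, h22, h23⟩ | ⟨h22, h23, h24⟩ <;> omega

theorem NoSparse.darts_univ_le_of_six_four_two (hP : NoSparse G) (hG : Holds G)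
    (hV : Fintype.card V = 15) (hJ : (bound G v).Nonempty) (hd : #(nbr G v) = 6)
    (hi : #(free G v) = 4) (hR₀ : #(rest₀ G v) = 2) : darts G univ univ ≤ 76 := by
  obtain ⟨h9, h10, h11, h12, h13, h14, h15, h16⟩ := hG.counts hV v
  have h17 := hG.darts_rest_nbr_of_two_le (v := v) (by omega)
  have h18 := darts_self_le (G := G) (rest₀ G v)
  have h19 := darts_nbr_le (G := G) (v := v)
  have hR₀' := hP.adj_of_card_free_eq_four hJ hi
  have h20 := hG.two_mul_darts_le (by omega) hi.le (by omega) Subset.rfl hR₀' hR₀.le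
  rw [hi] at h17 h20 h12
  rw [hR₀] at h18 h11
  rw [show #(bound G v) = 2 by omega] at h19
  rcases hP.rest_cases hG (v := v) with ⟨⟨p, hp, p', hp', hpp'⟩, h22, h23⟩ | ⟨h22, h23, h24⟩
  · suffices darts G (rest G v) (rest₀ G v) ≤ 10 by omega
    have h24 := hG.degOn_add_degOn_le_two hp hp' hpp' Subset.rfl hR₀' hR₀.le
    have h25 : p' ∈ (rest G v).erase p := mem_erase.2 ⟨hpp'.ne', hp'⟩
    have h26 : ∑ x ∈ ((rest G v).erase p).erase p', degOn G (rest₀ G v) x ≤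
        #(((rest G v).erase p).erase p') • #(rest₀ G v) :=
      sum_le_card_nsmul _ _ _ fun x _ => degOn_le_card _ _
    rw [card_erase_of_mem h25, card_erase_of_mem hp, hR₀, smul_eq_mul] at h26
    rw [darts, ← add_sum_erase _ _ hp, ← add_sum_erase _ _ h25]
    omega
  · omega

theorem NoSparse.darts_univ_le_of_six_three_two (hP : NoSparse G) (hG : Holds G)
    (hV : Fintype.card V = 15) (hJ : (bound G v).Nonempty) (hd : #(nbr G v) = 6)
    (hi : #(free G v) = 3) (hR₀ : #(rest₀ G v) = 2) : darts G univ univ ≤ 76 := by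
  obtain ⟨h9, h10, h11, h12, h13, h14, h15, h16⟩ := hG.counts hV v
  have h17 := hG.darts_rest_nbr_of_two_le (v := v) (by omega)
  have h18 := darts_self_le (G := G) (rest₀ G v)
  have h19 := darts_le (G := G) (rest G v) (rest₀ G v)
  by_cases h : Indep G (rest₀ G v)
  · have h20 := h.darts_eq
    rcases hP.rest_cases hG (v := v) with ⟨-, h22, h23⟩ | ⟨h22, h23, h24⟩
    · rw [hi] at h17 h12
      rw [hR₀] at h19 h11
      omega
    · have := darts_rest_nbr_le_of_exists hG (by omega) (hP.exists_degOn_le_two hG hJ h22 (by omega))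
      rw [hi] at this h12
      rw [hR₀] at h19 h11
      omega
  · have hR₀' : ∀ a ∈ rest₀ G v, ∀ b ∈ rest₀ G v, a ≠ b → G.Adj a b := by
      intro a ha b hb hab
      obtain ⟨c, hc, d, hd, hcd⟩ := not_indep_iff.1 h
      have h21 : {c, d} = rest₀ G v :=
        eq_of_subset_of_card_le (insert_subset hc (singleton_subset_iff.2 hd)) (by rw [card_pair hcd.ne, hR₀])
      rw [← h21, mem_insert, mem_singleton] at ha hb
      rcases ha with rfl | rfl <;> rcases hb with rfl | rfl
      · exact absurd rfl hab
      · exact hcd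
      · exact hcd.symm
      · exact absurd rfl hab
    have h20 := hG.two_mul_darts_le (by omega) (by omega) (by omega) Subset.rfl hR₀' hR₀.le
    rw [hi] at h17 h20 h12
    rw [hR₀] at h18 h19 h11
    rcases hP.rest_cases hG (v := v) with ⟨-, h22, h23⟩ | ⟨h22, h23, h24⟩ <;> omega

/-! ### Three vertices at distance three -/

theorem NoSparse.darts_univ_le_of_six_three_three (hP : NoSparse G) (hG : Holds G)
    (hV : Fintype.card V = 15) (hJ : (bound G v).Nonempty) (hd : #(nbr G v) = 6)
    (hi : #(free G v) = 3) (hR₀ : #(rest₀ G v) = 3) : darts G univ univ ≤ 76 := by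
  obtain ⟨h9, h10, h11, h12, h13, h14, h15, h16⟩ := hG.counts hV v
  have h17 := hG.darts_rest_nbr_of_two_le (v := v) (by omega)
  have h18 := darts_self_le (G := G) (rest₀ G v)
  have h19 := hG.darts_of_card_eq_eight (S := far G v) (by omega)
  obtain ⟨w, hw, w', hw', hww'⟩ : ∃ w ∈ rest₀ G v, ∃ w' ∈ rest₀ G v, G.Adj w w' := by
    refine not_indep_iff.1 fun h => ?_
    have := hP.card_free_add_card_le hJ Subset.rfl h
    omega
  have hW : {w, w'} ⊆ rest₀ G v := insert_subset hw (singleton_subset_iff.2 hw')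
  have hW' : ∀ a ∈ ({w, w'} : Finset V), ∀ b ∈ ({w, w'} : Finset V), a ≠ b → G.Adj a b := by
    intro a ha b hb hab
    rw [mem_insert, mem_singleton] at ha hb
    rcases ha with rfl | rfl <;> rcases hb with rfl | rfl
    · exact absurd rfl hab
    · exact hww'
    · exact hww'.symm
    · exact absurd rfl hab
  have hWc : #({w, w'} : Finset V) = 2 := card_pair hww'.ne
  have h20 := two_mul_sum_le_of_pairs (S := rest G v)
    (fun x => 2 * degOn G (nbr G v) x + degOn G {w, w'} x) (by omega) (s := 14) fun x hx y hy hxy => by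
      have h3 := hG.degOn_cases (by omega) hx hy hxy hW hW'
      have h4 := degOn_le_card_free hG (by omega) (far_of_mem_rest hx)
      have h5 := degOn_le_card_free hG (by omega) (far_of_mem_rest hy)
      have h6 := degOn_le_card (G := G) {w, w'} x
      have h7 := degOn_le_card (G := G) {w, w'} y
      omega
  rw [sum_add_distrib, ← mul_sum] at h20
  change 2 * (2 * darts G (rest G v) (nbr G v) + darts G (rest G v) {w, w'}) ≤ _ at h20
  have h21 := darts_union_right (G := G) (disjoint_sdiff (s := {w, w'}) (t := rest₀ G v)) (rest G v)
  rw [union_sdiff_of_subset hW] at h21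
  have h22 := darts_le (G := G) (rest G v) (rest₀ G v \ {w, w'})
  rw [card_sdiff_of_subset hW, hWc, hR₀] at h22
  rw [hi] at h17 h12
  rw [hR₀] at h18 h11
  rcases hP.rest_cases hG (v := v) with ⟨-, h22, h23⟩ | ⟨h22, h23, h24⟩ <;> omega

theorem Holds.darts_add_darts_le (hG : Holds G) (hi : #(free G v) = 4) (hq : #(rest G v) = 5)
    (hR₀ : #(rest₀ G v) = 3) (hR₀' : ∀ a ∈ rest₀ G v, ∀ b ∈ rest₀ G v, a ≠ b → G.Adj a b) :
    darts G (rest G v) (nbr G v) + darts G (rest G v) (rest₀ G v) ≤ 28 := by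
  have ht : ∀ x ∈ rest G v, degOn G (nbr G v) x ≤ 4 := fun x hx => by
    have := degOn_le_card_free hG (by omega) (far_of_mem_rest hx)
    omega
  rw [darts, darts, ← sum_add_distrib]
  by_cases h : ∃ x ∈ rest G v, degOn G (rest₀ G v) x = 3
  · obtain ⟨x, hx, h3⟩ := h
    have hxw : ∀ a ∈ rest₀ G v, G.Adj x a := by
      have := eq_of_subset_of_card_le (filter_subset (G.Adj x) (rest₀ G v)) (by rw [hR₀]; exact h3.ge)
      rwa [filter_eq_self] at this
    have h4 : ∀ y ∈ (rest G v).erase x, degOn G (nbr G v) y + degOn G (rest₀ G v) y ≤ 5 := by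
      intro y hy
      obtain ⟨hyx, hy⟩ := mem_erase.1 hy
      have h5 : degOn G (rest₀ G v) y ≤ 1 := by
        refine card_le_one.2 fun a ha b hb => ?_
        rw [mem_filter] at ha hb
        by_contra hab
        obtain ⟨c, hc, hcab⟩ : ∃ c ∈ rest₀ G v, c ∉ ({a, b} : Finset V) :=
          exists_mem_notMem_of_card_lt_card (lt_of_le_of_lt card_le_two (by omega))
        simp only [mem_insert, mem_singleton, not_or] at hcab
        have hne : ∀ z ∈ rest G v, ∀ w ∈ rest₀ G v, z ≠ w := by
          rintro z hz w hw rfl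
          exact disjoint_left.1 disjoint_rest₀_rest hw hz
        exact hG y a c x b ha.2 (hR₀' a ha.1 c hc (Ne.symm hcab.1)) (hxw c hc).symm (hxw b hb.1) hb.2.symm
          (hne y hy c hc) (hne x hx a ha.1).symm hcab.2 hyx.symm (Ne.symm hab)
      have := ht y hy
      omega
    have h6 := sum_le_card_nsmul _ _ _ h4
    rw [card_erase_of_mem hx, hq, smul_eq_mul] at h6
    have := ht x hx
    rw [← add_sum_erase _ _ hx]
    omega
  · push Not at h
    have := two_mul_sum_le_of_pairs (S := rest G v)
      (fun x => degOn G (nbr G v) x + degOn G (rest₀ G v) x) (by omega) (s := 10) fun x hx y hy hxy => by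
        have h3 := hG.degOn_cases (by omega) hx hy hxy Subset.rfl hR₀'
        have h4 := ht x hx
        have h5 := ht y hy
        have h6 := degOn_le_card (G := G) (rest₀ G v) x
        have h7 := degOn_le_card (G := G) (rest₀ G v) y
        have h8 := h x hx
        have h9 := h y hy
        omega
    omega

theorem NoSparse.darts_univ_le_of_six_four_three (hP : NoSparse G) (hG : Holds G)
    (hV : Fintype.card V = 15) (hJ : (bound G v).Nonempty) (hd : #(nbr G v) = 6)
    (hi : #(free G v) = 4) (hR₀ : #(rest₀ G v) = 3) : darts G univ univ ≤ 76 := by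
  obtain ⟨h9, h10, h11, h12, h13, h14, h15, h16⟩ := hG.counts hV v
  have h17 := hG.darts_rest_nbr_of_two_le (v := v) (by omega)
  have h18 := darts_self_le (G := G) (rest₀ G v)
  have h19 := hG.darts_of_card_eq_eight (S := far G v) (by omega)
  have h20 := darts_nbr_le (G := G) (v := v)
  have h21 := hG.darts_add_darts_le hi (by omega) hR₀ (hP.adj_of_card_free_eq_four hJ hi)
  rw [show #(bound G v) = 2 by omega] at h20
  rw [hi] at h17 h12
  rw [hR₀] at h18 h11
  rcases hP.rest_cases hG (v := v) with ⟨-, h22, h23⟩ | ⟨h22, h23, h24⟩ <;> omega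

/-! ### The remaining cases -/

set_option maxHeartbeats 800000 in
theorem NoSparse.darts_univ_le_of_two_le_card_rest₀ (hP : NoSparse G) (hG : Holds G)
    (hV : Fintype.card V = 15) (hd : 6 ≤ #(nbr G v)) (hΔ : ∀ x, degOn G univ x ≤ #(nbr G v))
    (hJ : (bound G v).Nonempty) (hi : 3 ≤ #(free G v)) (hR₀ : 2 ≤ #(rest₀ G v)) :
    darts G univ univ ≤ 76 := by
  have h2 := hP.card_free_le_four hJ (card_pos.1 (by omega))
  obtain ⟨h9, h10, h11, h12, h13, h14, h15, h16⟩ := hG.counts hV v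
  have h17 := hG.darts_rest_nbr_of_two_le (v := v) (by omega)
  have h18 := darts_self_le (G := G) (rest₀ G v)
  have h19 := darts_self_le (G := G) (far G v)
  have h20 := darts_rest_add_le hΔ
  have h21 := hG.darts_of_card_eq_six (S := far G v)
  have h22 := hG.darts_of_card_eq_seven (S := far G v)
  have h23 := hG.darts_of_card_eq_eight (S := far G v)
  have h24 := darts_nbr_le (G := G) (v := v)
  have h25 := hP.darts_univ_le_of_seven_four_two hG hV hJ
  have h26 := hP.darts_univ_le_of_six_four_two hG hV hJ
  have h27 := hP.darts_univ_le_of_six_three_two hG hV hJ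
  have h28 := hP.darts_univ_le_of_six_three_three hG hV hJ
  have h29 := hP.darts_univ_le_of_six_four_three hG hV hJ
  clear hΔ
  generalize #(free G v) = i at *
  generalize #(nbr G v) = d at *
  generalize #(bound G v) = j at *
  generalize #(rest₀ G v) = r₀ at *
  generalize #(far G v) = r at *
  obtain rfl : j = d - i := by omega
  obtain rfl : r = 14 - d := by omega
  have h30 : d ≤ 12 := by omega
  have h31 : r₀ ≤ 8 := by omega
  interval_cases i <;> interval_cases d <;> simp only [Nat.reduceSub, Nat.reduceMul] at h19 h24 <;>
    interval_cases r₀ <;> omega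

theorem NoSparse.darts_univ_le (hP : NoSparse G) (hG : Holds G) (hV : Fintype.card V = 15) :
    darts G univ univ ≤ 76 := by
  have : Nonempty V := Fintype.card_pos_iff.1 (by omega)
  obtain ⟨v, -, hv⟩ := exists_max_image univ (degOn G univ) univ_nonempty
  have hΔ : ∀ x, degOn G univ x ≤ #(nbr G v) := fun x => hv x (mem_univ x)
  rcases Nat.lt_or_ge #(nbr G v) 6 with hd | hd
  · have h : darts G univ univ ≤ #(univ : Finset V) • 5 :=
      sum_le_card_nsmul _ _ _ fun x _ => (hΔ x).trans (Nat.le_of_lt_succ hd)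
    rw [card_univ, hV, smul_eq_mul] at h
    omega
  rcases Nat.lt_or_ge #(free G v) 3 with hi | hi
  · exact hG.darts_univ_le_of_card_free_le_two hV hd (Nat.le_of_lt_succ hi)
  rcases (bound G v).eq_empty_or_nonempty with hJ | hJ
  · exact hP.darts_univ_le_of_bound_eq_empty hG hV hd hJ
  rcases Nat.lt_or_ge #(rest₀ G v) 2 with hR₀ | hR₀
  · rcases (rest₀ G v).eq_empty_or_nonempty with h | h
    · exact hP.darts_univ_le_of_rest₀_eq_empty hG hV hd hJ hi h
    · have := card_pos.2 h
      exact hP.darts_univ_le_of_card_rest₀_eq_one hG hV hd hΔ hJ hi (by omega)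
  · exact hP.darts_univ_le_of_two_le_card_rest₀ hG hV hd hΔ hJ hi hR₀

end

end PentagonFree

namespace ThreeColoring

open Finset PentagonFree CycleSearch

section

open scoped Classical

/-! ### Transferring graphs to the natural numbers -/

variable {n : ℕ} {V : Type*} (g : Fin n ↪ V) (H : SimpleGraph V)

def onNat : SimpleGraph ℕ := (H.comap g).map Fin.valEmbedding

variable {g H}

theorem onNat_adj {a b : ℕ} :
    (onNat g H).Adj a b ↔ ∃ i j : Fin n, H.Adj (g i) (g j) ∧ i.val = a ∧ j.val = b := by
  simp only [onNat, SimpleGraph.map_adj, SimpleGraph.comap_adj]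
  rfl

theorem onNat_adj_val {i j : Fin n} : (onNat g H).Adj i j ↔ H.Adj (g i) (g j) := by
  rw [onNat_adj]
  refine ⟨?_, fun h => ⟨i, j, h, rfl, rfl⟩⟩
  rintro ⟨i', j', h, hi, hj⟩
  rwa [Fin.ext hi, Fin.ext hj] at h

theorem lt_of_onNat_adj (a b : ℕ) (h : (onNat g H).Adj a b) : a < n := by
  obtain ⟨i, -, -, rfl, -⟩ := onNat_adj.1 h
  exact i.isLt

theorem sum_degIn_onNat : ∑ z ∈ range n, degIn (onNat g H) (range n) z =
    darts H (univ.map g) (univ.map g) := by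
  rw [sum_range, darts, sum_map]
  refine sum_congr rfl fun i _ => ?_
  have h : (range n).filter ((onNat g H).Adj i) =
      ((univ : Finset (Fin n)).filter fun j => H.Adj (g i) (g j)).map Fin.valEmbedding := by
    ext b
    simp only [mem_filter, mem_range, mem_map, mem_univ, true_and, Fin.valEmbedding_apply]
    constructor
    · rintro ⟨hb, h⟩
      exact ⟨⟨b, hb⟩, (onNat_adj_val (j := ⟨b, hb⟩)).1 h, rfl⟩
    · rintro ⟨j, h, rfl⟩
      exact ⟨j.isLt, onNat_adj_val.2 h⟩
  rw [degIn, degOn, filter_map, card_map]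
  convert congrArg card h using 1
  rw [card_map]
  rfl

/-! ### Cycles -/

theorem hasCopy_cycleGraph {m : ℕ} (f : Fin (m + 2) → V) (hf : Function.Injective f)
    (h : ∀ i, H.Adj (f i) (f (i + 1))) : HasCopy H (SimpleGraph.cycleGraph (m + 2)) := by
  refine ⟨⟨f, hf⟩, fun a b hab => ?_⟩
  rw [SimpleGraph.cycleGraph_adj] at hab
  rcases hab with hab | hab <;> rw [sub_eq_iff_eq_add'] at hab <;> subst hab
  · exact (h b).symm
  · exact h a

theorem hasCopy_of_hasHexagon (h : HasHexagon (onNat g H)) : HasCopy H (SimpleGraph.cycleGraph 6) := by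
  obtain ⟨a, b, c, d, e, f, hn, h1, h2, h3, h4, h5, h6⟩ := h
  lift a to Fin n using lt_of_onNat_adj _ _ h1
  lift b to Fin n using lt_of_onNat_adj _ _ h2
  lift c to Fin n using lt_of_onNat_adj _ _ h3
  lift d to Fin n using lt_of_onNat_adj _ _ h4
  lift e to Fin n using lt_of_onNat_adj _ _ h5
  lift f to Fin n using lt_of_onNat_adj _ _ h6
  rw [onNat_adj_val] at h1 h2 h3 h4 h5 h6
  refine hasCopy_cycleGraph (m := 4) (g ∘ ![a, b, c, d, e, f]) (g.injective.comp ?_) ?_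
  · rw [← List.nodup_ofFn]
    have := List.Nodup.of_map (f := Fin.val) (l := [a, b, c, d, e, f]) hn
    simpa using this
  · intro i
    fin_cases i <;> assumption

theorem holds_of_not_hasCopy (h : ¬ HasCopy H (SimpleGraph.cycleGraph 5)) : Holds H := by
  intro a b c d e hab hbc hcd hde hea hac hbd hce hda heb
  refine h (hasCopy_cycleGraph (m := 3) ![a, b, c, d, e] ?_ ?_)
  · rw [← List.nodup_ofFn]
    simp [hab.ne, hbc.ne, hcd.ne, hde.ne, hea.ne', hac, hbd, hce, hda.symm, heb.symm]
  · intro i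
    fin_cases i <;> assumption

/-! ### Counting -/

theorem sum_darts_colorGraph [DecidableEq V] (c : Sym2 V → Fin 3) (S : Finset V) :
    darts (colorGraph c 0) S S + darts (colorGraph c 1) S S + darts (colorGraph c 2) S S =
      #S * (#S - 1) := by
  rw [darts, darts, darts, ← sum_add_distrib, ← sum_add_distrib, ← smul_eq_mul, ← sum_const]
  refine sum_congr rfl fun x hx => ?_
  rw [← card_erase_of_mem hx]
  have h : ∀ i, degOn (colorGraph c i) S x = #{y ∈ S.erase x | c s(x, y) = i} := by
    intro i
    rw [degOn]
    congr 1
    ext y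
    simp only [mem_filter, mem_erase, colorGraph, SimpleGraph.fromRel_adj, Sym2.eq_swap (a := y), or_self,
      ne_comm (a := x)]
    tauto
  have h' := card_eq_sum_card_fiberwise (s := S.erase x) (f := fun y => c s(x, y)) (t := univ)
    fun _ _ => mem_coe.2 (mem_univ _)
  rw [h, h, h, h', Fin.sum_univ_three]

theorem darts_le_two_of_onlyEdge [DecidableEq V] {S : Finset V} {x y : V} (h : OnlyEdge H S x y) :
    darts H S S ≤ 2 := by
  have h1 : ∀ a ∈ S, degOn H S a ≤ if a ∈ ({x, y} : Finset V) then 1 else 0 := by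
    intro a ha
    split_ifs with hxy
    · refine card_le_one.2 fun b hb b' hb' => ?_
      rw [mem_filter] at hb hb'
      have h2 := h a ha b hb.1 hb.2
      have h3 := h a ha b' hb'.1 hb'.2
      grind
    · refine (degOn_eq_zero.2 fun b hb hab => ?_).le
      rw [mem_insert, mem_singleton] at hxy
      have := h a ha b hb hab
      tauto
  refine (sum_le_sum h1).trans ?_
  rw [sum_ite_mem, sum_const, smul_eq_mul, mul_one]
  exact (card_le_card inter_subset_right).trans card_le_two

theorem adj_cases (c : Sym2 V → Fin 3) {x y : V} (hxy : x ≠ y) (h : ¬ (colorGraph c 0).Adj x y) :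
    (colorGraph c 1).Adj x y ∨ (colorGraph c 2).Adj x y := by
  simp only [colorGraph, SimpleGraph.fromRel_adj, Sym2.eq_swap (a := y), or_self] at h ⊢
  have : ∀ i : Fin 3, i ≠ 0 → i = 1 ∨ i = 2 := by decide
  have := this (c s(x, y))
  tauto

theorem almostCovers_onNat {c : Sym2 V → Fin 3} {g : Fin 8 ↪ V} {x y : V}
    (h : OnlyEdge (colorGraph c 0) (univ.map g) x y) :
    AlmostCovers (onNat g (colorGraph c 1)) (onNat g (colorGraph c 2)) := by
  have key : ∀ i j : Fin 8, i ≠ j → ¬ (colorGraph c 0).Adj (g i) (g j) →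
      (onNat g (colorGraph c 1)).Adj i j ∨ (onNat g (colorGraph c 2)).Adj i j := by
    intro i j hij h'
    rw [onNat_adj_val, onNat_adj_val]
    exact adj_cases c (g.injective.ne hij) h'
  by_cases hxy : ∃ i j : Fin 8, (colorGraph c 0).Adj (g i) (g j)
  · obtain ⟨i, j, hij⟩ := hxy
    wlog hlt : i < j generalizing i j
    · exact this j i hij.symm (lt_of_le_of_ne (not_lt.1 hlt) fun h => hij.ne (by rw [h]))
    refine ⟨i, j, hlt, j.isLt, fun a b ha hb hab h1 h2 => ?_⟩
    lift a to Fin 8 using ha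
    lift b to Fin 8 using hb
    refine key a b (fun h => hab (by rw [h])) fun hadj => ?_
    have h3 := h _ (mem_map_of_mem g (mem_univ i)) _ (mem_map_of_mem g (mem_univ j)) hij
    have h4 := h _ (mem_map_of_mem g (mem_univ a)) _ (mem_map_of_mem g (mem_univ b)) hadj
    have h5 : (g a = g i ∧ g b = g j) ∨ (g a = g j ∧ g b = g i) := by grind
    simp only [g.injective.eq_iff] at h5
    grind
  · push Not at hxy
    refine ⟨0, 1, by decide, by decide, fun a b ha hb hab _ _ => ?_⟩
    lift a to Fin 8 using ha
    lift b to Fin 8 using hb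
    exact key a b (fun h => hab (by rw [h])) (hxy a b)

theorem noSparse_of_not_hasCopy [Fintype V] {c : Sym2 V → Fin 3}
    (h1 : ¬ HasCopy (colorGraph c 1) (SimpleGraph.cycleGraph 6))
    (h2 : ¬ HasCopy (colorGraph c 2) (SimpleGraph.cycleGraph 6)) : NoSparse (colorGraph c 0) := by
  intro S x y hS
  by_contra! hlt
  obtain ⟨T, hTS, hT⟩ := exists_subset_card_eq (n := 8) hlt
  obtain ⟨g, hg⟩ : ∃ g : Fin 8 ↪ V, univ.map g = T := by
    refine ⟨(T.equivFinOfCardEq hT).symm.toEmbedding.trans (Function.Embedding.subtype _), ?_⟩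
    rw [← Finset.map_map, map_univ_equiv, univ_eq_attach, attach_map_val]
  have hT' : OnlyEdge (colorGraph c 0) (univ.map g) x y := fun a ha b hb =>
    hS a (hTS (hg ▸ ha)) b (hTS (hg ▸ hb))
  have h3 := almostCovers_onNat hT'
  have h4 := sum_darts_colorGraph c (univ.map g)
  have h5 := darts_le_two_of_onlyEdge hT'
  obtain ⟨k, hk⟩ := darts_even (G := colorGraph c 1) (univ.map g)
  have h6 := hasHexagon_of_sum_degIn lt_of_onNat_adj h3
  have h7 := hasHexagon_of_sum_degIn lt_of_onNat_adj h3.symm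
  rw [sum_degIn_onNat] at h6 h7
  have h8 : ¬ HasHexagon (onNat g (colorGraph c 1)) := fun h => h1 (hasCopy_of_hasHexagon h)
  have h9 : ¬ HasHexagon (onNat g (colorGraph c 2)) := fun h => h2 (hasCopy_of_hasHexagon h)
  rw [card_map, card_univ, Fintype.card_fin] at h4
  rcases Nat.lt_or_ge (darts (colorGraph c 1) (univ.map g) (univ.map g)) 28 with h | h
  · exact (h7 (by omega)).elim h9 h8
  · exact (h6 h).elim h8 h9

theorem darts_univ_lt {H : SimpleGraph (Fin 15)} (h : ¬ HasCopy H (SimpleGraph.cycleGraph 6)) :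
    darts H univ univ ≤ 66 := by
  have h1 := sum_degIn_lt_of_not_hasHexagon (H := onNat (Function.Embedding.refl _) H) lt_of_onNat_adj
    fun h' => h (hasCopy_of_hasHexagon h')
  obtain ⟨k, hk⟩ := darts_even (G := H) univ
  rw [sum_degIn_onNat, map_refl] at h1
  omega

end

end ThreeColoring

/-- Every 3-coloring of the edges of `K₁₅` contains a 5-cycle in color 0 or a 6-cycle in
color 1 or color 2; i.e. `R(C₅, C₆, C₆) ≤ 15`. -/
theorem ramsey_C5_C6_C6_le_15 :
    ∀ c : Sym2 (Fin 15) → Fin 3,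
      HasCopy (colorGraph c 0) (SimpleGraph.cycleGraph 5) ∨
      HasCopy (colorGraph c 1) (SimpleGraph.cycleGraph 6) ∨
      HasCopy (colorGraph c 2) (SimpleGraph.cycleGraph 6) := by
  classical
  intro c
  by_contra! h
  obtain ⟨h0, h1, h2⟩ := h
  have h3 := (ThreeColoring.noSparse_of_not_hasCopy h1 h2).darts_univ_le
    (ThreeColoring.holds_of_not_hasCopy h0) (Fintype.card_fin 15)
  have h4 := ThreeColoring.darts_univ_lt h1
  have h5 := ThreeColoring.darts_univ_lt h2
  have h6 := ThreeColoring.sum_darts_colorGraph c Finset.univ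
  rw [Finset.card_univ, Fintype.card_fin] at h6
  have h7 : PentagonFree.darts (colorGraph c 0) Finset.univ Finset.univ ≤ 76 := by convert h3
  omega
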